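/- arXiv:2107.05912 — 12 statements merged into one kernel-verified Lean document; each statement's English description precedes it below -/
import Mathlib

section
/- Strong epimorphism-surjectivity for Heyting algebras: if A is a subset of a Heyting algebra B containing ⊤ and ⊥ and closed under ⊓, ⊔ and ⇨ (a Heyting subalgebra), and b ∈ B with b ∉ A, then there exist a Heyting algebra D and Heyting homomorphisms f, g : B → D such that f(a) = g(a) for all a ∈ A but f(b) ≠ g(b). -/
/-!
STATEMENT 0: Strong epimorphism-surjectivity for Heyting algebras: if `A` is a
Heyting subalgebra of a Heyting algebra `B` (a subset containing `⊤` and `⊥` and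
closed under `⊓`, `⊔` and `⇨`), and `b ∈ B` with `b ∉ A`, then there are a Heyting
algebra `D` and Heyting homomorphisms `f g : B → D` agreeing on `A` with `f b ≠ g b`.
-/

universe u

open Order

/-- In a distributive lattice, a meet-closed set and a join-closed set such that no element of the
first lies below an element of the second are separated by a prime ideal. -/
theorem exists_isPrime_ideal_of_infClosed_supClosed {α : Type*} [DistribLattice α] [BoundedOrder α]
    {S T : Set α} (hS : InfClosed S) (hT : SupClosed T) (hS₀ : S.Nonempty) (hT₀ : T.Nonempty)
    (hST : ∀ s ∈ S, ∀ t ∈ T, ¬ s ≤ t) :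
    ∃ J : Ideal α, J.IsPrime ∧ (∀ s ∈ S, s ∉ J) ∧ ∀ t ∈ T, t ∈ J := by
  have hF : IsPFilter (upperClosure S : Set α) := by
    refine .of_def (hS₀.mono subset_upperClosure) ?_ fun h hx => (upperClosure S).upper h hx
    rintro x ⟨s, hs, hsx⟩ y ⟨t, ht, hty⟩
    exact ⟨s ⊓ t, subset_upperClosure (hS hs ht), inf_le_left.trans hsx, inf_le_right.trans hty⟩
  have hI : IsIdeal (lowerClosure T : Set α) := by
    refine ⟨(lowerClosure T).lower, hT₀.mono subset_lowerClosure, ?_⟩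
    rintro x ⟨s, hs, hxs⟩ y ⟨t, ht, hyt⟩
    exact ⟨s ⊔ t, subset_lowerClosure (hT hs ht), hxs.trans le_sup_left, hyt.trans le_sup_right⟩
  obtain ⟨J, hJ, hIJ, hFJ⟩ := DistribLattice.prime_ideal_of_disjoint_filter_ideal
    (F := hF.toPFilter) (I := hI.toIdeal) (by
      rw [Set.disjoint_left]
      rintro x ⟨s, hs, hsx⟩ ⟨t, ht, hxt⟩
      exact hST s hs t ht (hsx.trans hxt))
  exact ⟨J, hJ, fun s hs => Set.disjoint_left.1 hFJ (subset_upperClosure hs),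
    fun t ht => hIJ (subset_lowerClosure ht)⟩

section

variable {B : Type*} [HeytingAlgebra B]

theorem Order.Ideal.IsPrime.exists_le_of_himp_mem {I : Ideal B} (hI : I.IsPrime) {x y : B}
    (h : x ⇨ y ∈ I) : ∃ J : Ideal B, J.IsPrime ∧ J ≤ I ∧ x ∉ J ∧ y ∈ J := by
  obtain ⟨J, hJ, hSJ, hTJ⟩ := exists_isPrime_ideal_of_infClosed_supClosed
    (S := {z | x ⇨ z ∉ I}) (T := {y})
    (by
      intro s hs t ht hst
      rw [himp_inf_distrib] at hst
      exact (hI.mem_or_mem hst).elim hs ht)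
    supClosed_singleton
    ⟨⊤, by simpa using Ideal.isProper_iff_top_notMem.1 hI.toIsProper⟩
    (Set.singleton_nonempty y)
    (by
      rintro s hs _ rfl hsy
      exact hs (I.lower (himp_le_himp_left hsy) h))
  refine ⟨J, hJ, fun z hz => ?_, ?_, hTJ y rfl⟩
  · by_contra hzI
    exact hSJ z (fun h' => hzI (I.lower le_himp h')) hz
  · exact hSJ x (by simpa using Ideal.isProper_iff_top_notMem.1 hI.toIsProper)

/-- Two ideals have the same trace on a set. -/
def SameTrace (A : Set B) (I J : Ideal B) : Prop := ∀ a ∈ A, a ∈ I ↔ a ∈ J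

theorem SameTrace.symm {A : Set B} {I J : Ideal B} (h : SameTrace A I J) : SameTrace A J I :=
  fun a ha => (h a ha).symm

/-- Prime ideals below `I` lift along a pair of prime ideals with the same trace on a
subalgebra. -/
theorem SameTrace.exists_le {A : Set B} (htop : (⊤ : B) ∈ A) (hbot : (⊥ : B) ∈ A)
    (hinf : InfClosed A) (hsup : SupClosed A) (hhimp : ∀ x ∈ A, ∀ y ∈ A, x ⇨ y ∈ A)
    {I J I' : Ideal B} (hIJ : SameTrace A I J) (hJ : J.IsPrime) (hI' : I'.IsPrime) (hle : I' ≤ I) :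
    ∃ J' : Ideal B, J'.IsPrime ∧ J' ≤ J ∧ SameTrace A I' J' := by
  have hI'top := Ideal.isProper_iff_top_notMem.1 hI'.toIsProper
  have hJtop := Ideal.isProper_iff_top_notMem.1 hJ.toIsProper
  obtain ⟨J', hJ', hSJ, hTJ⟩ := exists_isPrime_ideal_of_infClosed_supClosed
    (S := {x | ∃ a ∈ A, a ∉ I' ∧ ∃ z, z ∉ J ∧ x = z ⊓ a}) (T := A ∩ {a | a ∈ I'})
    (by
      rintro _ ⟨a, haA, ha, z, hz, rfl⟩ _ ⟨c, hcA, hc, w, hw, rfl⟩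
      exact ⟨a ⊓ c, hinf haA hcA, fun h => (hI'.mem_or_mem h).elim ha hc, z ⊓ w,
        fun h => (hJ.mem_or_mem h).elim hz hw, inf_inf_inf_comm z a w c⟩)
    (fun a ha c hc => ⟨hsup ha.1 hc.1, Ideal.sup_mem ha.2 hc.2⟩)
    ⟨⊤ ⊓ ⊤, ⊤, htop, hI'top, ⊤, hJtop, rfl⟩ ⟨⊥, hbot, I'.bot_mem⟩
    (by
      rintro _ ⟨a, haA, ha, z, hz, rfl⟩ i ⟨hiA, hi⟩ hle'
      have himpI' : a ⇨ i ∈ I' :=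
        (hI'.mem_or_mem (I'.lower inf_himp_le hi)).resolve_left ha
      exact hz (J.lower (le_himp_iff.2 hle') ((hIJ _ (hhimp a haA i hiA)).1 (hle himpI'))))
  refine ⟨J', hJ', fun z hz => ?_, fun a haA => ⟨fun ha => hTJ a ⟨haA, ha⟩, fun ha => ?_⟩⟩
  · by_contra hzJ
    exact hSJ z ⟨⊤, htop, hI'top, z, hzJ, (inf_top_eq z).symm⟩ hz
  · by_contra haI
    exact hSJ a ⟨a, haA, haI, ⊤, hJtop, (top_inf_eq a).symm⟩ ha

/-- A bounded morphism `π` from a preorder to the prime ideals of a Heyting algebra induces a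
Heyting homomorphism into the lower sets of the preorder. -/
def heytingHomOfBoundedMorphism {X : Type*} [Preorder X] (π : X → Ideal B) (hπ : Monotone π)
    (hprime : ∀ x, (π x).IsPrime)
    (hlift : ∀ x (I : Ideal B), I.IsPrime → I ≤ π x → ∃ x' ≤ x, π x' = I) :
    HeytingHom B (LowerSet X) where
  toFun b := ⟨{x | b ∉ π x}, fun _ _ hle hb h => hb (hπ hle h)⟩
  map_sup' b c := by
    ext x
    change b ⊔ c ∉ π x ↔ b ∉ π x ∨ c ∉ π x
    rw [Ideal.sup_mem_iff, not_and_or]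
  map_inf' b c := by
    ext x
    change b ⊓ c ∉ π x ↔ b ∉ π x ∧ c ∉ π x
    rw [← not_or, not_iff_not]
    exact ⟨(hprime x).mem_or_mem,
      fun h => h.elim ((π x).lower inf_le_left) ((π x).lower inf_le_right)⟩
  map_bot' := by
    ext x
    exact iff_of_false (fun h => h (π x).bot_mem) id
  map_himp' b c := by
    apply le_antisymm
    · rw [le_himp_iff]
      rintro x ⟨hx, hb⟩ hc
      exact ((hprime x).mem_or_mem ((π x).lower inf_himp_le hc)).elim hb hx
    · intro x hx hbc
      obtain ⟨I, hI, hle, hb, hc⟩ := (hprime x).exists_le_of_himp_mem hbc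
      obtain ⟨x', hx', rfl⟩ := hlift x I hI hle
      exact himp_inf_le (α := LowerSet X) ⟨LowerSet.lower _ hx' hx, hb⟩ hc

theorem exists_sameTrace_separating {A : Set B} (htop : (⊤ : B) ∈ A) (hbot : (⊥ : B) ∈ A)
    (hinf : InfClosed A) (hsup : SupClosed A) (hhimp : ∀ x ∈ A, ∀ y ∈ A, x ⇨ y ∈ A)
    {b : B} (hb : b ∉ A) :
    ∃ I J : Ideal B, I.IsPrime ∧ J.IsPrime ∧ SameTrace A I J ∧ b ∉ I ∧ b ∈ J := by
  obtain ⟨J, hJ, hSJ, hTJ⟩ := exists_isPrime_ideal_of_infClosed_supClosed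
    (S := {a | a ∈ A ∧ b ≤ a}) (T := {b})
    (fun a ha c hc => ⟨hinf ha.1 hc.1, le_inf ha.2 hc.2⟩) supClosed_singleton
    ⟨⊤, htop, le_top⟩ (Set.singleton_nonempty b)
    (by
      rintro a ⟨haA, hba⟩ _ rfl hab
      exact hb (hab.antisymm hba ▸ haA))
  have hJtop := Ideal.isProper_iff_top_notMem.1 hJ.toIsProper
  obtain ⟨I, hI, hSI, hTI⟩ := exists_isPrime_ideal_of_infClosed_supClosed
    (S := {x | ∃ a ∈ A, a ∉ J ∧ x = b ⊓ a}) (T := A ∩ {a | a ∈ J})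
    (by
      rintro _ ⟨a, haA, ha, rfl⟩ _ ⟨c, hcA, hc, rfl⟩
      exact ⟨a ⊓ c, hinf haA hcA, fun h => (hJ.mem_or_mem h).elim ha hc,
        (inf_inf_distrib_left b a c).symm⟩)
    (fun a ha c hc => ⟨hsup ha.1 hc.1, Ideal.sup_mem ha.2 hc.2⟩)
    ⟨b ⊓ ⊤, ⊤, htop, hJtop, rfl⟩ ⟨⊥, hbot, J.bot_mem⟩
    (by
      rintro _ ⟨a, haA, ha, rfl⟩ i ⟨hiA, hi⟩ hle
      have hJimp : a ⇨ i ∉ J := hSJ _ ⟨hhimp a haA i hiA, le_himp_iff.2 hle⟩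
      exact (hJ.mem_or_mem (J.lower inf_himp_le hi)).elim ha hJimp)
  refine ⟨I, J, hI, hJ, fun a haA => ⟨fun ha => ?_, fun ha => hTI a ⟨haA, ha⟩⟩, fun h => ?_,
    hTJ b rfl⟩
  · by_contra haJ
    exact hSI _ ⟨a, haA, haJ, rfl⟩ (I.lower inf_le_right ha)
  · exact hSI _ ⟨⊤, htop, hJtop, rfl⟩ (I.lower inf_le_left h)

end

theorem strong_es_heyting {B : Type u} [HeytingAlgebra B] (A : Set B)
    (htop : (⊤ : B) ∈ A) (hbot : (⊥ : B) ∈ A)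
    (hinf : ∀ x ∈ A, ∀ y ∈ A, x ⊓ y ∈ A)
    (hsup : ∀ x ∈ A, ∀ y ∈ A, x ⊔ y ∈ A)
    (hhimp : ∀ x ∈ A, ∀ y ∈ A, x ⇨ y ∈ A)
    (b : B) (hb : b ∉ A) :
    ∃ (D : HeytAlg.{u}) (f g : HeytingHom B D),
      (∀ a ∈ A, f a = g a) ∧ f b ≠ g b := by
  have hinf' : InfClosed A := fun x hx y hy => hinf x hx y hy
  have hsup' : SupClosed A := fun x hx y hy => hsup x hx y hy
  let X := {p : Ideal B × Ideal B // p.1.IsPrime ∧ p.2.IsPrime ∧ SameTrace A p.1 p.2}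
  let f : HeytingHom B (LowerSet X) :=
    heytingHomOfBoundedMorphism (fun p => p.1.1) (fun _ _ h => h.1) (fun p => p.2.1) (by
      rintro ⟨⟨I, J⟩, _, hJ, hIJ⟩ I' hI' hle
      obtain ⟨J', hJ', hle', h⟩ := hIJ.exists_le htop hbot hinf' hsup' hhimp hJ hI' hle
      exact ⟨⟨(I', J'), hI', hJ', h⟩, ⟨hle, hle'⟩, rfl⟩)
  let g : HeytingHom B (LowerSet X) :=
    heytingHomOfBoundedMorphism (fun p => p.1.2) (fun _ _ h => h.2) (fun p => p.2.2.1) (by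
      rintro ⟨⟨I, J⟩, hI, _, hIJ⟩ J' hJ' hle
      obtain ⟨I', hI', hle', h⟩ := hIJ.symm.exists_le htop hbot hinf' hsup' hhimp hI hJ' hle
      exact ⟨⟨(I', J'), hI', hJ', h.symm⟩, ⟨hle', hle⟩, rfl⟩)
  refine ⟨HeytAlg.of (LowerSet X), f, g, fun a ha => ?_, fun h => ?_⟩
  · refine LowerSet.ext (Set.ext fun p => ?_)
    exact not_congr (p.2.2.2 a ha)
  · obtain ⟨I, J, hI, hJ, hIJ, hbI, hbJ⟩ :=
      exists_sameTrace_separating htop hbot hinf' hsup' hhimp hb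
    let p : X := ⟨(I, J), hI, hJ, hIJ⟩
    have hp : p ∈ (f b : LowerSet X) := hbI
    exact (h ▸ hp : p ∈ (g b : LowerSet X)) hbJ
end

section
/- Strong epimorphism-surjectivity for Brouwerian algebras: if A is a subset of a Brouwerian algebra B containing ⊤ and closed under ⊓, ⊔ and ⇨ (a Brouwerian subalgebra), and b ∈ B with b ∉ A, then there exist a Brouwerian algebra D and Brouwerian homomorphisms f, g : B → D such that f(a) = g(a) for all a ∈ A but f(b) ≠ g(b). -/
/-!
STATEMENT 1: Strong epimorphism-surjectivity for Brouwerian algebras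
(= generalized Heyting algebras).
-/

universe u

/-- A bundled Brouwerian algebra (= generalized Heyting algebra). -/
structure BrouwerianAlgebra : Type (u + 1) where
  carrier : Type u
  [str : GeneralizedHeytingAlgebra carrier]

instance : CoeSort BrouwerianAlgebra.{u} (Type u) :=
  ⟨BrouwerianAlgebra.carrier⟩

instance (D : BrouwerianAlgebra.{u}) : GeneralizedHeytingAlgebra D := D.str

/-- A Brouwerian homomorphism: a map preserving `⊓`, `⊔`, `⇨` and `⊤`. -/
structure IsBrouwerianHom {α : Type*} {β : Type*} [GeneralizedHeytingAlgebra α]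
    [GeneralizedHeytingAlgebra β] (f : α → β) : Prop where
  map_inf : ∀ x y, f (x ⊓ y) = f x ⊓ f y
  map_sup : ∀ x y, f (x ⊔ y) = f x ⊔ f y
  map_himp : ∀ x y, f (x ⇨ y) = f x ⇨ f y
  map_top : f ⊤ = ⊤

/-- A filter of a lattice with top, possibly improper. -/
structure IsLatticeFilter_s1 {B : Type*} [GeneralizedHeytingAlgebra B] (P : Set B) : Prop where
  top_mem : ⊤ ∈ P
  inf_mem : ∀ {x y}, x ∈ P → y ∈ P → x ⊓ y ∈ P
  mem_of_le : ∀ {x y}, x ≤ y → x ∈ P → y ∈ P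

/-- A prime filter of a lattice with top, possibly improper. -/
structure IsPrimeLatticeFilter {B : Type*} [GeneralizedHeytingAlgebra B] (P : Set B) : Prop
    extends IsLatticeFilter_s1 P where
  mem_or_mem : ∀ {x y}, x ⊔ y ∈ P → x ∈ P ∨ y ∈ P

section PrimeFilters

variable {B : Type*} [GeneralizedHeytingAlgebra B]

theorem isLatticeFilter_Ici (b : B) : IsLatticeFilter_s1 (Set.Ici b) where
  top_mem := le_top
  inf_mem := le_inf
  mem_of_le h hx := le_trans hx h

/-- The filter generated by a filter and an inf-closed set containing the top element. -/
theorem IsLatticeFilter_s1.join {F S : Set B} (hF : IsLatticeFilter_s1 F) (htop : ⊤ ∈ S)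
    (hinf : ∀ x ∈ S, ∀ y ∈ S, x ⊓ y ∈ S) :
    IsLatticeFilter_s1 {z | ∃ p ∈ F, ∃ s ∈ S, p ⊓ s ≤ z} where
  top_mem := ⟨⊤, hF.top_mem, ⊤, htop, le_top⟩
  inf_mem := by
    rintro x y ⟨p, hp, s, hs, h⟩ ⟨q, hq, t, ht, h'⟩
    refine ⟨p ⊓ q, hF.inf_mem hp hq, s ⊓ t, hinf s hs t ht, ?_⟩
    rw [inf_inf_inf_comm]
    exact inf_le_inf h h'
  mem_of_le := by
    rintro x y hxy ⟨p, hp, s, hs, h⟩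
    exact ⟨p, hp, s, hs, h.trans hxy⟩

theorem IsLatticeFilter_s1.adjoin {F : Set B} (hF : IsLatticeFilter_s1 F) (x : B) :
    IsLatticeFilter_s1 {z | ∃ p ∈ F, p ⊓ x ≤ z} where
  top_mem := ⟨⊤, hF.top_mem, le_top⟩
  inf_mem := by
    rintro y z ⟨p, hp, h⟩ ⟨q, hq, h'⟩
    refine ⟨p ⊓ q, hF.inf_mem hp hq, le_inf ?_ ?_⟩
    · exact (inf_le_inf_right x inf_le_left).trans h
    · exact (inf_le_inf_right x inf_le_right).trans h'
  mem_of_le := by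
    rintro y z hyz ⟨p, hp, h⟩
    exact ⟨p, hp, h.trans hyz⟩

/-- Prime filter separation: a filter disjoint from a sup-closed (possibly empty) set extends to a
prime filter disjoint from it. -/
theorem IsLatticeFilter_s1.exists_prime {F I : Set B} (hF : IsLatticeFilter_s1 F)
    (hI : ∀ x ∈ I, ∀ y ∈ I, x ⊔ y ∈ I) (hFI : ∀ x ∈ F, x ∉ I) :
    ∃ P, IsPrimeLatticeFilter P ∧ F ⊆ P ∧ ∀ x ∈ P, x ∉ I := by
  obtain ⟨G, hFG, hG⟩ := zorn_subset_nonempty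
    {G : Set B | IsLatticeFilter_s1 G ∧ ∀ x ∈ G, x ∉ I} (by
      rintro c hc hchain ⟨G₀, hG₀⟩
      refine ⟨⋃₀ c, ⟨⟨⟨G₀, hG₀, (hc hG₀).1.top_mem⟩, ?_, ?_⟩, ?_⟩,
        fun s hs => Set.subset_sUnion_of_mem hs⟩
      · rintro x y ⟨s, hs, hx⟩ ⟨t, ht, hy⟩
        rcases hchain.total hs ht with h | h
        · exact ⟨t, ht, (hc ht).1.inf_mem (h hx) hy⟩
        · exact ⟨s, hs, (hc hs).1.inf_mem hx (h hy)⟩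
      · rintro x y hxy ⟨s, hs, hx⟩
        exact ⟨s, hs, (hc hs).1.mem_of_le hxy hx⟩
      · rintro x ⟨s, hs, hx⟩
        exact (hc hs).2 x hx) F ⟨hF, hFI⟩
  have meets : ∀ x, x ∉ G → ∃ g ∈ G, ∃ i ∈ I, g ⊓ x ≤ i := by
    intro x hx
    by_contra! h
    refine hx (hG.le_of_ge (y := {z | ∃ p ∈ G, p ⊓ x ≤ z}) ⟨hG.prop.1.adjoin x, ?_⟩ ?_ ?_)
    · rintro z ⟨p, hp, hz⟩ hzI
      exact h p hp z hzI hz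
    · exact fun z hz => ⟨z, hz, inf_le_left⟩
    · exact ⟨⊤, hG.prop.1.top_mem, inf_le_right⟩
  refine ⟨G, { hG.prop.1 with mem_or_mem := ?_ }, hFG, hG.prop.2⟩
  intro x y hxy
  by_contra! h
  obtain ⟨g, hg, i, hi, hgi⟩ := meets x h.1
  obtain ⟨k, hk, j, hj, hkj⟩ := meets y h.2
  refine hG.prop.2 (i ⊔ j) (hG.prop.1.mem_of_le ?_
    (hG.prop.1.inf_mem (hG.prop.1.inf_mem hg hk) hxy)) (hI i hi j hj)
  rw [inf_sup_left]
  exact sup_le_sup ((inf_le_inf_right x inf_le_left).trans hgi)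
    ((inf_le_inf_right y inf_le_right).trans hkj)

/-- If the trace of the filter `Q` on a subalgebra `A` is contained in that of the prime filter `P`,
then `Q` extends to a prime filter with the same trace on `A` as `P`. -/
theorem IsLatticeFilter_s1.exists_prime_trace_eq {A P Q : Set B} (htop : ⊤ ∈ A)
    (hinf : ∀ x ∈ A, ∀ y ∈ A, x ⊓ y ∈ A) (hsup : ∀ x ∈ A, ∀ y ∈ A, x ⊔ y ∈ A)
    (hhimp : ∀ x ∈ A, ∀ y ∈ A, x ⇨ y ∈ A) (hQ : IsLatticeFilter_s1 Q)
    (hP : IsPrimeLatticeFilter P) (h : ∀ a ∈ A, a ∈ Q → a ∈ P) :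
    ∃ Q', IsPrimeLatticeFilter Q' ∧ Q ⊆ Q' ∧ ∀ a ∈ A, a ∈ P ↔ a ∈ Q' := by
  obtain ⟨Q', hQ', hsub, hdisj⟩ := (hQ.join (S := A ∩ P) ⟨htop, hP.top_mem⟩
    fun x hx y hy => ⟨hinf x hx.1 y hy.1, hP.inf_mem hx.2 hy.2⟩).exists_prime (I := A \ P)
    (fun x hx y hy => ⟨hsup x hx.1 y hy.1, fun hxy => (hP.mem_or_mem hxy).elim hx.2 hy.2⟩) (by
      rintro d ⟨q, hq, p, hp, hd⟩ hdI
      have himp : p ⇨ d ∈ P :=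
        h _ (hhimp p hp.1 d hdI.1) (hQ.mem_of_le (le_himp_iff.2 hd) hq)
      exact hdI.2 (hP.mem_of_le himp_inf_le (hP.inf_mem himp hp.2)))
  refine ⟨Q', hQ', fun q hq => hsub ⟨q, hq, ⊤, ⟨htop, hP.top_mem⟩, inf_le_left⟩, fun a ha => ?_⟩
  refine ⟨fun haP => hsub ⟨⊤, hQ.top_mem, a, ⟨ha, haP⟩, inf_le_right⟩, fun haQ => ?_⟩
  by_contra haP
  exact hdisj a haQ ⟨ha, haP⟩

/-- The map into the lower sets of `W` dual to an assignment of filters to the points of `W`. -/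
def filterRepr {W : Type*} [Preorder W] (π : W → Set B) (hπ : Antitone π) (x : B) : LowerSet W :=
  ⟨{w | x ∈ π w}, fun _ _ hwv hx => hπ hwv hx⟩

/-- The dual of a map of prime filters with the lifting property is a Brouwerian homomorphism. -/
theorem isBrouwerianHom_filterRepr {W : Type*} [Preorder W] {π : W → Set B} (hπ : Antitone π)
    (hprime : ∀ w, IsPrimeLatticeFilter (π w))
    (hlift : ∀ w P, IsPrimeLatticeFilter P → π w ⊆ P → ∃ v ≤ w, π v = P) :
    IsBrouwerianHom (filterRepr π hπ) where
  map_inf x y := by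
    ext w
    exact ⟨fun h => ⟨(hprime w).mem_of_le inf_le_left h, (hprime w).mem_of_le inf_le_right h⟩,
      fun h => (hprime w).inf_mem h.1 h.2⟩
  map_sup x y := by
    ext w
    exact ⟨(hprime w).mem_or_mem, fun h => h.elim ((hprime w).mem_of_le le_sup_left)
      ((hprime w).mem_of_le le_sup_right)⟩
  map_himp x y := by
    apply le_antisymm
    · rw [le_himp_iff]
      intro w hw
      exact (hprime w).mem_of_le himp_inf_le ((hprime w).inf_mem hw.1 hw.2)
    · intro w hw
      have hle : LowerSet.Iic w ⊓ filterRepr π hπ x ≤ filterRepr π hπ y :=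
        le_himp_iff.1 (LowerSet.Iic_le.2 hw)
      by_contra hxy
      obtain ⟨P, hP, hsub, hdisj⟩ := ((hprime w).adjoin x).exists_prime (I := {y})
        (by rintro _ rfl _ rfl; exact sup_idem _) (by
          rintro _ ⟨p, hp, h⟩ rfl
          exact hxy ((hprime w).mem_of_le (le_himp_iff.2 h) hp))
      obtain ⟨v, hvw, rfl⟩ := hlift w P hP fun p hp => hsub ⟨p, hp, inf_le_left⟩
      exact hdisj y (hle ⟨hvw, hsub ⟨⊤, (hprime w).top_mem, inf_le_right⟩⟩) rfl
  map_top := by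
    ext w
    exact ⟨fun _ => trivial, fun _ => (hprime w).top_mem⟩

end PrimeFilters

theorem strong_es_brouwerian {B : Type u} [GeneralizedHeytingAlgebra B] (A : Set B)
    (htop : (⊤ : B) ∈ A)
    (hinf : ∀ x ∈ A, ∀ y ∈ A, x ⊓ y ∈ A)
    (hsup : ∀ x ∈ A, ∀ y ∈ A, x ⊔ y ∈ A)
    (hhimp : ∀ x ∈ A, ∀ y ∈ A, x ⇨ y ∈ A)
    (b : B) (hb : b ∉ A) :
    ∃ (D : BrouwerianAlgebra.{u}) (f g : B → D),
      IsBrouwerianHom f ∧ IsBrouwerianHom g ∧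
      (∀ a ∈ A, f a = g a) ∧ f b ≠ g b := by
  let W := {p : (Set B × Set B)ᵒᵈ // IsPrimeLatticeFilter (OrderDual.ofDual p).1 ∧
    IsPrimeLatticeFilter (OrderDual.ofDual p).2 ∧
    ∀ a ∈ A, a ∈ (OrderDual.ofDual p).1 ↔ a ∈ (OrderDual.ofDual p).2}
  let π₁ : W → Set B := fun w => (OrderDual.ofDual w.1).1
  let π₂ : W → Set B := fun w => (OrderDual.ofDual w.1).2
  have hπ₁ : Antitone π₁ := fun v w h => h.1
  have hπ₂ : Antitone π₂ := fun v w h => h.2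
  refine ⟨⟨LowerSet W⟩, filterRepr π₁ hπ₁, filterRepr π₂ hπ₂,
    isBrouwerianHom_filterRepr hπ₁ (fun w => w.2.1) ?_,
    isBrouwerianHom_filterRepr hπ₂ (fun w => w.2.2.1) ?_, ?_, ?_⟩
  · rintro ⟨⟨P, Q⟩, hP, hQ, hPQ⟩ P' hP' hsub
    obtain ⟨Q', hQ', hQQ', htrace⟩ := hQ.exists_prime_trace_eq htop hinf hsup hhimp hP'
      fun a ha haQ => hsub ((hPQ a ha).2 haQ)
    exact ⟨⟨OrderDual.toDual (P', Q'), hP', hQ', htrace⟩, ⟨hsub, hQQ'⟩, rfl⟩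
  · rintro ⟨⟨P, Q⟩, hP, hQ, hPQ⟩ Q' hQ' hsub
    obtain ⟨P', hP', hPP', htrace⟩ := hP.exists_prime_trace_eq htop hinf hsup hhimp hQ'
      fun a ha haP => hsub ((hPQ a ha).1 haP)
    exact ⟨⟨OrderDual.toDual (P', Q'), hP', hQ', fun a ha => (htrace a ha).symm⟩,
      ⟨hPP', hsub⟩, rfl⟩
  · intro a ha
    apply LowerSet.ext
    ext w
    exact w.2.2.2 a ha
  · intro heq
    obtain ⟨Q, hQ, hsub, hdisj⟩ := ((isLatticeFilter_Ici (⊤ : B)).join (S := A ∩ Set.Ici b)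
      ⟨htop, le_top⟩ fun x hx y hy => ⟨hinf x hx.1 y hy.1, le_inf hx.2 hy.2⟩).exists_prime
      (I := Set.Iic b) (fun x hx y hy => sup_le hx hy) (by
        rintro z ⟨p, hp, a, ha, hz⟩ hzb
        have hab : a ≤ b := (le_inf (le_top.trans hp) le_rfl).trans (hz.trans hzb)
        exact hb (le_antisymm hab ha.2 ▸ ha.1))
    obtain ⟨P, hP, hbP, htrace⟩ :=
      (isLatticeFilter_Ici b).exists_prime_trace_eq htop hinf hsup hhimp hQ
        fun a ha hba => hsub ⟨⊤, le_rfl, a, ⟨ha, hba⟩, inf_le_right⟩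
    let w : W := ⟨OrderDual.toDual (P, Q), hP, hQ, fun a ha => (htrace a ha).symm⟩
    have hw : w ∈ filterRepr π₁ hπ₁ b := hbP (le_refl b)
    have hw' : w ∈ filterRepr π₂ hπ₂ b := by
      rw [← show filterRepr π₁ hπ₁ b = filterRepr π₂ hπ₂ b from heq]
      exact hw
    exact hdisj b hw' (le_refl b)
end

section
/- In the category of Heyting algebras with Heyting homomorphisms (Mathlib's HeytAlg), every epimorphism is surjective as a function on underlying sets. -/
/-!
STATEMENT 2: In the category of Heyting algebras with Heyting homomorphisms
(Mathlib's `HeytAlg`), every epimorphism is surjective on underlying sets.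
-/

open CategoryTheory

universe u

namespace Order.Ideal

theorem IsPrime.inf_mem_iff {B : Type*} [Lattice B] {I : Ideal B} (hI : I.IsPrime) {x y : B} :
    x ⊓ y ∈ I ↔ x ∈ I ∨ y ∈ I :=
  ⟨hI.mem_or_mem, fun h => h.elim (I.lower inf_le_left) (I.lower inf_le_right)⟩

/-- The prime separation theorem for a filter and an ideal given as sets. -/
theorem exists_isPrime_of_isUpperSet_isLowerSet {B : Type*} [DistribLattice B] {F I : Set B}
    (hF : IsUpperSet F) (hF' : F.Nonempty) (hFinf : ∀ x ∈ F, ∀ y ∈ F, x ⊓ y ∈ F)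
    (hI : IsLowerSet I) (hI' : I.Nonempty) (hIsup : ∀ x ∈ I, ∀ y ∈ I, x ⊔ y ∈ I)
    (hFI : ∀ x ∈ F, x ∉ I) :
    ∃ J : Ideal B, J.IsPrime ∧ (∀ x ∈ I, x ∈ J) ∧ ∀ x ∈ F, x ∉ J := by
  have hF : IsPFilter F := IsPFilter.of_def hF'
    (fun x hx y hy => ⟨x ⊓ y, hFinf x hx y hy, inf_le_left, inf_le_right⟩) (hF ·)
  have hI : IsIdeal I := ⟨hI, hI', fun x hx y hy => ⟨x ⊔ y, hIsup x hx y hy, le_sup_left,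
    le_sup_right⟩⟩
  obtain ⟨J, hJ, hIJ, hFJ⟩ := DistribLattice.prime_ideal_of_disjoint_filter_ideal
    (F := hF.toPFilter) (I := hI.toIdeal) (Set.disjoint_left.2 hFI)
  exact ⟨J, hJ, fun x hx => hIJ hx, fun x hx => Set.disjoint_left.1 hFJ hx⟩

/-- The map induced by a Heyting homomorphism on prime ideals is a p-morphism onto its image. -/
theorem IsPrime.exists_le_forall_map_mem_iff {A B : Type*} [HeytingAlgebra A] [HeytingAlgebra B]
    (h : HeytingHom A B) {I J : Ideal B} (hI : I.IsPrime) (hJ : J.IsPrime)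
    (hJI : ∀ a, h a ∈ J → h a ∈ I) :
    ∃ K : Ideal B, K.IsPrime ∧ K ≤ I ∧ ∀ a, h a ∈ K ↔ h a ∈ J := by
  have hItop : ⊤ ∉ I := hI.toIsProper.top_notMem
  have hJtop : ⊤ ∉ J := hJ.toIsProper.top_notMem
  obtain ⟨K, hK, hJK, hFK⟩ := exists_isPrime_of_isUpperSet_isLowerSet
    (F := {z | ∃ s ∉ I, ∃ a, h a ∉ J ∧ s ⊓ h a ≤ z}) (I := {z | ∃ c, h c ∈ J ∧ z ≤ h c})
    (fun x y hxy ⟨s, hs, a, ha, hx⟩ => ⟨s, hs, a, ha, hx.trans hxy⟩)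
    ⟨⊤, ⊤, hItop, ⊤, by simpa using hJtop, le_top⟩
    (by
      rintro x ⟨s, hs, a, ha, hx⟩ y ⟨t, ht, b, hb, hy⟩
      refine ⟨s ⊓ t, by simp [hI.inf_mem_iff, hs, ht], a ⊓ b,
        by simp [hJ.inf_mem_iff, ha, hb], ?_⟩
      rw [map_inf, inf_inf_inf_comm]
      exact inf_le_inf hx hy)
    (fun x y hyx ⟨c, hc, hx⟩ => ⟨c, hc, hyx.trans hx⟩)
    ⟨⊥, ⊥, by simp, bot_le⟩
    (by
      rintro x ⟨c, hc, hx⟩ y ⟨d, hd, hy⟩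
      exact ⟨c ⊔ d, by simpa using ⟨hc, hd⟩, by simpa using sup_le_sup hx hy⟩)
    (by
      rintro x ⟨s, hs, a, ha, hx⟩ ⟨c, hc, hxc⟩
      have hsac : s ≤ h (a ⇨ c) := by
        rw [map_himp, le_himp_iff]
        exact hx.trans hxc
      have hac : h (a ⇨ c) ∉ J := fun hm => hs (I.lower hsac (hJI _ hm))
      have hle : h a ⊓ h (a ⇨ c) ≤ h c := by
        rw [map_himp]
        exact inf_himp_le
      exact (hJ.mem_or_mem (J.lower hle hc)).elim ha hac)
  refine ⟨K, hK, fun x hx => ?_, fun a => ⟨fun ha => ?_, fun ha => hJK _ ⟨a, ha, le_rfl⟩⟩⟩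
  · by_contra hxI
    exact hFK x ⟨x, hxI, ⊤, by simpa using hJtop, inf_le_left⟩ hx
  · by_contra haJ
    exact hFK _ ⟨⊤, hItop, a, haJ, inf_le_right⟩ ha

/-- An element outside a Heyting subalgebra is separated by prime ideals with the same trace on it. -/
theorem exists_isPrime_pair_of_notMem_range {A B : Type*} [HeytingAlgebra A] [HeytingAlgebra B]
    (h : HeytingHom A B) {b : B} (hb : b ∉ Set.range h) :
    ∃ I J : Ideal B, I.IsPrime ∧ J.IsPrime ∧ (∀ a, h a ∈ I ↔ h a ∈ J) ∧ b ∉ I ∧ b ∈ J := by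
  obtain ⟨I, hI, hAI, hbI⟩ := exists_isPrime_of_isUpperSet_isLowerSet
    (F := Set.Ici b) (I := {z | ∃ a, h a ≤ b ∧ z ≤ h a})
    (isUpperSet_Ici b) ⟨b, le_rfl⟩ (fun x hx y hy => le_inf hx hy)
    (fun x y hyx ⟨a, ha, hx⟩ => ⟨a, ha, hyx.trans hx⟩)
    ⟨⊥, ⊥, by simp, bot_le⟩
    (by
      rintro x ⟨c, hc, hx⟩ y ⟨d, hd, hy⟩
      exact ⟨c ⊔ d, by simpa using ⟨hc, hd⟩, by simpa using sup_le_sup hx hy⟩)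
    (fun x hbx ⟨a, hab, hxa⟩ => hb ⟨a, hab.antisymm (le_trans hbx hxa)⟩)
  have hbI : b ∉ I := hbI b le_rfl
  obtain ⟨J, hJ, hbJ, hAJ⟩ := exists_isPrime_of_isUpperSet_isLowerSet
    (F := {z | ∃ a, h a ∉ I ∧ h a ≤ z}) (I := Set.Iic b)
    (fun x y hxy ⟨a, ha, hx⟩ => ⟨a, ha, hx.trans hxy⟩)
    ⟨⊤, ⊤, by simpa using hI.toIsProper.top_notMem, le_top⟩
    (by
      rintro x ⟨c, hc, hx⟩ y ⟨d, hd, hy⟩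
      exact ⟨c ⊓ d, by simp [hI.inf_mem_iff, hc, hd], by simpa using inf_le_inf hx hy⟩)
    (isLowerSet_Iic b) ⟨b, le_rfl⟩ (fun x hx y hy => sup_le hx hy)
    (fun x ⟨a, ha, hax⟩ hxb => ha (hAI _ ⟨a, le_trans hax hxb, le_rfl⟩))
  obtain ⟨K, hK, hKI, hKJ⟩ := hI.exists_le_forall_map_mem_iff h hJ fun a ha => by
    by_contra haI
    exact hAJ _ ⟨a, haI, le_rfl⟩ ha
  exact ⟨K, J, hK, hJ, hKJ, fun hbK => hbI (hKI hbK), hbJ b le_rfl⟩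

end Order.Ideal

open Order

/-- The Heyting homomorphism into lower sets dual to a p-morphism into the prime ideals. -/
def HeytingHom.toLowerSet {B P : Type*} [HeytingAlgebra B] [Preorder P] (f : P → Ideal B)
    (hf : Monotone f) (hprime : ∀ p, (f p).IsPrime)
    (hback : ∀ p (J : Ideal B), J.IsPrime → J ≤ f p → ∃ q ≤ p, f q = J) :
    HeytingHom B (LowerSet P) where
  toFun b := ⟨{p | b ∉ f p}, fun _ _ hqp hp hq => hp (hf hqp hq)⟩
  map_sup' a b := by
    ext p
    change a ⊔ b ∉ f p ↔ a ∉ f p ∨ b ∉ f p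
    rw [Ideal.sup_mem_iff, not_and_or]
  map_inf' a b := by
    ext p
    change a ⊓ b ∉ f p ↔ a ∉ f p ∧ b ∉ f p
    rw [(hprime p).inf_mem_iff, not_or]
  map_bot' := by
    ext p
    simp
  map_himp' a b := by
    refine eq_of_forall_le_iff fun U => ?_
    rw [le_himp_iff]
    constructor
    · rintro hU p ⟨hpU, hpa⟩ hpb
      have hle : a ⊓ (a ⇨ b) ≤ b := inf_himp_le
      exact ((hprime p).mem_or_mem ((f p).lower hle hpb)).elim hpa (hU hpU)
    · intro hU p hpU hpab
      obtain ⟨J, hJ, hbJ, hFJ⟩ := Ideal.exists_isPrime_of_isUpperSet_isLowerSet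
        (F := {z | ∃ s ∉ f p, s ⊓ a ≤ z}) (I := Set.Iic b)
        (fun x y hxy ⟨s, hs, hx⟩ => ⟨s, hs, hx.trans hxy⟩)
        ⟨⊤, ⊤, (hprime p).toIsProper.top_notMem, le_top⟩
        (by
          rintro x ⟨s, hs, hx⟩ y ⟨t, ht, hy⟩
          refine ⟨s ⊓ t, by simp [(hprime p).inf_mem_iff, hs, ht], ?_⟩
          rw [inf_inf_distrib_right]
          exact inf_le_inf hx hy)
        (isLowerSet_Iic b) ⟨b, le_rfl⟩ (fun x hx y hy => sup_le hx hy)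
        (fun x ⟨s, hs, hsx⟩ hxb => hs ((f p).lower (le_himp_iff.2 (hsx.trans hxb)) hpab))
      obtain ⟨q, hqp, rfl⟩ := hback p J hJ fun x hx => by
        by_contra hxp
        exact hFJ x ⟨x, hxp, inf_le_left⟩ hx
      exact hU ⟨U.lower hqp hpU,
        hFJ a ⟨⊤, (hprime p).toIsProper.top_notMem, inf_le_right⟩⟩ (hbJ b le_rfl)

theorem HeytingHom.mem_toLowerSet {B P : Type*} [HeytingAlgebra B] [Preorder P] {f : P → Ideal B}
    {hf : Monotone f} {hprime : ∀ p, (f p).IsPrime}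
    {hback : ∀ p (J : Ideal B), J.IsPrime → J ≤ f p → ∃ q ≤ p, f q = J} {b : B} {p : P} :
    p ∈ HeytingHom.toLowerSet f hf hprime hback b ↔ b ∉ f p :=
  Iff.rfl

theorem epi_in_HeytAlg_is_surjective {A B : HeytAlg.{u}} (h : A ⟶ B) (hepi : Epi h) :
    Function.Surjective (h : A → B) := by
  intro b
  by_contra hb
  obtain ⟨I, J, hI, hJ, hIJ, hbI, hbJ⟩ := Ideal.exists_isPrime_pair_of_notMem_range h.hom hb
  let P : Type u := {p : Ideal B × Ideal B //
    p.1.IsPrime ∧ p.2.IsPrime ∧ ∀ a, h.hom a ∈ p.1 ↔ h.hom a ∈ p.2}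
  let f : HeytingHom B (LowerSet P) := HeytingHom.toLowerSet (fun p : P => p.1.1)
    (fun _ _ hpq => hpq.1) (fun p => p.2.1) fun ⟨⟨K, L⟩, hK, hL, hKL⟩ M hM hMK => by
      obtain ⟨N, hN, hNL, hNM⟩ := hL.exists_le_forall_map_mem_iff h.hom hM
        fun a ha => (hKL a).1 (hMK ha)
      exact ⟨⟨(M, N), hM, hN, fun a => (hNM a).symm⟩, ⟨hMK, hNL⟩, rfl⟩
  let g : HeytingHom B (LowerSet P) := HeytingHom.toLowerSet (fun p : P => p.1.2)
    (fun _ _ hpq => hpq.2) (fun p => p.2.2.1) fun ⟨⟨K, L⟩, hK, hL, hKL⟩ M hM hML => by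
      obtain ⟨N, hN, hNK, hNM⟩ := hK.exists_le_forall_map_mem_iff h.hom hM
        fun a ha => (hKL a).2 (hML ha)
      exact ⟨⟨(N, M), hN, hM, hNM⟩, ⟨hNK, hML⟩, rfl⟩
  have hfg : h ≫ HeytAlg.ofHom f = h ≫ HeytAlg.ofHom g :=
    HeytAlg.ext fun a => LowerSet.ext (Set.ext fun p => not_congr (p.2.2.2 a))
  have hfgb : f b = g b := ConcreteCategory.congr_hom ((cancel_epi h).1 hfg) b
  have hmem : (⟨(I, J), hI, hJ, hIJ⟩ : P) ∈ f b := HeytingHom.mem_toLowerSet.2 hbI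
  rw [hfgb] at hmem
  exact HeytingHom.mem_toLowerSet.1 hmem hbJ
end

section
/- Weak epimorphism-surjectivity for varieties of Heyting algebras: let K be a variety of Heyting algebras and let h : A → B be a K-epimorphism with A, B ∈ K. If there is b ∈ B such that B is generated by h[A] ∪ {b} (i.e., the only subset of B containing h[A] ∪ {b}, containing ⊤ and ⊥, and closed under ⊓, ⊔ and ⇨ is B itself), then h is surjective. -/
/-!
STATEMENT 3: Weak epimorphism-surjectivity for varieties of Heyting algebras:
if `K` is an HSP-closed class of Heyting algebras, `h : A → B` is a `K`-epimorphism
between members of `K`, and `B` is generated by `h[A] ∪ {b}` for some `b ∈ B`,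
then `h` is surjective.
-/

universe u

theorem inf_himp_congr {α : Type*} [GeneralizedHeytingAlgebra α] {f x x' y y' : α}
    (hx : f ⊓ x = f ⊓ x') (hy : f ⊓ y = f ⊓ y') : f ⊓ (x ⇨ y) = f ⊓ (x' ⇨ y') := by
  have key : ∀ {x x' y y' : α}, f ⊓ x = f ⊓ x' → f ⊓ y = f ⊓ y' →
      f ⊓ (x ⇨ y) ≤ f ⊓ (x' ⇨ y') := by
    intro x x' y y' hx hy
    refine le_inf inf_le_left (le_himp_iff.2 ?_)
    calc f ⊓ (x ⇨ y) ⊓ x' = f ⊓ x ⊓ (x ⇨ y) := by rw [inf_right_comm, hx]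
      _ = f ⊓ y ⊓ x := by rw [inf_assoc, inf_himp, inf_assoc, inf_comm y]
      _ ≤ y' := by rw [hy]; exact inf_le_left.trans inf_le_right
  exact (key hx hy).antisymm (key hx.symm hy.symm)

theorem inf_sup_congr {α : Type*} [DistribLattice α] {f x x' y y' : α}
    (hx : f ⊓ x = f ⊓ x') (hy : f ⊓ y = f ⊓ y') : f ⊓ (x ⊔ y) = f ⊓ (x' ⊔ y') := by
  rw [inf_sup_left, inf_sup_left, hx, hy]

theorem inf_inf_congr {α : Type*} [SemilatticeInf α] {f x x' y y' : α}
    (hx : f ⊓ x = f ⊓ x') (hy : f ⊓ y = f ⊓ y') : f ⊓ (x ⊓ y) = f ⊓ (x' ⊓ y') := by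
  rw [inf_inf_distrib_left, hx, hy, ← inf_inf_distrib_left]

namespace Order.PFilter

section SemilatticeInf

variable {α : Type*} [SemilatticeInf α]

/-- Two elements are identified modulo a filter if they have the same meet with some member
of the filter. -/
def setoid (F : PFilter α) : Setoid α where
  r x y := ∃ f ∈ F, f ⊓ x = f ⊓ y
  iseqv :=
    { refl := fun _ => F.nonempty.imp fun _ hf => ⟨hf, rfl⟩
      symm := fun ⟨f, hf, e⟩ => ⟨f, hf, e.symm⟩
      trans := by
        rintro x y z ⟨f, hf, e⟩ ⟨g, hg, e'⟩
        refine ⟨f ⊓ g, inf_mem hf hg, ?_⟩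
        rw [inf_right_comm, e, inf_right_comm, inf_assoc, e', inf_assoc] }

/-- The quotient of a meet-semilattice by a filter. -/
def Quot (F : PFilter α) : Type _ := Quotient F.setoid

/-- The canonical projection onto the quotient by a filter. -/
def toQuot (F : PFilter α) (x : α) : F.Quot := Quotient.mk F.setoid x

variable {F : PFilter α}

theorem toQuot_surjective : Function.Surjective F.toQuot := Quotient.mk_surjective

theorem toQuot_eq_toQuot {x y : α} : F.toQuot x = F.toQuot y ↔ ∃ f ∈ F, f ⊓ x = f ⊓ y :=
  Quotient.eq

/-- Descend to the quotient by a filter a binary operation that is compatible with meets. -/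
def Quot.map₂ (op : α → α → α) (hop : ∀ {f x x' y y' : α}, f ⊓ x = f ⊓ x' → f ⊓ y = f ⊓ y' →
    f ⊓ op x y = f ⊓ op x' y') : F.Quot → F.Quot → F.Quot :=
  Quotient.map₂ op <| by
    rintro x x' ⟨f, hf, e⟩ y y' ⟨g, hg, e'⟩
    refine ⟨f ⊓ g, inf_mem hf hg, hop ?_ ?_⟩
    · rw [inf_right_comm, e, inf_right_comm]
    · rw [inf_assoc, e', inf_assoc]

instance : LE F.Quot where
  le p q := ∃ x y, F.toQuot x = p ∧ F.toQuot y = q ∧ x ≤ y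

theorem toQuot_le_toQuot {x y : α} : F.toQuot x ≤ F.toQuot y ↔ ∃ f ∈ F, f ⊓ x ≤ y := by
  constructor
  · rintro ⟨x', y', hx, hy, hxy⟩
    obtain ⟨f, hf, e⟩ := toQuot_eq_toQuot.1 hx
    obtain ⟨g, hg, e'⟩ := toQuot_eq_toQuot.1 hy
    refine ⟨g ⊓ f, inf_mem hg hf, ?_⟩
    calc g ⊓ f ⊓ x = g ⊓ (f ⊓ x') := by rw [inf_assoc, e]
      _ ≤ g ⊓ y' := inf_le_inf_left g (inf_le_right.trans hxy)
      _ ≤ y := e'.trans_le inf_le_right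
  · rintro ⟨f, hf, hxy⟩
    exact ⟨f ⊓ x, y, toQuot_eq_toQuot.2 ⟨f, hf, inf_left_idem f x⟩, rfl, hxy⟩

theorem toQuot_le_toQuot_of_le {x y : α} (hxy : x ≤ y) : F.toQuot x ≤ F.toQuot y :=
  ⟨x, y, rfl, rfl, hxy⟩

instance : PartialOrder F.Quot where
  le_refl p := by
    obtain ⟨x, rfl⟩ := toQuot_surjective p
    exact toQuot_le_toQuot_of_le le_rfl
  le_trans p q r := by
    obtain ⟨x, rfl⟩ := toQuot_surjective p
    obtain ⟨y, rfl⟩ := toQuot_surjective q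
    obtain ⟨z, rfl⟩ := toQuot_surjective r
    simp only [toQuot_le_toQuot]
    rintro ⟨f, hf, hxy⟩ ⟨g, hg, hyz⟩
    exact ⟨g ⊓ f, inf_mem hg hf, by rw [inf_assoc]; exact (inf_le_inf_left g hxy).trans hyz⟩
  le_antisymm p q := by
    obtain ⟨x, rfl⟩ := toQuot_surjective p
    obtain ⟨y, rfl⟩ := toQuot_surjective q
    simp only [toQuot_le_toQuot, toQuot_eq_toQuot]
    rintro ⟨f, hf, hxy⟩ ⟨g, hg, hyx⟩
    refine ⟨f ⊓ g, inf_mem hf hg, le_antisymm ?_ ?_⟩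
    · exact le_inf inf_le_left ((inf_le_inf_right x inf_le_left).trans hxy)
    · exact le_inf inf_le_left ((inf_le_inf_right y inf_le_right).trans hyx)

end SemilatticeInf

variable {α : Type*} [HeytingAlgebra α] {F : PFilter α}

instance : HeytingAlgebra F.Quot where
  inf := Quot.map₂ (· ⊓ ·) inf_inf_congr
  sup := Quot.map₂ (· ⊔ ·) inf_sup_congr
  himp := Quot.map₂ (· ⇨ ·) inf_himp_congr
  compl p := Quot.map₂ (· ⇨ ·) inf_himp_congr p (F.toQuot ⊥)
  top := F.toQuot ⊤
  bot := F.toQuot ⊥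
  le_top p := by
    obtain ⟨x, rfl⟩ := toQuot_surjective p
    exact toQuot_le_toQuot_of_le le_top
  bot_le p := by
    obtain ⟨x, rfl⟩ := toQuot_surjective p
    exact toQuot_le_toQuot_of_le bot_le
  inf_le_left p q := by
    obtain ⟨x, rfl⟩ := toQuot_surjective p
    obtain ⟨y, rfl⟩ := toQuot_surjective q
    exact toQuot_le_toQuot_of_le inf_le_left
  inf_le_right p q := by
    obtain ⟨x, rfl⟩ := toQuot_surjective p
    obtain ⟨y, rfl⟩ := toQuot_surjective q
    exact toQuot_le_toQuot_of_le inf_le_right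
  le_inf p q r hpq hpr := by
    obtain ⟨x, rfl⟩ := toQuot_surjective p
    obtain ⟨y, rfl⟩ := toQuot_surjective q
    obtain ⟨z, rfl⟩ := toQuot_surjective r
    obtain ⟨f, hf, hxy⟩ := toQuot_le_toQuot.1 hpq
    obtain ⟨g, hg, hxz⟩ := toQuot_le_toQuot.1 hpr
    exact toQuot_le_toQuot.2 ⟨f ⊓ g, inf_mem hf hg, le_inf
      ((inf_le_inf_right x inf_le_left).trans hxy) ((inf_le_inf_right x inf_le_right).trans hxz)⟩
  le_sup_left p q := by
    obtain ⟨x, rfl⟩ := toQuot_surjective p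
    obtain ⟨y, rfl⟩ := toQuot_surjective q
    exact toQuot_le_toQuot_of_le le_sup_left
  le_sup_right p q := by
    obtain ⟨x, rfl⟩ := toQuot_surjective p
    obtain ⟨y, rfl⟩ := toQuot_surjective q
    exact toQuot_le_toQuot_of_le le_sup_right
  sup_le p q r hpr hqr := by
    obtain ⟨x, rfl⟩ := toQuot_surjective p
    obtain ⟨y, rfl⟩ := toQuot_surjective q
    obtain ⟨z, rfl⟩ := toQuot_surjective r
    obtain ⟨f, hf, hxz⟩ := toQuot_le_toQuot.1 hpr
    obtain ⟨g, hg, hyz⟩ := toQuot_le_toQuot.1 hqr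
    refine toQuot_le_toQuot.2 ⟨f ⊓ g, inf_mem hf hg, ?_⟩
    rw [inf_sup_left]
    exact sup_le ((inf_le_inf_right x inf_le_left).trans hxz)
      ((inf_le_inf_right y inf_le_right).trans hyz)
  le_himp_iff p q r := by
    obtain ⟨x, rfl⟩ := toQuot_surjective p
    obtain ⟨y, rfl⟩ := toQuot_surjective q
    obtain ⟨z, rfl⟩ := toQuot_surjective r
    change F.toQuot x ≤ F.toQuot (y ⇨ z) ↔ F.toQuot (x ⊓ y) ≤ F.toQuot z
    simp only [toQuot_le_toQuot, le_himp_iff, inf_assoc]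
  himp_bot _ := rfl

/-- The canonical projection onto the quotient by a filter, as a Heyting homomorphism. -/
def toQuotHom (F : PFilter α) : HeytingHom α F.Quot where
  toFun := F.toQuot
  map_sup' _ _ := rfl
  map_inf' _ _ := rfl
  map_bot' := rfl
  map_himp' _ _ := rfl

end Order.PFilter

/-- `SubstTop h b x y` says that `(x, y)` lies in the subalgebra of `B × B` generated by the pairs
`(h a, h a)` and `(b, ⊤)`: some polynomial over `A` takes the value `x` at `b` and `y` at `⊤`. -/
inductive SubstTop {A B : Type*} [HeytingAlgebra A] [HeytingAlgebra B] (h : HeytingHom A B)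
    (b : B) : B → B → Prop
  | const (a : A) : SubstTop h b (h a) (h a)
  | var : SubstTop h b b ⊤
  | inf {x x' y y' : B} : SubstTop h b x x' → SubstTop h b y y' → SubstTop h b (x ⊓ y) (x' ⊓ y')
  | sup {x x' y y' : B} : SubstTop h b x x' → SubstTop h b y y' → SubstTop h b (x ⊔ y) (x' ⊔ y')
  | himp {x x' y y' : B} : SubstTop h b x x' → SubstTop h b y y' → SubstTop h b (x ⇨ y) (x' ⇨ y')

namespace SubstTop

open scoped symmDiff

variable {A B : Type*} [HeytingAlgebra A] [HeytingAlgebra B] {h : HeytingHom A B} {b : B}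

theorem top : SubstTop h b ⊤ ⊤ := by simpa using const (h := h) (b := b) ⊤

theorem bot : SubstTop h b ⊥ ⊥ := by simpa using const (h := h) (b := b) ⊥

theorem right_mem_range {x y : B} (hxy : SubstTop h b x y) : y ∈ Set.range h := by
  induction hxy with
  | const a => exact ⟨a, rfl⟩
  | var => exact ⟨⊤, map_top h⟩
  | inf _ _ hx hy =>
    obtain ⟨⟨a, rfl⟩, c, rfl⟩ := And.intro hx hy
    exact ⟨a ⊓ c, map_inf h a c⟩
  | sup _ _ hx hy =>
    obtain ⟨⟨a, rfl⟩, c, rfl⟩ := And.intro hx hy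
    exact ⟨a ⊔ c, map_sup h a c⟩
  | himp _ _ hx hy =>
    obtain ⟨⟨a, rfl⟩, c, rfl⟩ := And.intro hx hy
    exact ⟨a ⇨ c, map_himp h a c⟩

theorem inf_eq_inf {x y : B} (hxy : SubstTop h b x y) : b ⊓ x = b ⊓ y := by
  induction hxy with
  | const a => rfl
  | var => simp
  | inf _ _ hx hy => exact inf_inf_congr hx hy
  | sup _ _ hx hy => exact inf_sup_congr hx hy
  | himp _ _ hx hy => exact inf_himp_congr hx hy

theorem bihimp {x x' y y' : B} (hx : SubstTop h b x x') (hy : SubstTop h b y y') :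
    SubstTop h b (x ⇔ y) (x' ⇔ y') :=
  (hy.himp hx).inf (hx.himp hy)

variable (h b) in
/-- The filter generated by the values at `⊤` of the polynomials whose value at `b` is `⊤`. -/
def filter : Order.PFilter B :=
  Order.IsPFilter.toPFilter (F := {y | ∃ z, SubstTop h b ⊤ z ∧ z ≤ y}) <| by
    refine .of_def ⟨⊤, ⊤, top, le_rfl⟩ ?_ ?_
    · rintro x ⟨x', hx, hx'⟩ y ⟨y', hy, hy'⟩
      exact ⟨x' ⊓ y', ⟨x' ⊓ y', by simpa using hx.inf hy, le_rfl⟩,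
        inf_le_left.trans hx', inf_le_right.trans hy'⟩
    · rintro x y hxy ⟨z, hz, hzx⟩
      exact ⟨z, hz, hzx.trans hxy⟩

theorem mem_filter {y : B} : y ∈ filter h b ↔ ∃ z, SubstTop h b ⊤ z ∧ z ≤ y := Iff.rfl

theorem toQuot_eq_toQuot {x y y' : B} (hy : SubstTop h b x y) (hy' : SubstTop h b x y') :
    (filter h b).toQuot y = (filter h b).toQuot y' := by
  refine Order.PFilter.toQuot_eq_toQuot.2 ⟨y ⇔ y', ⟨_, by simpa using hy.bihimp hy', le_rfl⟩, ?_⟩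
  have key (u v : B) : (u ⇔ v) ⊓ u ≤ v := (inf_le_inf_right u inf_le_right).trans himp_inf_le
  have hle : (y ⇔ y') ⊓ y' ≤ y := bihimp_comm y y' ▸ key y' y
  exact le_antisymm (le_inf inf_le_left (key y y')) (le_inf inf_le_left hle)

/-- If every element of `B` is the value at `b` of a polynomial over `A`, then evaluation at `⊤`
is a well-defined homomorphism to the quotient by `SubstTop.filter`. -/
theorem exists_hom (hb : ∀ x, ∃ y, SubstTop h b x y) :
    ∃ g : HeytingHom B (filter h b).Quot,
      ∀ {x y : B}, SubstTop h b x y → g x = (filter h b).toQuot y := by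
  choose s hs using hb
  exact ⟨{ toFun := fun x => (filter h b).toQuot (s x)
           map_sup' := fun x y => toQuot_eq_toQuot (hs (x ⊔ y)) ((hs x).sup (hs y))
           map_inf' := fun x y => toQuot_eq_toQuot (hs (x ⊓ y)) ((hs x).inf (hs y))
           map_bot' := toQuot_eq_toQuot (hs ⊥) bot
           map_himp' := fun x y => toQuot_eq_toQuot (hs (x ⇨ y)) ((hs x).himp (hs y)) },
    fun hxy => toQuot_eq_toQuot (hs _) hxy⟩

end SubstTop

theorem weak_es_heyting_variety
    (K : (A : Type u) → [inst : HeytingAlgebra A] → Prop)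
    -- closure under homomorphic images
    (hH : ∀ (A : Type u) [HeytingAlgebra A] (B : Type u) [HeytingAlgebra B],
      K A → (∃ f : HeytingHom A B, Function.Surjective f) → K B)
    -- closure under subalgebras
    (hS : ∀ (A : Type u) [HeytingAlgebra A] (B : Type u) [HeytingAlgebra B],
      K A → (∃ f : HeytingHom B A, Function.Injective f) → K B)
    -- closure under products
    (hP : ∀ (I : Type u) (A : I → Type u) [∀ i, HeytingAlgebra (A i)],
      (∀ i, K (A i)) → K (∀ i, A i))
    {A B : Type u} [HeytingAlgebra A] [HeytingAlgebra B]
    (hA : K A) (hB : K B) (h : HeytingHom A B)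
    -- `h` is a `K`-epimorphism
    (hepi : ∀ (C : Type u) [HeytingAlgebra C], K C →
      ∀ g₁ g₂ : HeytingHom B C, g₁.comp h = g₂.comp h → g₁ = g₂)
    -- `B` is generated by `h[A] ∪ {b}`
    (b : B)
    (hgen : ∀ S : Set B, Set.range h ⊆ S → b ∈ S → (⊤ : B) ∈ S → (⊥ : B) ∈ S →
      (∀ x ∈ S, ∀ y ∈ S, x ⊓ y ∈ S) → (∀ x ∈ S, ∀ y ∈ S, x ⊔ y ∈ S) →
      (∀ x ∈ S, ∀ y ∈ S, x ⇨ y ∈ S) → S = Set.univ) :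
    Function.Surjective h := by
  have total : {x | ∃ y, SubstTop h b x y} = Set.univ := by
    refine hgen _ ?_ ⟨⊤, .var⟩ ⟨⊤, .top⟩ ⟨⊥, .bot⟩ ?_ ?_ ?_
    · rintro _ ⟨a, rfl⟩
      exact ⟨h a, .const a⟩
    · rintro x ⟨x', hx⟩ y ⟨y', hy⟩
      exact ⟨_, hx.inf hy⟩
    · rintro x ⟨x', hx⟩ y ⟨y', hy⟩
      exact ⟨_, hx.sup hy⟩
    · rintro x ⟨x', hx⟩ y ⟨y', hy⟩
      exact ⟨_, hx.himp hy⟩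
  obtain ⟨g, hg⟩ := SubstTop.exists_hom (Set.eq_univ_iff_forall.1 total)
  have hKC : K (SubstTop.filter h b).Quot :=
    hH B _ hB ⟨(SubstTop.filter h b).toQuotHom, Order.PFilter.toQuot_surjective⟩
  have hgq : g = (SubstTop.filter h b).toQuotHom :=
    hepi _ hKC _ _ (HeytingHom.ext fun a => hg (.const a))
  have htop : (SubstTop.filter h b).toQuot ⊤ = (SubstTop.filter h b).toQuot b :=
    (hg .var).symm.trans (DFunLike.congr_fun hgq b)
  obtain ⟨f, hf, e⟩ := Order.PFilter.toQuot_eq_toQuot.1 htop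
  obtain ⟨y, hy, hyf⟩ := SubstTop.mem_filter.1 hf
  have hyb : y ≤ b := hyf.trans (inf_eq_left.1 (e.symm.trans (inf_top_eq f)))
  have hby : b ≤ y := inf_eq_left.1 (hy.inf_eq_inf.symm.trans (inf_top_eq b))
  have hb : b ∈ Set.range h := hby.antisymm hyb ▸ hy.right_mem_range
  refine Set.range_eq_univ.1 (hgen _ subset_rfl hb ⟨⊤, map_top h⟩ ⟨⊥, map_bot h⟩ ?_ ?_ ?_)
  · rintro _ ⟨a, rfl⟩ _ ⟨c, rfl⟩
    exact ⟨a ⊓ c, map_inf h a c⟩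
  · rintro _ ⟨a, rfl⟩ _ ⟨c, rfl⟩
    exact ⟨a ⊔ c, map_sup h a c⟩
  · rintro _ ⟨a, rfl⟩ _ ⟨c, rfl⟩
    exact ⟨a ⇨ c, map_himp h a c⟩
end

section
/- Weak epimorphism-surjectivity for varieties of Brouwerian algebras: let K be a variety of Brouwerian algebras and let h : A → B be a K-epimorphism with A, B ∈ K. If there is b ∈ B such that B is generated by h[A] ∪ {b} (i.e., the only subset of B containing h[A] ∪ {b}, containing ⊤, and closed under ⊓, ⊔ and ⇨ is B itself), then h is surjective. -/
/-!
STATEMENT 4: Weak epimorphism-surjectivity for varieties of Brouwerian algebras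
(= generalized Heyting algebras).
-/

universe u

namespace BrouwerianQuotient

variable {B : Type u} [GeneralizedHeytingAlgebra B]

/-- The congruence of a Brouwerian algebra associated with a filter. -/
def filterSetoid (F : Order.PFilter B) : Setoid B where
  r x y := ∃ f ∈ F, x ⊓ f = y ⊓ f
  iseqv :=
    { refl := fun _ => ⟨⊤, F.top_mem, rfl⟩
      symm := fun ⟨f, hf, e⟩ => ⟨f, hf, e.symm⟩
      trans := by
        rintro x y z ⟨f, hf, e⟩ ⟨g, hg, e'⟩
        refine ⟨f ⊓ g, F.inf_mem hf hg, ?_⟩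
        rw [← inf_assoc, e, inf_right_comm, e', inf_right_comm, inf_assoc] }

/-- The quotient of a Brouwerian algebra by a filter. -/
def FilterQuotient (F : Order.PFilter B) : Type u := Quotient (filterSetoid F)

variable {F : Order.PFilter B}

/-- The canonical projection onto the quotient by a filter. -/
def proj (F : Order.PFilter B) (x : B) : FilterQuotient F := Quotient.mk (filterSetoid F) x

theorem proj_surjective : Function.Surjective (proj F) := Quotient.mk_surjective

theorem proj_eq_iff {x y : B} : proj F x = proj F y ↔ ∃ f ∈ F, x ⊓ f = y ⊓ f :=
  Quotient.eq (r := filterSetoid F)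

theorem proj_eq_top_iff {x : B} : proj F x = proj F ⊤ ↔ x ∈ F := by
  rw [proj_eq_iff]
  constructor
  · rintro ⟨f, hf, e⟩
    exact F.mem_of_le (by rw [top_inf_eq] at e; exact inf_eq_right.1 e) hf
  · exact fun hx => ⟨x, hx, by simp⟩

theorem inf_inf_congr {x x' y y' f g : B} (hx : x ⊓ f = x' ⊓ f) (hy : y ⊓ g = y' ⊓ g) :
    (x ⊓ y) ⊓ (f ⊓ g) = (x' ⊓ y') ⊓ (f ⊓ g) := by
  rw [inf_inf_inf_comm, hx, hy, inf_inf_inf_comm]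

theorem sup_inf_congr {x x' y y' f : B} (hx : x ⊓ f = x' ⊓ f) (hy : y ⊓ f = y' ⊓ f) :
    (x ⊔ y) ⊓ f = (x' ⊔ y') ⊓ f := by
  rw [inf_sup_right, hx, hy, inf_sup_right]

theorem himp_inf_le_himp {x x' y y' f : B} (hx : x ⊓ f = x' ⊓ f) (hy : y ⊓ f = y' ⊓ f) :
    (x ⇨ y) ⊓ f ≤ x' ⇨ y' := by
  rw [le_himp_iff]
  calc (x ⇨ y) ⊓ f ⊓ x' = (x ⇨ y) ⊓ (x' ⊓ f) := by rw [inf_assoc, inf_comm f]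
    _ = ((x ⇨ y) ⊓ x) ⊓ f := by rw [← hx, inf_assoc]
    _ ≤ y ⊓ f := inf_le_inf_right _ himp_inf_le
    _ ≤ y' := by rw [hy]; exact inf_le_left

theorem himp_inf_congr {x x' y y' f : B} (hx : x ⊓ f = x' ⊓ f) (hy : y ⊓ f = y' ⊓ f) :
    (x ⇨ y) ⊓ f = (x' ⇨ y') ⊓ f :=
  le_antisymm (le_inf (himp_inf_le_himp hx hy) inf_le_right)
    (le_inf (himp_inf_le_himp hx.symm hy.symm) inf_le_right)

theorem inf_eq_of_le {x y f g : B} (hgf : g ≤ f) (e : x ⊓ f = y ⊓ f) : x ⊓ g = y ⊓ g := by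
  rw [← inf_eq_right.2 hgf, ← inf_assoc, e, inf_assoc]

theorem proj_congr₂ {op : B → B → B}
    (hop : ∀ {x x' y y' f : B}, x ⊓ f = x' ⊓ f → y ⊓ f = y' ⊓ f → op x y ⊓ f = op x' y' ⊓ f)
    {x x' y y' : B} (hx : proj F x = proj F x') (hy : proj F y = proj F y') :
    proj F (op x y) = proj F (op x' y') := by
  obtain ⟨f, hf, e⟩ := proj_eq_iff.1 hx
  obtain ⟨g, hg, e'⟩ := proj_eq_iff.1 hy
  exact proj_eq_iff.2 ⟨f ⊓ g, F.inf_mem hf hg,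
    hop (inf_eq_of_le inf_le_left e) (inf_eq_of_le inf_le_right e')⟩

/-- The operation induced on the quotient by a compatible binary operation. -/
def lift₂ (op : B → B → B)
    (hop : ∀ {x x' y y' f : B}, x ⊓ f = x' ⊓ f → y ⊓ f = y' ⊓ f → op x y ⊓ f = op x' y' ⊓ f) :
    FilterQuotient F → FilterQuotient F → FilterQuotient F :=
  Quotient.lift₂ (s₁ := filterSetoid F) (s₂ := filterSetoid F) (fun x y => proj F (op x y))
    fun _ _ _ _ hx hy => proj_congr₂ hop (proj_eq_iff.2 hx) (proj_eq_iff.2 hy)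

instance : Max (FilterQuotient F) := ⟨lift₂ (· ⊔ ·) sup_inf_congr⟩

instance : Min (FilterQuotient F) :=
  ⟨lift₂ (· ⊓ ·) fun {_ _ _ _ f} hx hy => by simpa using inf_inf_congr (f := f) (g := f) hx hy⟩

theorem proj_sup (x y : B) : proj F (x ⊔ y) = proj F x ⊔ proj F y := rfl

theorem proj_inf (x y : B) : proj F (x ⊓ y) = proj F x ⊓ proj F y := rfl

instance : Lattice (FilterQuotient F) :=
  Lattice.mk'
    (proj_surjective.forall₂.2 fun x y => by rw [← proj_sup, sup_comm, proj_sup])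
    (proj_surjective.forall₃.2 fun x y z => by simp only [← proj_sup, sup_assoc])
    (proj_surjective.forall₂.2 fun x y => by rw [← proj_inf, inf_comm, proj_inf])
    (proj_surjective.forall₃.2 fun x y z => by simp only [← proj_inf, inf_assoc])
    (proj_surjective.forall₂.2 fun x y => by rw [← proj_inf, ← proj_sup, sup_inf_self])
    (proj_surjective.forall₂.2 fun x y => by rw [← proj_sup, ← proj_inf, inf_sup_self])

theorem proj_le_proj_iff {x y : B} : proj F x ≤ proj F y ↔ x ⇨ y ∈ F := by
  rw [← inf_eq_left, ← proj_inf, proj_eq_iff]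
  constructor
  · rintro ⟨f, hf, e⟩
    refine F.mem_of_le (le_himp_iff.2 ?_) hf
    rw [inf_comm, ← e]
    exact inf_le_left.trans inf_le_right
  · exact fun hxy => ⟨x ⇨ y, hxy, by rw [inf_right_comm, inf_himp, inf_assoc, inf_idem]⟩

instance : GeneralizedHeytingAlgebra (FilterQuotient F) where
  top := proj F ⊤
  himp := lift₂ (· ⇨ ·) himp_inf_congr
  le_top := proj_surjective.forall.2 fun x => by
    change proj F x ≤ proj F ⊤
    rw [proj_le_proj_iff, himp_top]
    exact F.top_mem
  le_himp_iff := proj_surjective.forall₃.2 fun x y z => by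
    change proj F x ≤ proj F (y ⇨ z) ↔ proj F (x ⊓ y) ≤ proj F z
    rw [proj_le_proj_iff, proj_le_proj_iff, himp_himp]

theorem isBrouwerianHom_proj (F : Order.PFilter B) : IsBrouwerianHom (proj F) where
  map_inf _ _ := rfl
  map_sup _ _ := rfl
  map_himp _ _ := rfl
  map_top := rfl

end BrouwerianQuotient

namespace IsBrouwerianHom

variable {A : Type*} {B : Type*} [GeneralizedHeytingAlgebra B]

/-- The pairs `(t(b), t(⊤))`, where `t` runs through the unary polynomials with coefficients in
the range of `h`. -/
inductive PolyPair (h : A → B) (b : B) : B → B → Prop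
  | coeff (a : A) : PolyPair h b (h a) (h a)
  | var : PolyPair h b b ⊤
  | inf {x y x' y' : B} : PolyPair h b x x' → PolyPair h b y y' → PolyPair h b (x ⊓ y) (x' ⊓ y')
  | sup {x y x' y' : B} : PolyPair h b x x' → PolyPair h b y y' → PolyPair h b (x ⊔ y) (x' ⊔ y')
  | himp {x y x' y' : B} : PolyPair h b x x' → PolyPair h b y y' → PolyPair h b (x ⇨ y) (x' ⇨ y')

variable {h : A → B} {b x y : B}

theorem PolyPair.inf_eq (p : PolyPair h b x y) : x ⊓ b = y ⊓ b := by
  induction p with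
  | coeff => rfl
  | var => simp
  | inf _ _ hx hy => simpa using BrouwerianQuotient.inf_inf_congr hx hy
  | sup _ _ hx hy => exact BrouwerianQuotient.sup_inf_congr hx hy
  | himp _ _ hx hy => exact BrouwerianQuotient.himp_inf_congr hx hy

variable [GeneralizedHeytingAlgebra A]

theorem PolyPair.mem_range (hh : IsBrouwerianHom h) (p : PolyPair h b x y) :
    y ∈ Set.range h := by
  induction p with
  | coeff a => exact ⟨a, rfl⟩
  | var => exact ⟨⊤, hh.map_top⟩
  | inf _ _ hx hy =>
    obtain ⟨⟨u, rfl⟩, ⟨v, rfl⟩⟩ := And.intro hx hy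
    exact ⟨u ⊓ v, hh.map_inf u v⟩
  | sup _ _ hx hy =>
    obtain ⟨⟨u, rfl⟩, ⟨v, rfl⟩⟩ := And.intro hx hy
    exact ⟨u ⊔ v, hh.map_sup u v⟩
  | himp _ _ hx hy =>
    obtain ⟨⟨u, rfl⟩, ⟨v, rfl⟩⟩ := And.intro hx hy
    exact ⟨u ⇨ v, hh.map_himp u v⟩

theorem polyPair_top (hh : IsBrouwerianHom h) : PolyPair h b ⊤ ⊤ := by
  simpa only [hh.map_top] using PolyPair.coeff (h := h) (b := b) ⊤

/-- The filter generated by the values `t(⊤)` of the polynomials `t` with `t(b) = ⊤`. -/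
def polyFilter (hh : IsBrouwerianHom h) (b : B) : Order.PFilter B :=
  Order.IsPFilter.toPFilter (F := {z | ∃ w, PolyPair h b ⊤ w ∧ w ≤ z}) <|
    Order.IsPFilter.of_def ⟨⊤, ⊤, hh.polyPair_top, le_rfl⟩
      (by
        rintro z ⟨w, hw, hwz⟩ z' ⟨w', hw', hwz'⟩
        exact ⟨w ⊓ w', ⟨w ⊓ w', by simpa using hw.inf hw', le_rfl⟩,
          inf_le_left.trans hwz, inf_le_right.trans hwz'⟩)
      (by
        rintro z z' hzz' ⟨w, hw, hwz⟩
        exact ⟨w, hw, hwz.trans hzz'⟩)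

theorem mem_polyFilter {hh : IsBrouwerianHom h} {z : B} :
    z ∈ polyFilter hh b ↔ ∃ w, PolyPair h b ⊤ w ∧ w ≤ z := Iff.rfl

theorem mem_range_of_mem_polyFilter {hh : IsBrouwerianHom h} (hb : b ∈ polyFilter hh b) :
    b ∈ Set.range h := by
  obtain ⟨w, hw, hwb⟩ := mem_polyFilter.1 hb
  have e : b = w := by simpa [inf_eq_left.2 hwb] using hw.inf_eq
  rw [e]
  exact hw.mem_range hh

theorem PolyPair.proj_eq (hh : IsBrouwerianHom h) {y' : B} (p : PolyPair h b x y)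
    (p' : PolyPair h b x y') :
    BrouwerianQuotient.proj (polyFilter hh b) y = BrouwerianQuotient.proj (polyFilter hh b) y' := by
  apply le_antisymm <;> rw [BrouwerianQuotient.proj_le_proj_iff, mem_polyFilter]
  · exact ⟨_, by simpa using p.himp p', le_rfl⟩
  · exact ⟨_, by simpa using p'.himp p, le_rfl⟩

end IsBrouwerianHom

open BrouwerianQuotient IsBrouwerianHom in
theorem weak_es_brouwerian_variety
    (K : (A : Type u) → [inst : GeneralizedHeytingAlgebra A] → Prop)
    -- closure under homomorphic images
    (hH : ∀ (A : Type u) [GeneralizedHeytingAlgebra A] (B : Type u)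
      [GeneralizedHeytingAlgebra B],
      K A → (∃ f : A → B, IsBrouwerianHom f ∧ Function.Surjective f) → K B)
    -- closure under subalgebras
    (hS : ∀ (A : Type u) [GeneralizedHeytingAlgebra A] (B : Type u)
      [GeneralizedHeytingAlgebra B],
      K A → (∃ f : B → A, IsBrouwerianHom f ∧ Function.Injective f) → K B)
    -- closure under products
    (hP : ∀ (I : Type u) (A : I → Type u) [∀ i, GeneralizedHeytingAlgebra (A i)],
      (∀ i, K (A i)) → K (∀ i, A i))
    {A B : Type u} [GeneralizedHeytingAlgebra A] [GeneralizedHeytingAlgebra B]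
    (hA : K A) (hB : K B) (h : A → B) (hhom : IsBrouwerianHom h)
    -- `h` is a `K`-epimorphism
    (hepi : ∀ (C : Type u) [GeneralizedHeytingAlgebra C], K C →
      ∀ g₁ g₂ : B → C, IsBrouwerianHom g₁ → IsBrouwerianHom g₂ →
        g₁ ∘ h = g₂ ∘ h → g₁ = g₂)
    -- `B` is generated by `h[A] ∪ {b}`
    (b : B)
    (hgen : ∀ S : Set B, Set.range h ⊆ S → b ∈ S → (⊤ : B) ∈ S →
      (∀ x ∈ S, ∀ y ∈ S, x ⊓ y ∈ S) → (∀ x ∈ S, ∀ y ∈ S, x ⊔ y ∈ S) →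
      (∀ x ∈ S, ∀ y ∈ S, x ⇨ y ∈ S) → S = Set.univ) :
    Function.Surjective h := by
  have htotal : ∀ x, ∃ y, PolyPair h b x y := by
    refine Set.eq_univ_iff_forall.1 (hgen {x | ∃ y, PolyPair h b x y} ?_ ⟨⊤, .var⟩
      ⟨⊤, hhom.polyPair_top⟩ ?_ ?_ ?_)
    · rintro _ ⟨a, rfl⟩
      exact ⟨h a, .coeff a⟩
    · rintro x ⟨x', hx⟩ y ⟨y', hy⟩
      exact ⟨_, hx.inf hy⟩
    · rintro x ⟨x', hx⟩ y ⟨y', hy⟩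
      exact ⟨_, hx.sup hy⟩
    · rintro x ⟨x', hx⟩ y ⟨y', hy⟩
      exact ⟨_, hx.himp hy⟩
  choose s hs using htotal
  let F := polyFilter hhom b
  have hs_hom : IsBrouwerianHom (fun x => proj F (s x)) :=
    { map_inf := fun x y => (hs _).proj_eq hhom ((hs x).inf (hs y))
      map_sup := fun x y => (hs _).proj_eq hhom ((hs x).sup (hs y))
      map_himp := fun x y => (hs _).proj_eq hhom ((hs x).himp (hs y))
      map_top := (hs _).proj_eq hhom hhom.polyPair_top }
  have heq : proj F = fun x => proj F (s x) :=
    hepi _ (hH B _ hB ⟨proj F, isBrouwerianHom_proj F, proj_surjective⟩) _ _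
      (isBrouwerianHom_proj F) hs_hom
      (funext fun a => PolyPair.proj_eq hhom (.coeff a) (hs (h a)))
  have hb : b ∈ Set.range h := mem_range_of_mem_polyFilter (hh := hhom) <|
    proj_eq_top_iff.1 ((congrFun heq b).trans ((hs b).proj_eq hhom .var))
  refine Set.range_eq_univ.1 (hgen _ subset_rfl hb ⟨⊤, hhom.map_top⟩ ?_ ?_ ?_)
  · rintro _ ⟨x, rfl⟩ _ ⟨y, rfl⟩
    exact ⟨x ⊓ y, hhom.map_inf x y⟩
  · rintro _ ⟨x, rfl⟩ _ ⟨y, rfl⟩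
    exact ⟨x ⊔ y, hhom.map_sup x y⟩
  · rintro _ ⟨x, rfl⟩ _ ⟨y, rfl⟩
    exact ⟨x ⇨ y, hhom.map_himp x y⟩
end

section
/- Depth formula for Heyting algebras (Ono–Maksimova): for every n ∈ ℕ, a Heyting algebra A satisfies the identity hₙ ≈ ⊤ if and only if there is no strictly increasing chain F₀ ⊊ F₁ ⊊ ⋯ ⊊ Fₙ of n + 1 prime filters of A. -/
/-!
STATEMENT 5: Ono–Maksimova depth formula for Heyting algebras: `A` satisfies the
identity `hₙ ≈ ⊤` iff there is no strictly increasing chain of `n + 1` prime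
filters of `A`.
-/

universe u

/-- The depth terms: `hTerm 0 a = a 0` (the variable `y`) and
`hTerm (n+1) a = a (n+1) ⊔ (a (n+1) ⇨ hTerm n a)`. -/
def hTerm {α : Type*} [GeneralizedHeytingAlgebra α] : ℕ → (ℕ → α) → α
  | 0, a => a 0
  | n + 1, a => a (n + 1) ⊔ (a (n + 1) ⇨ hTerm n a)

/-- A filter of a lattice: a nonempty upward-closed subset closed under `⊓`. -/
structure IsLatticeFilter {L : Type*} [Lattice L] (F : Set L) : Prop where
  nonempty : F.Nonempty
  mem_of_le : ∀ {x y}, x ∈ F → x ≤ y → y ∈ F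
  inf_mem : ∀ {x y}, x ∈ F → y ∈ F → x ⊓ y ∈ F

/-- A prime filter: a proper filter such that `x ⊔ y ∈ F` implies `x ∈ F` or `y ∈ F`. -/
structure IsPrimeFilter {L : Type*} [Lattice L] (F : Set L) extends
    IsLatticeFilter F : Prop where
  ne_univ : F ≠ Set.univ
  mem_or_mem : ∀ {x y}, x ⊔ y ∈ F → x ∈ F ∨ y ∈ F

section PrimeFilters

variable {L : Type*}

/-- The preimage of a filter of a Heyting algebra under `a ⇨ ·` is a filter. -/
theorem IsLatticeFilter.preimage_himp [GeneralizedHeytingAlgebra L] {F : Set L}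
    (hF : IsLatticeFilter F) (a : L) : IsLatticeFilter {x | a ⇨ x ∈ F} where
  nonempty := by
    obtain ⟨x, hx⟩ := hF.nonempty
    exact ⟨x, hF.mem_of_le hx le_himp⟩
  mem_of_le hx hxy := hF.mem_of_le hx (himp_le_himp_left hxy)
  inf_mem {x y} hx hy := by
    simpa only [Set.mem_ofPred_eq, himp_inf_distrib] using hF.inf_mem hx hy

theorem isLatticeFilter_singleton_top [Lattice L] [OrderTop L] :
    IsLatticeFilter ({⊤} : Set L) where
  nonempty := ⟨⊤, rfl⟩
  mem_of_le hx hxy := top_le_iff.1 (hx ▸ hxy)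
  inf_mem hx hy := inf_eq_top_iff.2 ⟨hx, hy⟩

theorem IsPrimeFilter.exists_notMem [Lattice L] {F : Set L} (hF : IsPrimeFilter F) :
    ∃ x, x ∉ F :=
  (Set.ne_univ_iff_exists_notMem F).1 hF.ne_univ

/-- The complement of a prime ideal is a prime filter. -/
theorem Order.Ideal.IsPrime.isPrimeFilter_compl [Lattice L] {J : Order.Ideal L}
    (hJ : J.IsPrime) : IsPrimeFilter (J : Set L)ᶜ where
  nonempty := (Set.ne_univ_iff_exists_notMem _).1 hJ.toIsProper.ne_univ
  mem_of_le hx hxy hy := hx (J.lower hxy hy)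
  inf_mem hx hy h := (hJ.mem_or_mem h).elim hx hy
  ne_univ h := by
    obtain ⟨x, hx⟩ := J.nonempty
    exact (h ▸ Set.mem_univ x : x ∈ (J : Set L)ᶜ) hx
  mem_or_mem {x y} h := by
    by_contra! hxy
    exact h (J.sup_mem (not_not.1 hxy.1) (not_not.1 hxy.2))

/-- The prime filter theorem: a filter of a distributive lattice extends to a prime filter
avoiding a given element outside it. -/
theorem IsLatticeFilter.exists_isPrimeFilter_notMem [DistribLattice L] {F : Set L}
    (hF : IsLatticeFilter F) {z : L} (hz : z ∉ F) :
    ∃ G, IsPrimeFilter G ∧ F ⊆ G ∧ z ∉ G := by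
  have hF' : Order.IsPFilter F := Order.IsPFilter.of_def hF.nonempty
    (fun x hx y hy => ⟨x ⊓ y, hF.inf_mem hx hy, inf_le_left, inf_le_right⟩)
    (fun hxy hx => hF.mem_of_le hx hxy)
  have hdisj : Disjoint (hF'.toPFilter : Set L) (Order.Ideal.principal z : Set L) :=
    Set.disjoint_left.2 fun x hx hxz => hz (hF.mem_of_le hx hxz)
  obtain ⟨J, hJ, hzJ, hFJ⟩ := DistribLattice.prime_ideal_of_disjoint_filter_ideal hdisj
  exact ⟨(J : Set L)ᶜ, hJ.isPrimeFilter_compl, fun x hx => Set.disjoint_left.1 hFJ hx,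
    fun h => h (hzJ Order.Ideal.mem_principal_self)⟩

end PrimeFilters

section DepthTerms

variable {A : Type*}

theorem hTerm_congr [GeneralizedHeytingAlgebra A] {n : ℕ} {a b : ℕ → A}
    (h : ∀ i ≤ n, a i = b i) : hTerm n a = hTerm n b := by
  induction n with
  | zero => exact h 0 le_rfl
  | succ n ih =>
    simp only [hTerm, h (n + 1) le_rfl, ih fun i hi => h i (hi.trans n.le_succ)]

/-- If a prime filter omits a value of the `n`-th depth term, then it is the first of a strictly
increasing chain of `n + 1` prime filters. -/
theorem IsPrimeFilter.exists_strictMono_of_hTerm_notMem [GeneralizedHeytingAlgebra A] {n : ℕ}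
    {a : ℕ → A} {P : Set A} (hP : IsPrimeFilter P) (h : hTerm n a ∉ P) :
    ∃ F : Fin (n + 1) → Set A, (∀ i, IsPrimeFilter (F i)) ∧ StrictMono F ∧ F 0 = P := by
  induction n generalizing P with
  | zero => exact ⟨fun _ => P, fun _ => hP, Fin.strictMono_iff_lt_succ.2 fun i => i.elim0, rfl⟩
  | succ n ih =>
    have ha : a (n + 1) ∉ P := fun ha => h (hP.mem_of_le ha le_sup_left)
    have himp : hTerm n a ∉ {x | a (n + 1) ⇨ x ∈ P} :=
      fun hx => h (hP.mem_of_le hx le_sup_right)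
    obtain ⟨G, hG, hPG, hnG⟩ :=
      (hP.preimage_himp (a (n + 1))).exists_isPrimeFilter_notMem himp
    have haG : a (n + 1) ∈ G := by
      obtain ⟨x, hx⟩ := hP.nonempty
      exact hPG (hP.mem_of_le hx (by simp))
    have hlt : P < G :=
      ⟨fun x hx => hPG (hP.mem_of_le hx le_himp), fun hGP => ha (hGP haG)⟩
    obtain ⟨F, hF, hmono, rfl⟩ := ih hG hnG
    refine ⟨Fin.cons P F, Fin.cases hP hF, Fin.strictMono_iff_lt_succ.2 ?_, rfl⟩
    refine Fin.cases hlt fun i => ?_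
    cases n with
    | zero => exact i.elim0
    | succ n => exact hmono i.castSucc_lt_succ

/-- A strictly increasing chain of `n + 1` prime filters yields a value of the `n`-th depth term
outside the first of them. -/
theorem exists_hTerm_notMem_of_strictMono [GeneralizedHeytingAlgebra A] {n : ℕ}
    {F : Fin (n + 1) → Set A} (hF : ∀ i, IsPrimeFilter (F i)) (hmono : StrictMono F) :
    ∃ a : ℕ → A, hTerm n a ∉ F 0 := by
  induction n with
  | zero =>
    obtain ⟨x, hx⟩ := (hF 0).exists_notMem
    exact ⟨fun _ => x, hx⟩
  | succ n ih =>
    obtain ⟨a, ha⟩ := ih (F := fun i => F i.succ) (fun i => hF i.succ)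
      (hmono.comp Fin.strictMono_succ)
    have hlt : F 0 < F (Fin.succ 0) := hmono (Fin.succ_pos 0)
    obtain ⟨b, hb, hb0⟩ := Set.exists_of_ssubset hlt
    refine ⟨Function.update a (n + 1) b, fun h => ?_⟩
    have hcongr : hTerm n (Function.update a (n + 1) b) = hTerm n a :=
      hTerm_congr fun i hi => Function.update_of_ne (by omega) _ _
    rw [hTerm, hcongr, Function.update_self] at h
    have himp := hlt.le (((hF 0).mem_or_mem h).resolve_left hb0)
    exact ha ((hF _).mem_of_le ((hF _).inf_mem hb himp) inf_himp_le)

end DepthTerms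

theorem heyting_depth_formula (n : ℕ) {A : Type u} [HeytingAlgebra A] :
    (∀ a : ℕ → A, hTerm n a = ⊤) ↔
      ¬ ∃ F : Fin (n + 1) → Set A, (∀ i, IsPrimeFilter (F i)) ∧ StrictMono F := by
  rw [← not_iff_not, not_not, not_forall]
  constructor
  · rintro ⟨a, ha⟩
    obtain ⟨P, hP, -, haP⟩ := isLatticeFilter_singleton_top.exists_isPrimeFilter_notMem ha
    obtain ⟨F, hF, hmono, -⟩ := hP.exists_strictMono_of_hTerm_notMem haP
    exact ⟨F, hF, hmono⟩
  · rintro ⟨F, hF, hmono⟩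
    obtain ⟨a, ha⟩ := exists_hTerm_notMem_of_strictMono hF hmono
    obtain ⟨x, hx⟩ := (hF 0).nonempty
    exact ⟨a, fun h => ha (h ▸ (hF 0).mem_of_le hx le_top)⟩
end

section
/- Transfer of the depth identities under adding a bottom: let n ∈ ℕ and let B be a Heyting algebra with ⊥ ≠ ⊤ such that the set A = {x ∈ B : x ≠ ⊥} is closed under ⊓ and ⇨ (so A is a Brouwerian subalgebra of B and B arises from A by adjoining a new least element). Then hₙ(a₀, a₁, …, aₙ) = ⊤ for all a₀, …, aₙ ∈ A if and only if B satisfies h_{n+1} ≈ ⊤ (i.e., h_{n+1}(b₀, b₁, …, b_{n+1}) = ⊤ for all b₀, …, b_{n+1} ∈ B). -/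
/-!
STATEMENT 6: Transfer of the depth identities under adding a bottom: if `B` is a
Heyting algebra with `⊥ ≠ ⊤` whose set `A = {x : B | x ≠ ⊥}` of nonbottom elements
is closed under `⊓` and `⇨` (so `B` arises from the Brouwerian subalgebra `A` by
adjoining a new least element), then `A` satisfies `hₙ ≈ ⊤` iff `B` satisfies
`h_{n+1} ≈ ⊤`.
-/

universe u

theorem hTerm_succ_eq_hTerm {α : Type*} [GeneralizedHeytingAlgebra α] {a b : ℕ → α}
    (h₀ : a 0 = hTerm 1 b) (h : ∀ i, a (i + 1) = b (i + 2)) (n : ℕ) :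
    hTerm n a = hTerm (n + 1) b := by
  induction n with
  | zero => exact h₀
  | succ n ih => rw [hTerm, ih, h, ← hTerm]

theorem hTerm_eq_top_of_le {α : Type*} [GeneralizedHeytingAlgebra α] {b : ℕ → α} {k m : ℕ}
    (hkm : k ≤ m) (hk : hTerm k b = ⊤) : hTerm m b = ⊤ := by
  induction m, hkm using Nat.le_induction with
  | base => exact hk
  | succ m _ ih => simp [hTerm, ih]

theorem depth_formula_add_bot (n : ℕ) {B : Type u} [HeytingAlgebra B]
    (hne : (⊥ : B) ≠ ⊤)
    (hinf : ∀ x y : B, x ≠ ⊥ → y ≠ ⊥ → x ⊓ y ≠ ⊥)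
    (hhimp : ∀ x y : B, x ≠ ⊥ → y ≠ ⊥ → x ⇨ y ≠ ⊥) :
    (∀ a : ℕ → B, (∀ i, i ≤ n → a i ≠ ⊥) → hTerm n a = ⊤) ↔
      (∀ b : ℕ → B, hTerm (n + 1) b = ⊤) := by
  constructor
  · intro h b
    by_cases hb : ∃ k ≤ n, b (k + 1) = ⊥
    · obtain ⟨k, hk, hbk⟩ := hb
      exact hTerm_eq_top_of_le (Nat.succ_le_succ hk) (by simp [hTerm, hbk])
    · push Not at hb
      rw [← hTerm_succ_eq_hTerm (a := fun i => if i = 0 then hTerm 1 b else b (i + 1))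
        (by simp) (by simp)]
      refine h _ fun i hi => ?_
      split_ifs with hi₀
      · exact ne_bot_of_le_ne_bot (hb 0 n.zero_le) le_sup_left
      · exact hb i hi
  · intro h a ha
    have h_compl : a 0 ⇨ ⊥ = ⊥ := by
      by_contra hc
      exact hinf _ _ (ha 0 n.zero_le) hc (by simp)
    rw [hTerm_succ_eq_hTerm (b := fun i => if i = 0 then ⊥ else a (i - 1)) ?_ (by simp)]
    · exact h _
    · simp [hTerm, -himp_bot, h_compl]
end

section
/- Uniform depth bound for finitely generated Heyting varieties: let B be a finite Heyting algebra. Then there exists n ∈ ℕ such that for every Heyting algebra A ∈ HSP(B) and every prime filter F of A, the collection of all filters of A containing F has at most n elements; in particular, every strictly increasing chain of prime filters of A has at most n elements. -/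
/-!
STATEMENT 8: Uniform depth bound for finitely generated Heyting varieties: for a
finite Heyting algebra `B` there is `n : ℕ` such that for every `A ∈ HSP(B)` and
every prime filter `F` of `A`, the set of filters of `A` containing `F` has at
most `n` elements; in particular every strictly increasing chain of prime filters
of `A` has at most `n` elements.
-/

universe u

/-- `A` lies in the variety `HSP(B)` generated by the Heyting algebra `B`:
`A` is a homomorphic image of a subalgebra of a power of `B`. -/
def HeytingInHSP (B : Type u) [HeytingAlgebra B] (A : Type u) [HeytingAlgebra A] :
    Prop :=
  ∃ (I : Type u) (S : HeytAlg.{u}) (f : HeytingHom S (I → B)) (g : HeytingHom S A),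
    Function.Injective f ∧ Function.Surjective g

open scoped symmDiff

theorem IsLatticeFilter.top_mem {L : Type*} [Lattice L] [OrderTop L] {F : Set L}
    (hF : IsLatticeFilter F) : ⊤ ∈ F :=
  let ⟨_, hx⟩ := hF.nonempty
  hF.mem_of_le hx le_top

theorem IsPrimeFilter.bot_notMem {L : Type*} [Lattice L] [OrderBot L] {F : Set L}
    (hF : IsPrimeFilter F) : ⊥ ∉ F := fun h =>
  hF.ne_univ (Set.eq_univ_of_forall fun _ => hF.mem_of_le h bot_le)

theorem IsPrimeFilter.exists_mem_of_finset_sup_mem {L ι : Type*} [Lattice L] [OrderBot L]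
    {F : Set L} (hF : IsPrimeFilter F) {s : Finset ι} {x : ι → L} (h : s.sup x ∈ F) :
    ∃ i ∈ s, x i ∈ F := by
  classical
  induction s using Finset.induction_on with
  | empty => exact absurd h hF.bot_notMem
  | insert a s _ ih =>
    rw [Finset.sup_insert] at h
    rcases hF.mem_or_mem h with h | h
    · exact ⟨a, Finset.mem_insert_self a s, h⟩
    · obtain ⟨i, hi, hx⟩ := ih h
      exact ⟨i, Finset.mem_insert_of_mem hi, hx⟩

/-- The congruence of a Heyting algebra associated with a filter. -/
def IsLatticeFilter.setoid {A : Type*} [HeytingAlgebra A] {F : Set A}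
    (hF : IsLatticeFilter F) : Setoid A where
  r a b := a ⇔ b ∈ F
  iseqv :=
    { refl := fun a => by
        rw [bihimp_self]
        exact hF.top_mem
      symm := fun {a b} h => by
        rwa [bihimp_comm]
      trans := fun h₁ h₂ => hF.mem_of_le (hF.inf_mem h₁ h₂) (bihimp_triangle _ _ _) }

theorem IsLatticeFilter.mem_of_bihimp_mem {A : Type*} [HeytingAlgebra A] {G : Set A}
    (hG : IsLatticeFilter G) {a b : A} (hab : a ⇔ b ∈ G) (ha : a ∈ G) : b ∈ G :=
  hG.mem_of_le (hG.inf_mem ha (hG.mem_of_le hab inf_le_right)) inf_himp_le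

/-- Among more than `Nat.card B` elements of an algebra in `HSP(B)`, the join of the
equivalences of distinct pairs is `⊤`. -/
theorem HeytingInHSP.finset_sup_bihimp_eq_top {B A : Type u} [HeytingAlgebra B] [Finite B]
    [HeytingAlgebra A] (h : HeytingInHSP B A) {ι : Type*} [Fintype ι] [DecidableEq ι]
    (hι : Nat.card B < Nat.card ι) (x : ι → A) :
    (Finset.univ.offDiag.sup fun p : ι × ι => x p.1 ⇔ x p.2) = ⊤ := by
  obtain ⟨I, S, f, g, hf, hg⟩ := h
  choose y hy using fun i => hg (x i)
  have key : (Finset.univ.offDiag.sup fun p : ι × ι => y p.1 ⇔ y p.2) = ⊤ := by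
    apply hf
    rw [map_finset_sup, map_top]
    funext k
    obtain ⟨i, j, hij, he⟩ : ∃ i j, i ≠ j ∧ f (y i) k = f (y j) k := by
      by_contra! hne
      exact hι.not_ge (Nat.card_le_card_of_injective (fun i => f (y i) k)
        fun i j hij => by_contra fun hn => hne i j hn hij)
    rw [Finset.sup_apply, Pi.top_apply, eq_top_iff]
    refine le_trans (le_of_eq ?_) (Finset.le_sup (b := (i, j)) (by simpa using hij))
    simp [bihimp, he]
  have := congrArg g key
  rw [map_finset_sup, map_top] at this
  simpa [Function.comp_def, map_bihimp, hy] using this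

theorem HeytingInHSP.finite_quotient_and_card_le {B A : Type u} [HeytingAlgebra B] [Finite B]
    [HeytingAlgebra A] (h : HeytingInHSP B A) {F : Set A} (hF : IsPrimeFilter F) :
    Finite (Quotient hF.setoid) ∧ Nat.card (Quotient hF.setoid) ≤ Nat.card B := by
  have no_embedding (e : Fin (Nat.card B + 1) ↪ Quotient hF.setoid) : False := by
    have hsup := h.finset_sup_bihimp_eq_top (ι := Fin (Nat.card B + 1)) (by simp)
      fun i => (e i).out
    obtain ⟨p, hp, hmem⟩ := hF.exists_mem_of_finset_sup_mem (hsup ▸ hF.top_mem)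
    exact (Finset.mem_offDiag.1 hp).2.2 (e.injective (Quotient.out_equiv_out.1 hmem))
  have hfin : Finite (Quotient hF.setoid) := by
    by_contra hinf
    rw [not_finite_iff_infinite] at hinf
    exact no_embedding (Fin.valEmbedding.trans (Infinite.natEmbedding _))
  refine ⟨hfin, ?_⟩
  by_contra! hlt
  exact no_embedding ((Fin.castLEEmb hlt).trans (Finite.equivFin _).symm.toEmbedding)

theorem IsLatticeFilter.injOn_image_mk {A : Type*} [HeytingAlgebra A] {F : Set A}
    (hF : IsLatticeFilter F) :
    Set.InjOn (fun G : Set A => Quotient.mk hF.setoid '' G)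
      {G | IsLatticeFilter G ∧ F ⊆ G} := by
  have subset_of_image_eq {G H : Set A} (hH : IsLatticeFilter H ∧ F ⊆ H)
      (h : Quotient.mk hF.setoid '' G = Quotient.mk hF.setoid '' H) : G ⊆ H := by
    intro a ha
    obtain ⟨b, hb, hba⟩ := h ▸ Set.mem_image_of_mem (Quotient.mk hF.setoid) ha
    exact hH.1.mem_of_bihimp_mem (hH.2 (Quotient.exact hba)) hb
  exact fun G hG H hH h => (subset_of_image_eq hH h).antisymm (subset_of_image_eq hG h.symm)

theorem HeytingInHSP.finite_and_ncard_filters_le {B A : Type u} [HeytingAlgebra B] [Finite B]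
    [HeytingAlgebra A] (h : HeytingInHSP B A) {F : Set A} (hF : IsPrimeFilter F) :
    {G : Set A | IsLatticeFilter G ∧ F ⊆ G}.Finite ∧
      {G : Set A | IsLatticeFilter G ∧ F ⊆ G}.ncard ≤ 2 ^ Nat.card B := by
  obtain ⟨hfin, hcard⟩ := h.finite_quotient_and_card_le hF
  have hinj := hF.injOn_image_mk
  refine ⟨Set.Finite.of_finite_image (Set.toFinite _) hinj, ?_⟩
  rw [← hinj.ncard_image]
  calc _ ≤ Nat.card (Set (Quotient hF.setoid)) := by
        rw [← Set.ncard_univ]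
        exact Set.ncard_le_ncard (Set.subset_univ _)
    _ = 2 ^ Nat.card (Quotient hF.setoid) := by
        have := Fintype.ofFinite (Quotient hF.setoid)
        simp [Nat.card_eq_fintype_card]
    _ ≤ 2 ^ Nat.card B := Nat.pow_le_pow_right two_pos hcard

theorem uniform_depth_bound_of_finite (B : Type u) [HeytingAlgebra B] [Finite B] :
    ∃ n : ℕ, ∀ (A : Type u) [HeytingAlgebra A], HeytingInHSP B A →
      (∀ F : Set A, IsPrimeFilter F →
        {G : Set A | IsLatticeFilter G ∧ F ⊆ G}.Finite ∧
        {G : Set A | IsLatticeFilter G ∧ F ⊆ G}.ncard ≤ n) ∧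
      (∀ (m : ℕ) (F : Fin m → Set A),
        (∀ i, IsPrimeFilter (F i)) → StrictMono F → m ≤ n) := by
  refine ⟨2 ^ Nat.card B, fun A _ hA => ⟨fun F hF => hA.finite_and_ncard_filters_le hF, ?_⟩⟩
  intro m F hF hmono
  rcases m with _ | m
  · exact Nat.zero_le _
  obtain ⟨hfin, hle⟩ := hA.finite_and_ncard_filters_le (hF 0)
  calc m + 1 = (Set.range F).ncard := by
        rw [← Set.image_univ, Set.ncard_image_of_injective _ hmono.injective, Set.ncard_univ,
          Nat.card_eq_fintype_card, Fintype.card_fin]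
    _ ≤ {G : Set A | IsLatticeFilter G ∧ F 0 ⊆ G}.ncard := by
        refine Set.ncard_le_ncard ?_ hfin
        rintro _ ⟨i, rfl⟩
        exact ⟨(hF i).toIsLatticeFilter, hmono.monotone (Fin.zero_le i)⟩
    _ ≤ 2 ^ Nat.card B := hle
end

section
/- Local finiteness of Brouwerian algebras of bounded depth: for every n ∈ ℕ, every Brouwerian algebra A that satisfies the identity hₙ ≈ ⊤ and is generated by a finite subset S (i.e., the only subset of A containing S and ⊤ and closed under ⊓, ⊔ and ⇨ is A itself) is finite. -/
/-!
STATEMENT 9: Local finiteness of Brouwerian algebras of bounded depth: every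
Brouwerian algebra satisfying the identity `hₙ ≈ ⊤` that is generated by a finite
subset is finite.
-/

universe u

namespace BrouwerianDepth

open Order

/-- The prime ideals of a lattice, ordered by inclusion. -/
abbrev PrimeIdeal (A : Type*) [Lattice A] : Type _ := {I : Ideal A // I.IsPrime}

/-- `HeightLT k I` says that every strictly decreasing chain starting at `I` has at most `k`
members. -/
def HeightLT {P : Type*} [Preorder P] : ℕ → P → Prop
  | 0, _ => False
  | k + 1, I => ∀ J < I, HeightLT k J

/-- Codes for points up to `k`-step bisimulation over the set `S` of colors. -/
def BisimType {A : Type u} (S : Set A) : ℕ → Type u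
  | 0 => PUnit
  | k + 1 => Set S × Set (BisimType S k)

theorem finite_bisimType {A : Type u} {S : Set A} (hS : S.Finite) (k : ℕ) :
    Finite (BisimType S k) := by
  induction k with
  | zero => exact inferInstanceAs (Finite PUnit)
  | succ k ih =>
    have := hS.to_subtype
    exact inferInstanceAs (Finite (Set S × Set (BisimType S k)))

section Lattice

variable {A : Type u} [Lattice A]

/-- The `k`-step bisimulation type of a prime ideal: its trace on `S` together with the types of
the prime ideals strictly below it. -/
def bisimType (S : Set A) : (k : ℕ) → PrimeIdeal A → BisimType S k
  | 0, _ => PUnit.unit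
  | k + 1, I => ({s | (s : A) ∈ I.1}, bisimType S k '' Set.Iio I)

/-- Membership of `a` is determined by the bisimulation type, at every height. -/
def Invariant (S : Set A) (a : A) : Prop :=
  ∀ (k : ℕ) (I J : PrimeIdeal A), HeightLT k I → HeightLT k J →
    bisimType S k I = bisimType S k J → a ∈ I.1 → a ∈ J.1

theorem inf_mem_iff (I : PrimeIdeal A) {a b : A} : a ⊓ b ∈ I.1 ↔ a ∈ I.1 ∨ b ∈ I.1 :=
  ⟨I.2.mem_or_mem, fun h => h.elim (I.1.lower inf_le_left) (I.1.lower inf_le_right)⟩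

theorem invariant_of_mem {S : Set A} {a : A} (ha : a ∈ S) : Invariant S a := by
  intro k I J hI _ h haI
  cases k with
  | zero => exact hI.elim
  | succ k =>
    have h₁ : {s : S | (s : A) ∈ I.1} = {s : S | (s : A) ∈ J.1} := congrArg Prod.fst h
    exact (Set.ext_iff.1 h₁ ⟨a, ha⟩).1 haI

theorem Invariant.inf {S : Set A} {a b : A} (ha : Invariant S a) (hb : Invariant S b) :
    Invariant S (a ⊓ b) := by
  intro k I J hI hJ h hab
  rw [inf_mem_iff] at hab ⊢
  exact hab.imp (ha k I J hI hJ h) (hb k I J hI hJ h)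

theorem Invariant.sup {S : Set A} {a b : A} (ha : Invariant S a) (hb : Invariant S b) :
    Invariant S (a ⊔ b) := by
  intro k I J hI hJ h hab
  rw [Ideal.sup_mem_iff] at hab ⊢
  exact hab.imp (ha k I J hI hJ h) (hb k I J hI hJ h)

end Lattice

variable {A : Type u} [GeneralizedHeytingAlgebra A]

theorem top_notMem (I : PrimeIdeal A) : ⊤ ∉ I.1 :=
  I.2.toIsProper.top_notMem

theorem himp_mem_iff (I : PrimeIdeal A) {a b : A} :
    a ⇨ b ∈ I.1 ↔ ∃ J ≤ I, a ∉ J.1 ∧ b ∈ J.1 := by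
  constructor
  · intro hab
    have hF : IsPFilter {x : A | ∃ c ∉ I.1, c ⊓ a ≤ x} := by
      refine .of_def ⟨⊤, ⊤, top_notMem I, le_top⟩ ?_ ?_
      · rintro x ⟨c, hc, hcx⟩ y ⟨d, hd, hdy⟩
        refine ⟨x ⊓ y, ⟨c ⊓ d, ?_, ?_⟩, inf_le_left, inf_le_right⟩
        · rw [inf_mem_iff]
          exact not_or.2 ⟨hc, hd⟩
        · exact le_inf ((inf_le_inf_right a inf_le_left).trans hcx)
            ((inf_le_inf_right a inf_le_right).trans hdy)
      · rintro x y hxy ⟨c, hc, hcx⟩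
        exact ⟨c, hc, hcx.trans hxy⟩
    have hdisj : Disjoint (hF.toPFilter : Set A) (Ideal.principal b : Set A) := by
      refine Set.disjoint_left.2 ?_
      rintro x ⟨c, hc, hcx⟩ hxb
      exact hc (I.1.lower (le_himp_iff.2 (hcx.trans hxb)) hab)
    obtain ⟨J, hJ, hbJ, hFJ⟩ := DistribLattice.prime_ideal_of_disjoint_filter_ideal hdisj
    refine ⟨⟨J, hJ⟩, fun x hx => ?_, ?_, hbJ Ideal.mem_principal_self⟩
    · by_contra hxI
      exact Set.disjoint_left.1 hFJ ⟨x, hxI, inf_le_left⟩ hx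
    · exact Set.disjoint_left.1 hFJ ⟨⊤, top_notMem I, inf_le_right⟩
  · rintro ⟨J, hJI, ha, hb⟩
    exact hJI (((inf_mem_iff J).1 (J.1.lower inf_himp_le hb)).resolve_left ha)

theorem le_of_forall_primeIdeal {a b : A} (h : ∀ I : PrimeIdeal A, b ∈ I.1 → a ∈ I.1) :
    a ≤ b := by
  by_contra hab
  have hdisj : Disjoint (PFilter.principal a : Set A) (Ideal.principal b : Set A) :=
    Set.disjoint_left.2 fun x hax hxb => hab (le_trans (α := A) hax hxb)
  obtain ⟨J, hJ, hbJ, hFJ⟩ := DistribLattice.prime_ideal_of_disjoint_filter_ideal hdisj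
  exact Set.disjoint_left.1 hFJ (PFilter.mem_principal.2 le_rfl)
    (h ⟨J, hJ⟩ (hbJ Ideal.mem_principal_self))

theorem invariant_top (S : Set A) : Invariant S ⊤ :=
  fun _ I _ _ _ _ h => (top_notMem I h).elim

theorem Invariant.himp {S : Set A} {a b : A} (ha : Invariant S a) (hb : Invariant S b) :
    Invariant S (a ⇨ b) := by
  intro k I J hI hJ h hab
  obtain ⟨I', hI', haI, hbI⟩ := (himp_mem_iff I).1 hab
  refine (himp_mem_iff J).2 ?_
  obtain rfl | hlt := hI'.eq_or_lt
  · exact ⟨J, le_rfl, fun haJ => haI (ha k J _ hJ hI h.symm haJ), hb k _ J hI hJ h hbI⟩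
  · cases k with
    | zero => exact hI.elim
    | succ k =>
      have h₂ : bisimType S k '' Set.Iio I = bisimType S k '' Set.Iio J := congrArg Prod.snd h
      obtain ⟨J', hJ', hIJ⟩ := h₂ ▸ Set.mem_image_of_mem (bisimType S k) hlt
      exact ⟨J', hJ'.le, fun haJ => haI (ha k J' I' (hJ J' hJ') (hI I' hlt) hIJ haJ),
        hb k I' J' (hI I' hlt) (hJ J' hJ') hIJ.symm hbI⟩

theorem hTerm_congr {n : ℕ} {a b : ℕ → A} (h : ∀ i ≤ n, a i = b i) : hTerm n a = hTerm n b := by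
  induction n with
  | zero => exact h 0 le_rfl
  | succ n ih => simp only [hTerm, h (n + 1) le_rfl, ih fun i hi => h i (hi.trans n.le_succ)]

theorem exists_hTerm_mem_of_not_heightLT {k : ℕ} {I : PrimeIdeal A} (hI : ¬ HeightLT k I) :
    ∃ a : ℕ → A, hTerm k a ∈ I.1 := by
  induction k generalizing I with
  | zero =>
    obtain ⟨x, hx⟩ := I.1.nonempty
    exact ⟨fun _ => x, hx⟩
  | succ k ih =>
    obtain ⟨J, hJI, hJ⟩ : ∃ J < I, ¬ HeightLT k J := by simpa [HeightLT] using hI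
    obtain ⟨a, ha⟩ := ih hJ
    obtain ⟨x, hxI, hxJ⟩ := Set.exists_of_ssubset (show (J.1 : Set A) ⊂ I.1 from hJI)
    refine ⟨Function.update a (k + 1) x, ?_⟩
    have hcongr : hTerm k (Function.update a (k + 1) x) = hTerm k a :=
      hTerm_congr fun i hi => Function.update_of_ne (by omega) _ _
    rw [hTerm, hcongr, Function.update_self]
    exact Ideal.sup_mem hxI ((himp_mem_iff I).2 ⟨J, hJI.le, hxJ, ha⟩)

theorem heightLT_of_hTerm_eq_top {n : ℕ} (h : ∀ a : ℕ → A, hTerm n a = ⊤) (I : PrimeIdeal A) :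
    HeightLT n I := by
  by_contra hI
  obtain ⟨a, ha⟩ := exists_hTerm_mem_of_not_heightLT hI
  exact top_notMem I (h a ▸ ha)

end BrouwerianDepth

theorem brouwerian_bounded_depth_locally_finite (n : ℕ)
    {A : Type u} [GeneralizedHeytingAlgebra A]
    (hdepth : ∀ a : ℕ → A, hTerm n a = ⊤)
    (S : Set A) (hSfin : S.Finite)
    (hgen : ∀ T : Set A, S ⊆ T → (⊤ : A) ∈ T →
      (∀ x ∈ T, ∀ y ∈ T, x ⊓ y ∈ T) → (∀ x ∈ T, ∀ y ∈ T, x ⊔ y ∈ T) →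
      (∀ x ∈ T, ∀ y ∈ T, x ⇨ y ∈ T) → T = Set.univ) :
    Finite A := by
  have hinv : {a : A | BrouwerianDepth.Invariant S a} = Set.univ :=
    hgen _ (fun _ => BrouwerianDepth.invariant_of_mem) (BrouwerianDepth.invariant_top S)
      (fun _ hx _ hy => hx.inf hy) (fun _ hx _ hy => hx.sup hy) (fun _ hx _ hy => hx.himp hy)
  have hheight := BrouwerianDepth.heightLT_of_hTerm_eq_top hdepth
  have := BrouwerianDepth.finite_bisimType hSfin n
  let f : A → Set (BrouwerianDepth.BisimType S n) := fun a =>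
    BrouwerianDepth.bisimType S n '' {I | a ∈ I.1}
  have hle : ∀ a b : A, f a = f b → a ≤ b := by
    refine fun a b hab => BrouwerianDepth.le_of_forall_primeIdeal fun I hb => ?_
    obtain ⟨J, hJ, hJI⟩ : BrouwerianDepth.bisimType S n I ∈ f a := hab ▸ ⟨I, hb, rfl⟩
    exact Set.eq_univ_iff_forall.1 hinv a n J I (hheight J) (hheight I) hJI hJ
  exact Finite.of_injective f fun a b h => (hle a b h).antisymm (hle b a h.symm)
end

section
/- Epimorphism-surjectivity for varieties of Heyting algebras of finite depth: let n ∈ ℕ and let K be a variety of Heyting algebras every member of which satisfies the identity hₙ ≈ ⊤. Then every K-epimorphism h : A → B with A, B ∈ K is surjective. -/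
/-!
STATEMENT 10: Epimorphism-surjectivity for varieties of Heyting algebras of
finite depth: if every member of a variety `K` of Heyting algebras satisfies the
identity `hₙ ≈ ⊤`, then every `K`-epimorphism between members of `K` is surjective.
-/

universe u

namespace Order.PFilter

section HeytingQuotient

variable {α : Type*} [HeytingAlgebra α] (F : PFilter α)

variable {F} in
theorem himp_mem_of_le {a b : α} (h : a ≤ b) : a ⇨ b ∈ F := by
  rw [himp_eq_top_iff.2 h]
  exact top_mem

variable {F} in
theorem himp_mem_trans {a b c : α} (hab : a ⇨ b ∈ F) (hbc : b ⇨ c ∈ F) : a ⇨ c ∈ F :=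
  mem_of_le (himp_triangle a b c) (inf_mem hab hbc)

variable {F} in
theorem himp_mem_inf {a b c d : α} (hab : a ⇨ b ∈ F) (hcd : c ⇨ d ∈ F) :
    a ⊓ c ⇨ b ⊓ d ∈ F := by
  rw [himp_inf_distrib]
  exact inf_mem (himp_mem_trans (himp_mem_of_le inf_le_left) hab)
    (himp_mem_trans (himp_mem_of_le inf_le_right) hcd)

variable {F} in
theorem himp_mem_sup {a b c d : α} (hab : a ⇨ b ∈ F) (hcd : c ⇨ d ∈ F) :
    a ⊔ c ⇨ b ⊔ d ∈ F := by
  rw [sup_himp_distrib]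
  exact inf_mem (himp_mem_trans hab (himp_mem_of_le le_sup_left))
    (himp_mem_trans hcd (himp_mem_of_le le_sup_right))

variable {F} in
theorem himp_mem_himp {a b c d : α} (hba : b ⇨ a ∈ F) (hcd : c ⇨ d ∈ F) :
    (a ⇨ c) ⇨ (b ⇨ d) ∈ F := by
  rw [himp_himp]
  exact himp_mem_trans (himp_mem_inf (himp_mem_of_le le_rfl) hba)
    (himp_mem_trans (himp_mem_of_le himp_inf_le) hcd)

/-- The congruence of a Heyting algebra determined by a filter. -/
def heytingSetoid : Setoid α where
  r a b := a ⇨ b ∈ F ∧ b ⇨ a ∈ F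
  iseqv :=
    { refl := fun _ => ⟨himp_mem_of_le le_rfl, himp_mem_of_le le_rfl⟩
      symm := And.symm
      trans := fun h₁ h₂ => ⟨himp_mem_trans h₁.1 h₂.1, himp_mem_trans h₂.2 h₁.2⟩ }

/-- The quotient of a Heyting algebra by a filter. -/
def HeytingQuotient : Type _ := Quotient F.heytingSetoid

instance : HeytingAlgebra F.HeytingQuotient where
  le := Quotient.lift₂ (fun a b => a ⇨ b ∈ F) fun _ _ _ _ h₁ h₂ => propext
    ⟨fun h => himp_mem_trans h₁.2 (himp_mem_trans h h₂.1),
      fun h => himp_mem_trans h₁.1 (himp_mem_trans h h₂.2)⟩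
  sup := Quotient.map₂ (· ⊔ ·) fun _ _ h₁ _ _ h₂ =>
    ⟨himp_mem_sup h₁.1 h₂.1, himp_mem_sup h₁.2 h₂.2⟩
  inf := Quotient.map₂ (· ⊓ ·) fun _ _ h₁ _ _ h₂ =>
    ⟨himp_mem_inf h₁.1 h₂.1, himp_mem_inf h₁.2 h₂.2⟩
  himp := Quotient.map₂ (· ⇨ ·) fun _ _ h₁ _ _ h₂ =>
    ⟨himp_mem_himp h₁.2 h₂.1, himp_mem_himp h₁.1 h₂.2⟩
  compl := Quotient.map (· ⇨ ⊥) fun _ _ h =>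
    ⟨himp_mem_himp h.2 (himp_mem_of_le le_rfl), himp_mem_himp h.1 (himp_mem_of_le le_rfl)⟩
  top := Quotient.mk _ ⊤
  bot := Quotient.mk _ ⊥
  le_refl := by rintro ⟨a⟩; exact himp_mem_of_le le_rfl
  le_trans := by rintro ⟨a⟩ ⟨b⟩ ⟨c⟩; exact himp_mem_trans
  le_antisymm := by rintro ⟨a⟩ ⟨b⟩ h₁ h₂; exact Quotient.sound ⟨h₁, h₂⟩
  le_sup_left := by rintro ⟨a⟩ ⟨b⟩; exact himp_mem_of_le le_sup_left
  le_sup_right := by rintro ⟨a⟩ ⟨b⟩; exact himp_mem_of_le le_sup_right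
  sup_le := by
    rintro ⟨a⟩ ⟨b⟩ ⟨c⟩ h₁ h₂
    change a ⊔ b ⇨ c ∈ F
    rw [sup_himp_distrib]
    exact inf_mem h₁ h₂
  inf_le_left := by rintro ⟨a⟩ ⟨b⟩; exact himp_mem_of_le inf_le_left
  inf_le_right := by rintro ⟨a⟩ ⟨b⟩; exact himp_mem_of_le inf_le_right
  le_inf := by
    rintro ⟨a⟩ ⟨b⟩ ⟨c⟩ h₁ h₂
    change a ⇨ b ⊓ c ∈ F
    rw [himp_inf_distrib]
    exact inf_mem h₁ h₂
  le_top := by rintro ⟨a⟩; exact himp_mem_of_le le_top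
  bot_le := by rintro ⟨a⟩; exact himp_mem_of_le bot_le
  le_himp_iff := by
    rintro ⟨a⟩ ⟨b⟩ ⟨c⟩
    change a ⇨ b ⇨ c ∈ F ↔ a ⊓ b ⇨ c ∈ F
    rw [himp_himp]
  himp_bot := by rintro ⟨a⟩; rfl

/-- The quotient map of a Heyting algebra onto its quotient by a filter. -/
def quotientHom : HeytingHom α F.HeytingQuotient where
  toFun := Quotient.mk _
  map_sup' _ _ := rfl
  map_inf' _ _ := rfl
  map_bot' := rfl
  map_himp' _ _ := rfl

theorem quotientHom_surjective : Function.Surjective F.quotientHom :=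
  Quotient.mk_surjective

theorem quotientHom_eq_iff {a b : α} :
    F.quotientHom a = F.quotientHom b ↔ a ⇨ b ∈ F ∧ b ⇨ a ∈ F :=
  Quotient.eq (r := F.heytingSetoid)

theorem quotientHom_eq_top_iff {a : α} : F.quotientHom a = ⊤ ↔ a ∈ F := by
  rw [← map_top F.quotientHom, quotientHom_eq_iff]
  simp

end HeytingQuotient

theorem IsPrime.mem_or_mem {α : Type*} [Lattice α] {F : PFilter α} (hF : F.IsPrime) {a b : α}
    (h : a ⊔ b ∈ F) : a ∈ F ∨ b ∈ F := by
  by_contra! hab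
  exact Ideal.sup_mem (s := hF.compl_ideal.toIdeal) hab.1 hab.2 h

theorem exists_isPrime_of_disjoint {α : Type*} [DistribLattice α] {F : PFilter α} {I : Ideal α}
    (hFI : Disjoint (F : Set α) I) :
    ∃ G : PFilter α, G.IsPrime ∧ F ≤ G ∧ Disjoint (G : Set α) I := by
  obtain ⟨J, hJ, hIJ, hFJ⟩ := DistribLattice.prime_ideal_of_disjoint_filter_ideal hFI
  refine ⟨hJ.toPrimePair.F, hJ.toPrimePair.F_isPrime, ?_, ?_⟩
  · exact fun a ha haJ => Set.disjoint_left.1 hFJ ha haJ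
  · exact Set.disjoint_left.2 fun a ha haI => ha (hIJ haI)

/-- If an element is not congruent modulo `G` to any element of the range of `h`, then two distinct
prime filters containing `G` have the same preimage under `h`. -/
theorem exists_isPrime_ne_of_forall_quotientHom_ne {A B : Type*} [HeytingAlgebra A]
    [HeytingAlgebra B] (h : HeytingHom A B) (G : PFilter B) {b : B}
    (hb : ∀ a, G.quotientHom (h a) ≠ G.quotientHom b) :
    ∃ F₁ F₂ : PFilter B, F₁.IsPrime ∧ F₂.IsPrime ∧ G ≤ F₁ ∧ G ≤ F₂ ∧ F₁ ≠ F₂ ∧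
      ∀ a, h a ∈ F₁ ↔ h a ∈ F₂ := by
  let P : PFilter B := IsPFilter.toPFilter (F := {c | ∃ a, b ⇨ h a ∈ G ∧ h a ⇨ c ∈ G}) <| by
    refine .of_def ⟨⊤, ⊤, by simp⟩ ?_ ?_
    · rintro c ⟨a, hba, hac⟩ c' ⟨a', hba', hac'⟩
      refine ⟨c ⊓ c', ⟨a ⊓ a', ?_, ?_⟩, inf_le_left, inf_le_right⟩
      · rw [map_inf, himp_inf_distrib]
        exact inf_mem hba hba'
      · rw [map_inf]
        exact himp_mem_inf hac hac'
    · rintro c c' hc ⟨a, hba, hac⟩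
      exact ⟨a, hba, himp_mem_trans hac (himp_mem_of_le hc)⟩
  have hP : Disjoint (P : Set B) (Ideal.principal b) := by
    refine Set.disjoint_left.2 ?_
    rintro c ⟨a, hba, hac⟩ hcb
    exact hb a (G.quotientHom_eq_iff.2 ⟨himp_mem_trans hac (himp_mem_of_le hcb), hba⟩)
  obtain ⟨F₁, hF₁, hPF₁, hbF₁⟩ := exists_isPrime_of_disjoint hP
  have hb₁ : b ∉ F₁ := fun hbF => Set.disjoint_left.1 hbF₁ hbF Ideal.mem_principal_self
  have hG₁ : G ≤ F₁ := fun c hc =>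
    hPF₁ ⟨⊤, by simp, by simpa using hc⟩
  have hha₁ : ∀ a, b ⇨ h a ∈ G → h a ∈ F₁ := fun a ha =>
    hPF₁ ⟨a, ha, himp_mem_of_le le_rfl⟩
  let Q : PFilter B := IsPFilter.toPFilter (F := {c | ∃ a, h a ∈ F₁ ∧ h a ⊓ b ⇨ c ∈ G}) <| by
    refine .of_def ⟨⊤, ⊤, by simp⟩ ?_ ?_
    · rintro c ⟨a, ha, hac⟩ c' ⟨a', ha', hac'⟩
      refine ⟨c ⊓ c', ⟨a ⊓ a', ?_, ?_⟩, inf_le_left, inf_le_right⟩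
      · rw [map_inf]
        exact inf_mem ha ha'
      · rw [map_inf, inf_inf_distrib_right]
        exact himp_mem_inf hac hac'
    · rintro c c' hc ⟨a, ha, hac⟩
      exact ⟨a, ha, himp_mem_trans hac (himp_mem_of_le hc)⟩
  let J : Ideal B := IsIdeal.toIdeal (I := {c | ∃ a, h a ∉ F₁ ∧ c ≤ h a}) <| by
    refine ⟨?_, ⟨⊥, ⊥, ?_, by simp⟩, ?_⟩
    · rintro c c' hc ⟨a, ha, hca⟩
      exact ⟨a, ha, hc.trans hca⟩
    · rw [map_bot]
      exact fun hbot => hb₁ (mem_of_le bot_le hbot)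
    · rintro c ⟨a, ha, hca⟩ c' ⟨a', ha', hca'⟩
      refine ⟨c ⊔ c', ⟨a ⊔ a', ?_, ?_⟩, le_sup_left, le_sup_right⟩
      · rw [map_sup]
        exact fun hsup => (hF₁.mem_or_mem hsup).elim ha ha'
      · rw [map_sup]
        exact sup_le_sup hca hca'
  have hQJ : Disjoint (Q : Set B) J := by
    refine Set.disjoint_left.2 ?_
    rintro c ⟨a, ha, hac⟩ ⟨a', ha', hca'⟩
    have hmem : b ⇨ h (a ⇨ a') ∈ G := by
      rw [map_himp, himp_himp, inf_comm]
      exact himp_mem_trans hac (himp_mem_of_le hca')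
    have := hha₁ _ hmem
    rw [map_himp] at this
    exact ha' (mem_of_le inf_himp_le (inf_mem ha this))
  obtain ⟨F₂, hF₂, hQF₂, hJF₂⟩ := exists_isPrime_of_disjoint hQJ
  refine ⟨F₁, F₂, hF₁, hF₂, hG₁, fun c hc => hQF₂ ⟨⊤, by simp, ?_⟩, ?_, fun a => ⟨?_, ?_⟩⟩
  · exact mem_of_le le_himp hc
  · rintro rfl
    exact hb₁ (hQF₂ ⟨⊤, by simp, by simp⟩)
  · exact fun ha => hQF₂ ⟨a, ha, himp_mem_of_le inf_le_left⟩
  · intro ha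
    by_contra ha₁
    exact Set.disjoint_left.1 hJF₂ ha ⟨a, ha₁, le_rfl⟩

/-- The prime filters of a Heyting algebra satisfying `hₙ ≈ ⊤` satisfy the ascending chain
condition. -/
theorem wellFoundedGT_isPrime_of_hTerm_eq_top {α : Type*} [HeytingAlgebra α] {n : ℕ}
    (hn : ∀ a : ℕ → α, hTerm n a = ⊤) : WellFoundedGT {F : PFilter α // F.IsPrime} := by
  have hmem : ∀ (a : ℕ → α) (f : ℕ → {F : PFilter α // F.IsPrime}) (i : ℕ), a 0 ∉ (f 0).1 →
      (∀ j < i, f (j + 1) ≤ f j ∧ a (j + 1) ∈ (f j).1 ∧ a (j + 1) ∉ (f (j + 1)).1) →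
      hTerm i a ∉ (f i).1 := by
    intro a f i h0 hf
    induction i with
    | zero => exact h0
    | succ i ih =>
      obtain ⟨hle, hmem, hnotMem⟩ := hf i i.lt_succ_self
      intro hsup
      have himp := hle (((f (i + 1)).2.mem_or_mem hsup).resolve_left hnotMem)
      exact ih (fun j hj => hf j (hj.trans i.lt_succ_self))
        (mem_of_le inf_himp_le (inf_mem hmem himp))
  rw [WellFoundedGT, isWellFounded_iff, RelEmbedding.wellFounded_iff_isEmpty]
  refine ⟨fun f => ?_⟩
  have hlt : ∀ i, f i < f (i + 1) := fun i => f.map_rel_iff.2 i.lt_succ_self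
  have hex : ∀ i, ∃ c ∈ (f (i + 1)).1, c ∉ (f i).1 := fun i =>
    SetLike.exists_of_lt (Subtype.coe_lt_coe.2 (hlt i))
  choose c hc hc' using hex
  refine hmem (fun i => c (n - i)) (fun i => f (n - i)) n (hc' n) (fun j hj => ?_) ?_
  · have hnj : n - j = n - (j + 1) + 1 := by omega
    exact ⟨hnj ▸ (hlt _).le, hnj ▸ hc _, hc' _⟩
  · rw [hn]
    exact top_mem

end Order.PFilter

/-- A Heyting homomorphism factors through any surjective one with a smaller kernel. -/
theorem HeytingHom.exists_comp_eq_of_surjective {A C D : Type*} [HeytingAlgebra A]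
    [HeytingAlgebra C] [HeytingAlgebra D] (s : HeytingHom A D) (hs : Function.Surjective s)
    (p : HeytingHom A C) (hsp : ∀ a a', s a = s a' → p a = p a') :
    ∃ g : HeytingHom D C, g.comp s = p := by
  choose r hr using hs
  refine ⟨
    { toFun := fun d => p (r d)
      map_sup' := fun d e => ?_
      map_inf' := fun d e => ?_
      map_bot' := ?_
      map_himp' := fun d e => ?_ }, ?_⟩
  · rw [← map_sup]
    exact hsp _ _ (by simp [hr])
  · rw [← map_inf]
    exact hsp _ _ (by simp [hr])
  · rw [← map_bot p]
    exact hsp _ _ (by simp [hr])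
  · rw [← map_himp]
    exact hsp _ _ (by simp [hr])
  · ext a
    exact hsp _ _ (hr _)

/-- Two prime filters with the same preimage under `h`, such that `h` is surjective modulo the
first and the second does not contain the first, provide a test algebra in which `h` fails to be
an epimorphism. -/
theorem Order.PFilter.exists_heytingHom_ne {A B : Type*} [HeytingAlgebra A] [HeytingAlgebra B]
    (h : HeytingHom A B) {F G : PFilter B} (hFG : ∀ a, h a ∈ G ↔ h a ∈ F) (hle : ¬ G ≤ F)
    (hsurj : Function.Surjective (G.quotientHom.comp h)) :
    ∃ g₁ g₂ : HeytingHom B F.HeytingQuotient, g₁.comp h = g₂.comp h ∧ g₁ ≠ g₂ := by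
  obtain ⟨g, hg⟩ := (G.quotientHom.comp h).exists_comp_eq_of_surjective hsurj
    (F.quotientHom.comp h) fun a a' haa' => by
      rw [HeytingHom.comp_apply, HeytingHom.comp_apply, quotientHom_eq_iff, ← map_himp,
        ← map_himp, hFG, hFG] at haa'
      rw [HeytingHom.comp_apply, HeytingHom.comp_apply, quotientHom_eq_iff, ← map_himp,
        ← map_himp]
      exact haa'
  refine ⟨F.quotientHom, g.comp G.quotientHom, by rw [HeytingHom.comp_assoc, hg],
    fun heq => hle fun b hb => ?_⟩
  rw [← F.quotientHom_eq_top_iff, heq, HeytingHom.comp_apply, G.quotientHom_eq_top_iff.2 hb,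
    map_top]

theorem es_heyting_variety_of_finite_depth (n : ℕ)
    (K : (A : Type u) → [inst : HeytingAlgebra A] → Prop)
    -- closure under homomorphic images
    (hH : ∀ (A : Type u) [HeytingAlgebra A] (B : Type u) [HeytingAlgebra B],
      K A → (∃ f : HeytingHom A B, Function.Surjective f) → K B)
    -- closure under subalgebras
    (hS : ∀ (A : Type u) [HeytingAlgebra A] (B : Type u) [HeytingAlgebra B],
      K A → (∃ f : HeytingHom B A, Function.Injective f) → K B)
    -- closure under products
    (hP : ∀ (I : Type u) (A : I → Type u) [∀ i, HeytingAlgebra (A i)],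
      (∀ i, K (A i)) → K (∀ i, A i))
    -- every member of `K` satisfies `hₙ ≈ ⊤`
    (hdepth : ∀ (A : Type u) [HeytingAlgebra A], K A → ∀ a : ℕ → A, hTerm n a = ⊤)
    {A B : Type u} [HeytingAlgebra A] [HeytingAlgebra B]
    (hA : K A) (hB : K B) (h : HeytingHom A B)
    -- `h` is a `K`-epimorphism
    (hepi : ∀ (C : Type u) [HeytingAlgebra C], K C →
      ∀ g₁ g₂ : HeytingHom B C, g₁.comp h = g₂.comp h → g₁ = g₂) :
    Function.Surjective h := by
  by_contra hns
  have hwf := Order.PFilter.wellFoundedGT_isPrime_of_hTerm_eq_top (hdepth B hB)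
  let bad : Set {F : Order.PFilter B // F.IsPrime} :=
    {G | ∃ F : {F : Order.PFilter B // F.IsPrime}, F ≠ G ∧ ∀ a, h a ∈ G.1 ↔ h a ∈ F.1}
  have hbad : ∀ (G : Order.PFilter B) (b : B),
      (∀ a, G.quotientHom (h a) ≠ G.quotientHom b) →
        ∃ F₁ ∈ bad, ∃ F₂ ∈ bad, G ≤ F₁.1 ∧ G ≤ F₂.1 ∧ F₁ ≠ F₂ := by
    intro G b hb
    obtain ⟨F₁, F₂, hF₁, hF₂, h₁, h₂, hne, htr⟩ :=
      Order.PFilter.exists_isPrime_ne_of_forall_quotientHom_ne h G hb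
    have hne' : (⟨F₁, hF₁⟩ : {F : Order.PFilter B // F.IsPrime}) ≠ ⟨F₂, hF₂⟩ :=
      fun heq => hne (congrArg Subtype.val heq)
    exact ⟨⟨F₁, hF₁⟩, ⟨⟨F₂, hF₂⟩, hne'.symm, htr⟩, ⟨F₂, hF₂⟩,
      ⟨⟨F₁, hF₁⟩, hne', fun a => (htr a).symm⟩, h₁, h₂, hne'⟩
  have hbad_nonempty : bad.Nonempty := by
    simp only [Function.Surjective, not_forall, not_exists] at hns
    obtain ⟨b, hb⟩ := hns
    obtain ⟨F, hF, -⟩ := hbad ⊥ b fun a heq => hb a <| by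
      obtain ⟨h₁, h₂⟩ := Order.PFilter.quotientHom_eq_iff _ |>.1 heq
      exact le_antisymm (himp_eq_top_iff.1 (top_le_iff.1 h₁))
        (himp_eq_top_iff.1 (top_le_iff.1 h₂))
    exact ⟨F, hF⟩
  obtain ⟨G, hG⟩ := exists_maximal_of_wellFoundedGT (· ∈ bad) hbad_nonempty
  have hsurj : Function.Surjective (G.1.quotientHom.comp h) := by
    intro d
    obtain ⟨b, rfl⟩ := G.1.quotientHom_surjective d
    by_contra! hb
    obtain ⟨F₁, hF₁, F₂, hF₂, h₁, h₂, hne⟩ := hbad G.1 b hb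
    exact hne ((hG.eq_of_le hF₁ h₁).symm.trans (hG.eq_of_le hF₂ h₂))
  obtain ⟨F, hne, htr⟩ := hG.prop
  have hle : ¬ G.1 ≤ F.1 := fun hle =>
    hne (hG.eq_of_le ⟨G, hne.symm, fun a => (htr a).symm⟩ hle).symm
  obtain ⟨g₁, g₂, hcomp, hg⟩ := Order.PFilter.exists_heytingHom_ne h htr hle hsurj
  exact hg (hepi _ (hH B _ hB ⟨F.1.quotientHom, F.1.quotientHom_surjective⟩) g₁ g₂ hcomp)
end

section
/- Epimorphism-surjectivity for varieties of Brouwerian algebras of finite depth: let n ∈ ℕ and let K be a variety of Brouwerian algebras every member of which satisfies the identity hₙ ≈ ⊤. Then every K-epimorphism h : A → B with A, B ∈ K is surjective. -/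
/-!
STATEMENT 11: Epimorphism-surjectivity for varieties of Brouwerian algebras of
finite depth: if every member of a variety `K` of Brouwerian algebras satisfies
the identity `hₙ ≈ ⊤`, then every `K`-epimorphism between members of `K` is
surjective.
-/

universe u

/-- A lattice filter, possibly improper, given by its carrier. -/
structure IsBrouwerianFilter {α : Type*} [GeneralizedHeytingAlgebra α] (F : Set α) : Prop where
  top_mem : ⊤ ∈ F
  inf_mem : ∀ {a b}, a ∈ F → b ∈ F → a ⊓ b ∈ F
  mem_of_le : ∀ {a b}, a ≤ b → a ∈ F → b ∈ F

/-- A prime filter; the improper filter counts as prime. -/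
structure IsPrimeBrouwerianFilter {α : Type*} [GeneralizedHeytingAlgebra α] (F : Set α) : Prop
    extends IsBrouwerianFilter F where
  mem_or_mem : ∀ {a b}, a ⊔ b ∈ F → a ∈ F ∨ b ∈ F

namespace IsBrouwerianFilter

variable {α : Type*} [GeneralizedHeytingAlgebra α] {F : Set α}

theorem mp (hF : IsBrouwerianFilter F) {a b : α} (hab : a ⇨ b ∈ F) (ha : a ∈ F) : b ∈ F :=
  hF.mem_of_le himp_inf_le (hF.inf_mem hab ha)

theorem himp_mem_of_le (hF : IsBrouwerianFilter F) {a b : α} (hab : a ≤ b) : a ⇨ b ∈ F := by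
  rw [himp_eq_top_iff.2 hab]
  exact hF.top_mem

theorem himp_trans (hF : IsBrouwerianFilter F) {a b c : α} (hab : a ⇨ b ∈ F)
    (hbc : b ⇨ c ∈ F) : a ⇨ c ∈ F :=
  hF.mem_of_le (himp_triangle a b c) (hF.inf_mem hab hbc)

theorem himp_inf_mem (hF : IsBrouwerianFilter F) {a b c : α} (hab : a ⇨ b ∈ F)
    (hac : a ⇨ c ∈ F) : a ⇨ b ⊓ c ∈ F := by
  rw [himp_inf_distrib]
  exact hF.inf_mem hab hac

theorem sup_himp_mem (hF : IsBrouwerianFilter F) {a b c : α} (hac : a ⇨ c ∈ F)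
    (hbc : b ⇨ c ∈ F) : a ⊔ b ⇨ c ∈ F := by
  rw [sup_himp_distrib]
  exact hF.inf_mem hac hbc

/-- The filter generated by a filter and a subset that is closed under meets. -/
theorem sup_of_inf_closed (hF : IsBrouwerianFilter F) {T : Set α} (hT : T.Nonempty)
    (hinf : ∀ a ∈ T, ∀ b ∈ T, a ⊓ b ∈ T) :
    IsBrouwerianFilter {c | ∃ p ∈ F, ∃ t ∈ T, p ⊓ t ≤ c} where
  top_mem := hT.elim fun t ht => ⟨⊤, hF.top_mem, t, ht, le_top⟩
  inf_mem := by
    rintro a b ⟨p, hp, t, ht, h⟩ ⟨p', hp', t', ht', h'⟩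
    refine ⟨p ⊓ p', hF.inf_mem hp hp', t ⊓ t', hinf t ht t' ht', ?_⟩
    rw [inf_inf_inf_comm]
    exact inf_le_inf h h'
  mem_of_le := by
    rintro a b hab ⟨p, hp, t, ht, h⟩
    exact ⟨p, hp, t, ht, h.trans hab⟩

/-- Prime filter separation. -/
theorem exists_prime_disjoint (hF : IsBrouwerianFilter F) {I : Set α}
    (hI : ∀ a ∈ I, ∀ b ∈ I, a ⊔ b ∈ I) (hd : ∀ a ∈ F, a ∉ I) :
    ∃ P : Set α, IsPrimeBrouwerianFilter P ∧ F ⊆ P ∧ ∀ a ∈ P, a ∉ I := by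
  obtain ⟨P, hFP, hP⟩ := zorn_subset_nonempty
    {G : Set α | IsBrouwerianFilter G ∧ ∀ a ∈ G, a ∉ I} (by
      rintro c hc hchain ⟨G₀, hG₀⟩
      refine ⟨⋃₀ c, ⟨⟨⟨G₀, hG₀, (hc hG₀).1.top_mem⟩, ?_, ?_⟩, ?_⟩,
        fun G hG => Set.subset_sUnion_of_mem hG⟩
      · rintro a b ⟨G, hG, ha⟩ ⟨G', hG', hb⟩
        rcases hchain.total hG hG' with h | h
        · exact ⟨G', hG', (hc hG').1.inf_mem (h ha) hb⟩
        · exact ⟨G, hG, (hc hG).1.inf_mem ha (h hb)⟩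
      · rintro a b hab ⟨G, hG, ha⟩
        exact ⟨G, hG, (hc hG).1.mem_of_le hab ha⟩
      · rintro a ⟨G, hG, ha⟩
        exact (hc hG).2 a ha) F ⟨hF, hd⟩
  have key : ∀ a, a ∉ P → ∃ p ∈ P, ∃ i ∈ I, p ⊓ a ≤ i := by
    intro a ha
    by_contra! hcon
    have hG := hP.prop.1.sup_of_inf_closed (Set.singleton_nonempty a) (by simp)
    have hle := hP.le_of_ge ⟨hG, by
      rintro c ⟨p, hp, t, rfl, hpt⟩ hc
      exact hcon p hp c hc hpt⟩ fun p hp => ⟨p, hp, a, rfl, inf_le_left⟩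
    exact ha (hle ⟨⊤, hP.prop.1.top_mem, a, rfl, inf_le_right⟩)
  refine ⟨P, ⟨hP.prop.1, ?_⟩, hFP, hP.prop.2⟩
  intro a b hab
  by_contra! hcon
  obtain ⟨p, hp, i, hi, hpi⟩ := key a hcon.1
  obtain ⟨q, hq, j, hj, hqj⟩ := key b hcon.2
  refine hP.prop.2 (i ⊔ j) (hP.prop.1.mem_of_le ?_
    (hP.prop.1.inf_mem (hP.prop.1.inf_mem hp hq) hab)) (hI i hi j hj)
  rw [inf_sup_left]
  exact sup_le_sup ((inf_le_inf_right a inf_le_left).trans hpi)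
    ((inf_le_inf_right b inf_le_right).trans hqj)

theorem exists_prime_of_himp_notMem (hF : IsBrouwerianFilter F) {b c : α} (h : b ⇨ c ∉ F) :
    ∃ P : Set α, IsPrimeBrouwerianFilter P ∧ F ⊆ P ∧ b ∈ P ∧ c ∉ P := by
  obtain ⟨P, hP, hle, hd⟩ :=
    (hF.sup_of_inf_closed (Set.singleton_nonempty b) (by simp)).exists_prime_disjoint
      (I := {c}) (by simp) (by
        rintro a ⟨p, hp, t, rfl, hpt⟩ rfl
        exact h (hF.mem_of_le (le_himp_iff.2 hpt) hp))
  exact ⟨P, hP, fun p hp => hle ⟨p, hp, b, rfl, inf_le_left⟩,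
    hle ⟨⊤, hF.top_mem, b, rfl, inf_le_right⟩, fun hc => hd c hc rfl⟩

/-- The congruence induced by a filter. -/
def setoid (hF : IsBrouwerianFilter F) : Setoid α where
  r a b := a ⇨ b ∈ F ∧ b ⇨ a ∈ F
  iseqv :=
    { refl := fun _ => ⟨hF.himp_mem_of_le le_rfl, hF.himp_mem_of_le le_rfl⟩
      symm := fun h => ⟨h.2, h.1⟩
      trans := fun h h' => ⟨hF.himp_trans h.1 h'.1, hF.himp_trans h'.2 h.2⟩ }

theorem inf_himp_inf_mem (hF : IsBrouwerianFilter F) {a a' b b' : α} (ha : a ⇨ a' ∈ F)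
    (hb : b ⇨ b' ∈ F) : a ⊓ b ⇨ a' ⊓ b' ∈ F :=
  hF.himp_inf_mem (hF.himp_trans (hF.himp_mem_of_le inf_le_left) ha)
    (hF.himp_trans (hF.himp_mem_of_le inf_le_right) hb)

theorem sup_himp_sup_mem (hF : IsBrouwerianFilter F) {a a' b b' : α} (ha : a ⇨ a' ∈ F)
    (hb : b ⇨ b' ∈ F) : a ⊔ b ⇨ a' ⊔ b' ∈ F :=
  hF.sup_himp_mem (hF.himp_trans ha (hF.himp_mem_of_le le_sup_left))
    (hF.himp_trans hb (hF.himp_mem_of_le le_sup_right))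

theorem himp_himp_himp_mem (hF : IsBrouwerianFilter F) {a a' b b' : α} (ha : a' ⇨ a ∈ F)
    (hb : b ⇨ b' ∈ F) : (a ⇨ b) ⇨ (a' ⇨ b') ∈ F := by
  rw [himp_himp]
  refine hF.himp_trans (b := b) ?_ hb
  refine hF.himp_trans (hF.inf_himp_inf_mem (hF.himp_mem_of_le le_rfl) ha) ?_
  exact hF.himp_mem_of_le himp_inf_le

/-- The quotient of a Brouwerian algebra by a filter. -/
def FilterQuotient (hF : IsBrouwerianFilter F) : Type _ := Quotient hF.setoid

instance (hF : IsBrouwerianFilter F) : GeneralizedHeytingAlgebra hF.FilterQuotient where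
  le := Quotient.lift₂ (fun a b => a ⇨ b ∈ F) fun _ _ _ _ h h' =>
    propext ⟨fun k => hF.himp_trans h.2 (hF.himp_trans k h'.1),
      fun k => hF.himp_trans h.1 (hF.himp_trans k h'.2)⟩
  le_refl := Quotient.ind fun _ => hF.himp_mem_of_le le_rfl
  le_trans := by
    rintro ⟨a⟩ ⟨b⟩ ⟨c⟩ h h'
    exact hF.himp_trans h h'
  le_antisymm := by
    rintro ⟨a⟩ ⟨b⟩ h h'
    exact Quotient.sound ⟨h, h'⟩
  sup := Quotient.map₂ (· ⊔ ·) fun _ _ h _ _ h' =>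
    ⟨hF.sup_himp_sup_mem h.1 h'.1, hF.sup_himp_sup_mem h.2 h'.2⟩
  le_sup_left := by
    rintro ⟨a⟩ ⟨b⟩
    exact hF.himp_mem_of_le le_sup_left
  le_sup_right := by
    rintro ⟨a⟩ ⟨b⟩
    exact hF.himp_mem_of_le le_sup_right
  sup_le := by
    rintro ⟨a⟩ ⟨b⟩ ⟨c⟩ h h'
    exact hF.sup_himp_mem h h'
  inf := Quotient.map₂ (· ⊓ ·) fun _ _ h _ _ h' =>
    ⟨hF.inf_himp_inf_mem h.1 h'.1, hF.inf_himp_inf_mem h.2 h'.2⟩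
  inf_le_left := by
    rintro ⟨a⟩ ⟨b⟩
    exact hF.himp_mem_of_le inf_le_left
  inf_le_right := by
    rintro ⟨a⟩ ⟨b⟩
    exact hF.himp_mem_of_le inf_le_right
  le_inf := by
    rintro ⟨a⟩ ⟨b⟩ ⟨c⟩ h h'
    exact hF.himp_inf_mem h h'
  top := Quotient.mk _ ⊤
  le_top := Quotient.ind fun _ => hF.himp_mem_of_le le_top
  himp := Quotient.map₂ (· ⇨ ·) fun _ _ h _ _ h' =>
    ⟨hF.himp_himp_himp_mem h.2 h'.1, hF.himp_himp_himp_mem h.1 h'.2⟩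
  le_himp_iff := by
    rintro ⟨a⟩ ⟨b⟩ ⟨c⟩
    change a ⇨ b ⇨ c ∈ F ↔ a ⊓ b ⇨ c ∈ F
    rw [himp_himp]

end IsBrouwerianFilter

/-- Every filter is the kernel of a surjective homomorphism. -/
theorem IsBrouwerianFilter.exists_surjective_hom {α : Type u} [GeneralizedHeytingAlgebra α]
    {F : Set α} (hF : IsBrouwerianFilter F) :
    ∃ (C : Type u) (_ : GeneralizedHeytingAlgebra C) (q : α → C),
      IsBrouwerianHom q ∧ Function.Surjective q ∧ ∀ a, q a = ⊤ ↔ a ∈ F := by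
  refine ⟨hF.FilterQuotient, inferInstance, Quotient.mk _, ⟨fun _ _ => rfl, fun _ _ => rfl,
    fun _ _ => rfl, rfl⟩, Quotient.mk_surjective, fun a => ⟨fun h => ?_, fun h => ?_⟩⟩
  · have := (Quotient.exact h).2
    rwa [top_himp] at this
  · refine Quotient.sound ⟨hF.himp_mem_of_le le_top, ?_⟩
    rwa [top_himp]

section Subalgebra

variable {α : Type*} [GeneralizedHeytingAlgebra α] {S : Set α}

/-- Two distinct prime filters of an algebra have the same trace on a proper subalgebra. -/
theorem exists_prime_ne_of_notMem_subalgebra (htop : ⊤ ∈ S)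
    (hinf : ∀ a ∈ S, ∀ b ∈ S, a ⊓ b ∈ S) (hsup : ∀ a ∈ S, ∀ b ∈ S, a ⊔ b ∈ S)
    (himp : ∀ a ∈ S, ∀ b ∈ S, a ⇨ b ∈ S) {b : α} (hb : b ∉ S) :
    ∃ x y : Set α, IsPrimeBrouwerianFilter x ∧ IsPrimeBrouwerianFilter y ∧ x ≠ y ∧
      ∀ a ∈ S, a ∈ x ↔ a ∈ y := by
  have hbot : IsBrouwerianFilter ({⊤} : Set α) := by
    refine ⟨rfl, ?_, ?_⟩
    · rintro _ _ rfl rfl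
      simp
    · rintro a c hac rfl
      simpa using hac
  obtain ⟨x, hx, hle, hd⟩ :=
    (hbot.sup_of_inf_closed (T := {a | a ∈ S ∧ b ≤ a}) ⟨⊤, htop, le_top⟩
      fun a ha c hc => ⟨hinf a ha.1 c hc.1, le_inf ha.2 hc.2⟩).exists_prime_disjoint
      (I := {b}) (by simp) (by
        rintro a ⟨p, rfl, t, ht, hpt⟩ rfl
        rw [top_inf_eq] at hpt
        exact hb (le_antisymm hpt ht.2 ▸ ht.1))
  have hbx : b ∉ x := fun h => hd b h rfl
  have hxS : ∀ a ∈ S, b ≤ a → a ∈ x := fun a ha hba =>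
    hle ⟨⊤, rfl, a, ⟨ha, hba⟩, inf_le_right⟩
  obtain ⟨y, hy, hle', hd'⟩ :=
    ((hbot.sup_of_inf_closed (Set.singleton_nonempty b) (by simp)).sup_of_inf_closed
      (T := S ∩ x) ⟨⊤, htop, hx.top_mem⟩
      fun a ha c hc => ⟨hinf a ha.1 c hc.1, hx.inf_mem ha.2 hc.2⟩).exists_prime_disjoint
      (I := S \ x)
      (fun a ha c hc => ⟨hsup a ha.1 c hc.1, fun h =>
        (hx.mem_or_mem h).elim ha.2 hc.2⟩) (by
        rintro a ⟨p, ⟨_, rfl, _, rfl, hp⟩, t, ht, hpt⟩ ha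
        rw [top_inf_eq] at hp
        have hba := hxS (t ⇨ a) (himp t ht.1 a ha.1) (hp.trans (le_himp_iff.2 hpt))
        exact ha.2 (hx.mp hba ht.2))
  refine ⟨x, y, hx, hy, ?_, fun a ha => ⟨fun h => ?_, fun h => ?_⟩⟩
  · rintro rfl
    exact hbx (hle' ⟨b, ⟨⊤, rfl, b, rfl, inf_le_right⟩, ⊤, ⟨htop, hx.top_mem⟩, inf_le_left⟩)
  · exact hle' ⟨⊤, ⟨⊤, rfl, b, rfl, le_top⟩, a, ⟨ha, h⟩, inf_le_right⟩
  · by_contra hax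
    exact hd' a h ⟨ha, hax⟩

/-- Restricting prime filters to a subalgebra is a p-morphism. -/
theorem exists_prime_superset_trace_eq (htop : ⊤ ∈ S)
    (hinf : ∀ a ∈ S, ∀ b ∈ S, a ⊓ b ∈ S) (hsup : ∀ a ∈ S, ∀ b ∈ S, a ⊔ b ∈ S)
    (himp : ∀ a ∈ S, ∀ b ∈ S, a ⇨ b ∈ S) {y z : Set α} (hy : IsPrimeBrouwerianFilter y)
    (hz : IsPrimeBrouwerianFilter z) (hyz : ∀ a ∈ S, a ∈ y → a ∈ z) :
    ∃ w : Set α, IsPrimeBrouwerianFilter w ∧ y ⊆ w ∧ ∀ a ∈ S, a ∈ z ↔ a ∈ w := by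
  obtain ⟨w, hw, hle, hd⟩ :=
    (hy.sup_of_inf_closed (T := S ∩ z) ⟨⊤, htop, hz.top_mem⟩
      fun a ha c hc => ⟨hinf a ha.1 c hc.1, hz.inf_mem ha.2 hc.2⟩).exists_prime_disjoint
      (I := S \ z)
      (fun a ha c hc => ⟨hsup a ha.1 c hc.1, fun h =>
        (hz.mem_or_mem h).elim ha.2 hc.2⟩) (by
        rintro a ⟨p, hp, t, ht, hpt⟩ ha
        exact ha.2 (hz.mp (hyz _ (himp t ht.1 a ha.1)
          (hy.mem_of_le (le_himp_iff.2 hpt) hp)) ht.2))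
  refine ⟨w, hw, fun p hp => hle ⟨p, hp, ⊤, ⟨htop, hz.top_mem⟩, inf_le_left⟩,
    fun a ha => ⟨fun h => hle ⟨⊤, hy.top_mem, a, ⟨ha, h⟩, inf_le_right⟩, fun h => ?_⟩⟩
  by_contra haz
  exact hd a h ⟨ha, haz⟩

theorem hTerm_mem_of_ssubset {x z : Set α} (hx : IsPrimeBrouwerianFilter x)
    (hz : IsPrimeBrouwerianFilter z) (hxz : x ⊂ z) {k : ℕ}
    (hk : ∀ a : ℕ → α, hTerm (k + 1) a ∈ x) (a : ℕ → α) : hTerm k a ∈ z := by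
  have hcongr : ∀ (m : ℕ) (f g : ℕ → α), (∀ i ≤ m, f i = g i) → hTerm m f = hTerm m g := by
    intro m f g
    induction m with
    | zero => exact fun h => h 0 le_rfl
    | succ m ih =>
      intro h
      simp only [hTerm, h (m + 1) le_rfl, ih fun i hi => h i (hi.trans m.le_succ)]
  obtain ⟨b, hbz, hbx⟩ := Set.exists_of_ssubset hxz
  have hmem := hk (Function.update a (k + 1) b)
  simp only [hTerm, Function.update_self] at hmem
  rw [hcongr k _ a fun i hi => Function.update_of_ne (by omega) _ _] at hmem
  exact hz.mp (hxz.1 ((hx.mem_or_mem hmem).resolve_left hbx)) hbz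

/-- In finite depth, some pair of prime filters with the same trace on a proper subalgebra
consists of points that are as close as possible in the order. -/
theorem exists_adjacent_primes {n : ℕ} (hdepth : ∀ a : ℕ → α, hTerm n a = ⊤) (htop : ⊤ ∈ S)
    (hinf : ∀ a ∈ S, ∀ b ∈ S, a ⊓ b ∈ S) (hsup : ∀ a ∈ S, ∀ b ∈ S, a ⊔ b ∈ S)
    (himp : ∀ a ∈ S, ∀ b ∈ S, a ⇨ b ∈ S) {b : α} (hb : b ∉ S) :
    ∃ x y : Set α, IsPrimeBrouwerianFilter x ∧ IsPrimeBrouwerianFilter y ∧ ¬ y ⊆ x ∧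
      (∀ a ∈ S, a ∈ x ↔ a ∈ y) ∧
      (∀ z, IsPrimeBrouwerianFilter z → x ⊂ z → y ⊆ z) ∧
      (x ⊆ y ∨ ∀ z, IsPrimeBrouwerianFilter z → y ⊂ z → x ⊆ z) := by
  classical
  let Q : ℕ → Set α → Set α → Prop := fun m x y =>
    IsPrimeBrouwerianFilter x ∧ IsPrimeBrouwerianFilter y ∧ x ≠ y ∧
      (∀ a ∈ S, a ∈ x ↔ a ∈ y) ∧ (∀ a, hTerm m a ∈ x) ∧ ∀ a, hTerm m a ∈ y
  have hex : ∃ m x y, Q m x y := by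
    obtain ⟨x, y, hx, hy, hne, htr⟩ :=
      exists_prime_ne_of_notMem_subalgebra htop hinf hsup himp hb
    exact ⟨n, x, y, hx, hy, hne, htr, fun a => hdepth a ▸ hx.top_mem,
      fun a => hdepth a ▸ hy.top_mem⟩
  have hspec := Nat.find_spec hex
  have hmin := fun m => Nat.find_min hex (m := m)
  generalize Nat.find hex = m at hspec hmin
  obtain ⟨x₀, y₀, hQ⟩ := hspec
  cases m with
  | zero =>
    obtain ⟨-, -, hne, -, h₁, h₂⟩ := hQ
    exact absurd (Set.ext fun a => iff_of_true (h₁ fun _ => a) (h₂ fun _ => a)) hne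
  | succ k =>
    have hinj : ∀ x y, ¬ Q k x y := fun x y h => hmin k k.lt_succ_self ⟨x, y, h⟩
    have lift : ∀ x y, Q (k + 1) x y → ∀ z, IsPrimeBrouwerianFilter z → x ⊂ z →
        y ⊆ z ∨ ∀ a ∈ S, a ∈ x ↔ a ∈ z := by
      rintro x y ⟨hx, hy, -, htr, hdx, hdy⟩ z hz hxz
      obtain ⟨w, hw, hyw, hzw⟩ := exists_prime_superset_trace_eq htop hinf hsup himp hy hz
        fun a ha hay => hxz.1 ((htr a ha).2 hay)
      rcases hyw.eq_or_ssubset with rfl | hyw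
      · exact Or.inr fun a ha => (htr a ha).trans (hzw a ha).symm
      · left
        by_cases hzw' : z = w
        · exact hzw' ▸ hyw.1
        · exact absurd ⟨hz, hw, hzw', hzw, hTerm_mem_of_ssubset hx hz hxz hdx,
            hTerm_mem_of_ssubset hy hw hyw hdy⟩ (hinj z w)
    by_cases hcomp : ∃ x y, Q (k + 1) x y ∧ x ⊂ y
    · obtain ⟨x, y, ⟨hx, hy, hne, htr, hdx, hdy⟩, hxy⟩ := hcomp
      refine ⟨x, y, hx, hy, hxy.2, htr, fun z hz hxz => ?_, Or.inl hxy.1⟩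
      rcases lift x y ⟨hx, hy, hne, htr, hdx, hdy⟩ z hz hxz with h | h
      · exact h
      · by_contra hyz
        exact hinj y z ⟨hy, hz, fun e => hyz e.le, fun a ha => (htr a ha).symm.trans (h a ha),
          hTerm_mem_of_ssubset hx hy hxy hdx, hTerm_mem_of_ssubset hx hz hxz hdx⟩
    · push Not at hcomp
      obtain ⟨hx, hy, hne, htr, hdx, hdy⟩ := id hQ
      have hQ' : Q (k + 1) y₀ x₀ := ⟨hy, hx, hne.symm, fun a ha => (htr a ha).symm, hdy, hdx⟩
      have up : ∀ x y, Q (k + 1) x y → ∀ z, IsPrimeBrouwerianFilter z → x ⊂ z → y ⊆ z := by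
        intro x y hq z hz hxz
        refine (lift x y hq z hz hxz).resolve_right fun h => ?_
        obtain ⟨hx, -, -, -, hdx, -⟩ := hq
        exact hcomp x z ⟨hx, hz, hxz.ne, h, hdx, fun a => hxz.1 (hdx a)⟩ hxz
      refine ⟨x₀, y₀, hx, hy, fun h => ?_, htr, up _ _ hQ, Or.inr (up _ _ hQ')⟩
      exact hcomp y₀ x₀ hQ' (h.ssubset_of_ne hne.symm)

end Subalgebra

open Classical in
/-- If the points strictly above `x` lie above `y`, and (unless `x ⊆ y`) conversely, then moving
the root of the quotient by `x` to `y` gives a second homomorphism into that quotient. -/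
theorem isBrouwerianHom_moveRoot {α β : Type*} [GeneralizedHeytingAlgebra α]
    [GeneralizedHeytingAlgebra β] {q : α → β} (hq : IsBrouwerianHom q) {x y : Set α}
    (hx : IsPrimeBrouwerianFilter x) (hy : IsPrimeBrouwerianFilter y)
    (hker : ∀ a, q a = ⊤ ↔ a ∈ x) {e : α} (hey : e ∈ y) (hex : e ∉ x)
    (hxy : ∀ b ∉ x, ∀ c ∈ y, b ⇨ c ∈ x)
    (hyx : ∀ b ∉ y, ∀ c ∈ x, c ∉ y → b ⇨ c ∈ y) :
    IsBrouwerianHom fun a => if a ∈ y then ⊤ else if a ∈ x then q e else q a := by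
  have hle : ∀ a b, q a ≤ q b ↔ a ⇨ b ∈ x := fun a b => by
    rw [← hker, hq.map_himp, himp_eq_top_iff]
  have hxy' : ∀ b ∉ x, ∀ c ∈ y, q b ≤ q c := fun b hb c hc => (hle b c).2 (hxy b hb c hc)
  have sup_mem : ∀ {P : Set α}, IsPrimeBrouwerianFilter P → ∀ a b,
      (a ⊔ b ∈ P ↔ a ∈ P ∨ b ∈ P) := fun hP a b =>
    ⟨hP.mem_or_mem, fun h => h.elim (hP.mem_of_le le_sup_left) (hP.mem_of_le le_sup_right)⟩
  have inf_mem : ∀ {P : Set α}, IsPrimeBrouwerianFilter P → ∀ a b,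
      (a ⊓ b ∈ P ↔ a ∈ P ∧ b ∈ P) := fun hP a b =>
    ⟨fun h => ⟨hP.mem_of_le inf_le_left h, hP.mem_of_le inf_le_right h⟩,
      fun h => hP.inf_mem h.1 h.2⟩
  have himp_mem : ∀ {P : Set α}, IsPrimeBrouwerianFilter P → ∀ a {b}, b ∈ P → a ⇨ b ∈ P :=
    fun hP a b hb => hP.mem_of_le le_himp hb
  have top_of_mem : ∀ {a}, a ∈ x → q a = ⊤ := fun h => (hker _).2 h
  have eq_e : ∀ a ∈ y, a ∉ x → q a = q e := fun a hay hax =>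
    le_antisymm (hxy' a hax e hey) (hxy' e hex a hay)
  have le_e : ∀ a ∉ x, q a ≤ q e := fun a hax => hxy' a hax e hey
  refine ⟨fun a b => ?_, fun a b => ?_, fun a b => ?_, ?_⟩
  · have h₁ := eq_e a
    have h₂ := eq_e b
    have h₃ := le_e a
    have h₄ := le_e b
    have h₅ := hxy' a
    have h₆ := hxy' b
    by_cases hay : a ∈ y <;> by_cases hby : b ∈ y <;> by_cases hax : a ∈ x <;>
      by_cases hbx : b ∈ x <;>
      simp_all [inf_mem hx, inf_mem hy, hq.map_inf]
  · have h₃ := le_e a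
    have h₄ := le_e b
    by_cases hay : a ∈ y <;> by_cases hby : b ∈ y <;> by_cases hax : a ∈ x <;>
      by_cases hbx : b ∈ x <;>
      simp_all [sup_mem hx, sup_mem hy, hq.map_sup]
  · by_cases hby : b ∈ y
    · simp [himp_mem hy a hby, hby]
    by_cases hay : a ∈ y
    · have hab : a ⇨ b ∉ y := fun h => hby (hy.mp h hay)
      by_cases hbx : b ∈ x
      · simp [hay, hby, hab, hbx, himp_mem hx a hbx]
      by_cases habx : a ⇨ b ∈ x
      · have hax : a ∉ x := fun h => hbx (hx.mp habx h)
        have : q b = q e :=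
          le_antisymm (le_e b hbx) (eq_e a hay hax ▸ (hle a b).2 habx)
        simp [hay, hby, hab, hbx, habx, this]
      · have : q (a ⇨ b) = q b := by
          refine le_antisymm ?_ ((hle _ _).2 (hx.himp_mem_of_le le_himp))
          have h₁ := hxy' _ habx a hay
          rw [hq.map_himp] at h₁ ⊢
          exact (le_inf le_rfl h₁).trans himp_inf_le
        simp [hay, hby, hab, hbx, habx, this]
    by_cases hbx : b ∈ x
    · have hab : a ⇨ b ∈ y := hyx a hay b hbx hby
      by_cases hax : a ∈ x
      · simp [hay, hby, hab, hax, hbx]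
      · simp [hay, hby, hab, hax, hbx, himp_eq_top_iff.2 (le_e a hax)]
    by_cases hax : a ∈ x
    · have habx : a ⇨ b ∉ x := fun h => hbx (hx.mp h hax)
      have heq : q (a ⇨ b) = q b := by simp [hq.map_himp, top_of_mem hax]
      by_cases hab : a ⇨ b ∈ y
      · have : q e ≤ q b := heq ▸ hxy' e hex _ hab
        simp [hay, hby, hab, hax, hbx, himp_eq_top_iff.2 this]
      · have hne : q e ⇨ q b ≤ q b := by
          rw [← hq.map_himp]
          by_cases heb : e ⇨ b ∈ x
          · refine absurd ?_ hab
            by_cases hey' : e ⇨ b ∈ y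
            · exact absurd (hy.mp hey' hey) hby
            · have h₁ := hyx a hay _ heb hey'
              rw [himp_left_comm] at h₁
              exact hy.mp h₁ hey
          · have h₁ := le_e _ heb
            rw [hq.map_himp] at h₁ ⊢
            exact (le_inf le_rfl h₁).trans himp_inf_le
        simp [hay, hby, hab, hax, hbx, habx, heq, le_antisymm hne le_himp]
    · have hcontr : ∀ {P : Set α}, a ⇨ (a ⇨ b) ∈ P → a ⇨ b ∈ P := fun h => by
        rwa [himp_idem] at h
      by_cases hab : a ⇨ b ∈ y
      · simp [hay, hby, hab, hax, hbx,
          himp_eq_top_iff.2 ((hle a b).2 (hcontr (hxy a hax _ hab)))]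
      · have habx : a ⇨ b ∉ x := fun h => hab (hcontr (hyx a hay _ h hab))
        simp [hay, hby, hab, hax, hbx, habx, hq.map_himp]
  · simp [hy.top_mem]

theorem es_brouwerian_variety_of_finite_depth (n : ℕ)
    (K : (A : Type u) → [inst : GeneralizedHeytingAlgebra A] → Prop)
    -- closure under homomorphic images
    (hH : ∀ (A : Type u) [GeneralizedHeytingAlgebra A] (B : Type u)
      [GeneralizedHeytingAlgebra B],
      K A → (∃ f : A → B, IsBrouwerianHom f ∧ Function.Surjective f) → K B)
    -- closure under subalgebras
    (hS : ∀ (A : Type u) [GeneralizedHeytingAlgebra A] (B : Type u)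
      [GeneralizedHeytingAlgebra B],
      K A → (∃ f : B → A, IsBrouwerianHom f ∧ Function.Injective f) → K B)
    -- closure under products
    (hP : ∀ (I : Type u) (A : I → Type u) [∀ i, GeneralizedHeytingAlgebra (A i)],
      (∀ i, K (A i)) → K (∀ i, A i))
    -- every member of `K` satisfies `hₙ ≈ ⊤`
    (hdepth : ∀ (A : Type u) [GeneralizedHeytingAlgebra A], K A →
      ∀ a : ℕ → A, hTerm n a = ⊤)
    {A B : Type u} [GeneralizedHeytingAlgebra A] [GeneralizedHeytingAlgebra B]
    (hA : K A) (hB : K B) (h : A → B) (hhom : IsBrouwerianHom h)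
    -- `h` is a `K`-epimorphism
    (hepi : ∀ (C : Type u) [GeneralizedHeytingAlgebra C], K C →
      ∀ g₁ g₂ : B → C, IsBrouwerianHom g₁ → IsBrouwerianHom g₂ →
        g₁ ∘ h = g₂ ∘ h → g₁ = g₂) :
    Function.Surjective h := by
  by_contra hsurj
  obtain ⟨b, hb⟩ := not_forall.1 hsurj
  obtain ⟨x, y, hx, hy, hnot, htr, hxy, hyx⟩ := exists_adjacent_primes (S := Set.range h)
    (hdepth B hB) ⟨⊤, hhom.map_top⟩
    (by rintro _ ⟨a, rfl⟩ _ ⟨c, rfl⟩; exact ⟨a ⊓ c, hhom.map_inf a c⟩)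
    (by rintro _ ⟨a, rfl⟩ _ ⟨c, rfl⟩; exact ⟨a ⊔ c, hhom.map_sup a c⟩)
    (by rintro _ ⟨a, rfl⟩ _ ⟨c, rfl⟩; exact ⟨a ⇨ c, hhom.map_himp a c⟩) (b := b) hb
  obtain ⟨e, hey, hex⟩ := Set.not_subset.1 hnot
  obtain ⟨C, _, q, hq, hqsurj, hker⟩ := hx.exists_surjective_hom
  classical
  have hmove := isBrouwerianHom_moveRoot hq hx hy hker hey hex
    (fun b hb c hc => by
      by_contra hbc
      obtain ⟨z, hz, hxz, hbz, hcz⟩ := hx.exists_prime_of_himp_notMem hbc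
      exact hcz (hxy z hz ⟨hxz, fun h => hb (h hbz)⟩ hc))
    (fun b hb c hc hcy => by
      by_contra hbc
      obtain ⟨z, hz, hyz, hbz, hcz⟩ := hy.exists_prime_of_himp_notMem hbc
      rcases hyx with hyx | hyx
      · exact hcy (hyx hc)
      · exact hcz (hyx z hz ⟨hyz, fun h => hb (h hbz)⟩ hc))
  have heq := hepi C (hH B C hB ⟨q, hq, hqsurj⟩) q _ hq hmove (by
    funext a
    have ha := htr (h a) ⟨a, rfl⟩
    by_cases hay : h a ∈ y
    · simp [hay, (hker (h a)).2 (ha.2 hay)]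
    · simp [hay, mt ha.1 hay])
  have hqe := congrFun heq e
  simp only [hey, if_true] at hqe
  exact hex ((hker e).1 hqe)
end

section
/- Epimorphism-surjectivity for finitely generated varieties of Heyting algebras: let B be a finite Heyting algebra and let K = HSP(B). Then every K-epimorphism h : A → A' with A, A' ∈ K (i.e., every Heyting homomorphism h between members of K such that for every C ∈ K and all Heyting homomorphisms g₁, g₂ : A' → C, g₁ ∘ h = g₂ ∘ h implies g₁ = g₂) is surjective. -/
/-!
STATEMENT 12: Epimorphism-surjectivity for finitely generated varieties of
Heyting algebras: for a finite Heyting algebra `B` and `K = HSP(B)`, every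
`K`-epimorphism between members of `K` is surjective.
-/

universe u

/-!
# Epimorphisms in finitely generated varieties of Heyting algebras

A prime filter of a bounded lattice is represented by its characteristic function, a bounded
lattice homomorphism to `Prop`. If `B` is finite, then every member `A` of `HSP(B)` satisfies a
pigeonhole identity which forces each prime filter of `A` to have only finitely many prime filters
above it. If `h : A → A'` is not surjective, two distinct prime filters of `A'` have the same
preimage in `A`. Choosing them suitably, one gets two distinct homomorphisms, agreeing on the range
of `h`, from `A'` to the finite Heyting algebra of upper sets of prime filters above one of them;
this algebra is a quotient of `A'`, hence a member of `HSP(B)`.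
-/

open scoped symmDiff

/-- Prime filters of a bounded lattice, as homomorphisms to `Prop`. -/
abbrev PrimeFilterHom (A : Type*) [Lattice A] [BoundedOrder A] := BoundedLatticeHom A Prop

namespace PrimeFilterHom

instance (A : Type*) [Lattice A] [BoundedOrder A] : PartialOrder (PrimeFilterHom A) :=
  PartialOrder.lift (fun P => (P : A → Prop)) DFunLike.coe_injective

section Lattice

variable {A : Type*} [Lattice A] [BoundedOrder A]

theorem le_iff {P Q : PrimeFilterHom A} : P ≤ Q ↔ ∀ a, P a → Q a := Iff.rfl

theorem apply_mono (P : PrimeFilterHom A) {a b : A} (hab : a ≤ b) : P a → P b :=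
  OrderHomClass.mono P hab

theorem apply_inf (P : PrimeFilterHom A) (a b : A) : P (a ⊓ b) ↔ P a ∧ P b := by
  rw [map_inf]; rfl

theorem apply_sup (P : PrimeFilterHom A) (a b : A) : P (a ⊔ b) ↔ P a ∨ P b := by
  rw [map_sup]; rfl

theorem apply_top (P : PrimeFilterHom A) : P ⊤ := by
  rw [map_top]; trivial

theorem not_apply_bot (P : PrimeFilterHom A) : ¬ P ⊥ := by
  rw [map_bot]; exact id

theorem apply_finset_sup (P : PrimeFilterHom A) {ι : Type*} (s : Finset ι) (a : ι → A) :
    P (s.sup a) ↔ ∃ i ∈ s, P (a i) := by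
  rw [map_finset_sup, Finset.sup_eq_iSup]
  simp

theorem apply_finset_inf (P : PrimeFilterHom A) {ι : Type*} (s : Finset ι) (a : ι → A) :
    P (s.inf a) ↔ ∀ i ∈ s, P (a i) := by
  rw [map_finset_inf, Finset.inf_eq_iInf]
  simp

theorem not_le_iff {P Q : PrimeFilterHom A} : ¬ P ≤ Q ↔ ∃ a, P a ∧ ¬ Q a := by
  rw [le_iff]; push Not; rfl

end Lattice

/-- The prime filter theorem for distributive lattices. -/
theorem exists_of_disjoint {A : Type*} [DistribLattice A] [BoundedOrder A] {F I : Set A}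
    (hF : F.Nonempty) (hFinf : ∀ a ∈ F, ∀ b ∈ F, a ⊓ b ∈ F)
    (hI : I.Nonempty) (hIsup : ∀ a ∈ I, ∀ b ∈ I, a ⊔ b ∈ I)
    (hFI : ∀ a ∈ F, ∀ b ∈ I, ¬ a ≤ b) :
    ∃ P : PrimeFilterHom A, (∀ a ∈ F, P a) ∧ ∀ b ∈ I, ¬ P b := by
  have hF' : Order.IsPFilter {x | ∃ a ∈ F, a ≤ x} := by
    refine Order.IsPFilter.of_def (hF.mono fun a ha => ⟨a, ha, le_rfl⟩) ?_ ?_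
    · rintro x ⟨a, ha, hax⟩ y ⟨b, hb, hby⟩
      exact ⟨a ⊓ b, ⟨_, hFinf a ha b hb, le_rfl⟩, inf_le_left.trans hax, inf_le_right.trans hby⟩
    · rintro x y hxy ⟨a, ha, hax⟩
      exact ⟨a, ha, hax.trans hxy⟩
  have hI' : Order.IsIdeal {x | ∃ a ∈ I, x ≤ a} := by
    refine ⟨?_, hI.mono fun a ha => ⟨a, ha, le_rfl⟩, ?_⟩
    · rintro x y hxy ⟨a, ha, hax⟩
      exact ⟨a, ha, hxy.trans hax⟩
    · rintro x ⟨a, ha, hax⟩ y ⟨b, hb, hby⟩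
      exact ⟨a ⊔ b, ⟨_, hIsup a ha b hb, le_rfl⟩, hax.trans le_sup_left, hby.trans le_sup_right⟩
  have hdisj : Disjoint (hF'.toPFilter : Set A) (hI'.toIdeal : Set A) := by
    rw [Set.disjoint_left]
    rintro x ⟨a, ha, hax⟩ ⟨b, hb, hxb⟩
    exact hFI a ha b hb (le_trans hax hxb)
  obtain ⟨J, hJ, hIJ, hFJ⟩ := DistribLattice.prime_ideal_of_disjoint_filter_ideal hdisj
  have htop : ⊤ ∉ J := fun h => Set.disjoint_left.1 hFJ
    (hF.elim fun a ha => ⟨a, ha, le_top⟩ : (⊤ : A) ∈ hF'.toPFilter) h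
  refine ⟨{ toFun := fun a => a ∉ J
            map_sup' := fun a b => ?_
            map_inf' := fun a b => ?_
            map_top' := ?_
            map_bot' := ?_ }, fun a ha hJa => ?_, fun b hb hJb => ?_⟩
  · simp only [Order.Ideal.sup_mem_iff, sup_Prop_eq, eq_iff_iff]
    tauto
  · simp only [inf_Prop_eq, eq_iff_iff]
    refine ⟨fun h => ⟨fun ha => h (J.lower inf_le_left ha), fun hb => h (J.lower inf_le_right hb)⟩,
      fun h hab => ?_⟩
    exact (hJ.mem_or_mem hab).elim h.1 h.2
  · simpa using htop
  · simp
  · exact Set.disjoint_left.1 hFJ (⟨a, ha, le_rfl⟩ : a ∈ hF'.toPFilter) hJa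
  · exact hJb (hIJ (⟨b, hb, le_rfl⟩ : b ∈ hI'.toIdeal))

section Heyting

variable {A A' : Type*} [HeytingAlgebra A] [HeytingAlgebra A']

theorem apply_himp_iff (P : PrimeFilterHom A) (a b : A) :
    P (a ⇨ b) ↔ ∀ Q, P ≤ Q → Q a → Q b := by
  refine ⟨fun h Q hPQ hQa => ?_, fun h => ?_⟩
  · exact Q.apply_mono himp_inf_le ((Q.apply_inf _ _).2 ⟨hPQ _ h, hQa⟩)
  · by_contra hP
    obtain ⟨Q, hQF, hQI⟩ := exists_of_disjoint (F := {x | ∃ p, P p ∧ x = p ⊓ a}) (I := {b})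
      ⟨_, ⊤, P.apply_top, rfl⟩
      (by
        rintro _ ⟨p, hp, rfl⟩ _ ⟨q, hq, rfl⟩
        exact ⟨p ⊓ q, (P.apply_inf _ _).2 ⟨hp, hq⟩, (inf_inf_distrib_right p q a).symm⟩)
      ⟨b, rfl⟩ (by rintro _ rfl _ rfl; exact sup_idem _)
      (by
        rintro _ ⟨p, hp, rfl⟩ _ rfl hle
        exact hP (P.apply_mono (le_himp_iff.2 hle) hp))
    refine hQI b rfl (h Q (fun p hp => ?_) ?_)
    · exact Q.apply_mono inf_le_left (hQF _ ⟨p, hp, rfl⟩)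
    · exact Q.apply_mono inf_le_right (hQF _ ⟨⊤, P.apply_top, rfl⟩)

theorem eq_of_apply_bihimp {P Q : PrimeFilterHom A} {a b : A} (h : P (a ⇔ b)) (hPQ : P ≤ Q) :
    Q a = Q b := by
  rw [bihimp, apply_inf] at h
  exact propext ⟨(P.apply_himp_iff _ _).1 h.2 Q hPQ, (P.apply_himp_iff _ _).1 h.1 Q hPQ⟩

/-- The preimage of a prime filter under a Heyting homomorphism. -/
noncomputable def comap (h : HeytingHom A A') (P : PrimeFilterHom A') : PrimeFilterHom A :=
  P.comp (h : BoundedLatticeHom A A')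

@[simp] theorem comap_apply (h : HeytingHom A A') (P : PrimeFilterHom A') (a : A) :
    comap h P a = P (h a) := rfl

theorem comap_mono (h : HeytingHom A A') {P Q : PrimeFilterHom A'} (hPQ : P ≤ Q) :
    comap h P ≤ comap h Q := fun a => hPQ (h a)

theorem exists_le_comap_eq (h : HeytingHom A A') {P : PrimeFilterHom A'} {Q : PrimeFilterHom A}
    (hPQ : comap h P ≤ Q) : ∃ P', P ≤ P' ∧ comap h P' = Q := by
  obtain ⟨P', hF, hI⟩ := exists_of_disjoint (F := {x | ∃ p q, P p ∧ Q q ∧ x = p ⊓ h q})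
    (I := {x | ∃ r, ¬ Q r ∧ x = h r})
    ⟨_, ⊤, ⊤, P.apply_top, Q.apply_top, rfl⟩
    (by
      rintro _ ⟨p, q, hp, hq, rfl⟩ _ ⟨p', q', hp', hq', rfl⟩
      refine ⟨p ⊓ p', q ⊓ q', (P.apply_inf _ _).2 ⟨hp, hp'⟩, (Q.apply_inf _ _).2 ⟨hq, hq'⟩, ?_⟩
      rw [map_inf, inf_inf_inf_comm])
    ⟨_, ⊥, Q.not_apply_bot, rfl⟩
    (by
      rintro _ ⟨r, hr, rfl⟩ _ ⟨r', hr', rfl⟩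
      exact ⟨r ⊔ r', by rw [apply_sup]; tauto, (map_sup h r r').symm⟩)
    (by
      rintro _ ⟨p, q, hp, hq, rfl⟩ _ ⟨r, hr, rfl⟩ hle
      have hqr : Q (q ⇨ r) := hPQ _ (by
        change P (h (q ⇨ r))
        rw [map_himp]
        exact P.apply_mono (le_himp_iff.2 hle) hp)
      exact hr ((Q.apply_himp_iff _ _).1 hqr Q le_rfl hq))
  refine ⟨P', fun p hp => P'.apply_mono inf_le_left (hF _ ⟨p, ⊤, hp, Q.apply_top, rfl⟩), ?_⟩
  refine DFunLike.ext _ _ fun q => propext ⟨fun hq => ?_, fun hq => ?_⟩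
  · by_contra hQ
    exact hI _ ⟨q, hQ, rfl⟩ hq
  · exact P'.apply_mono inf_le_right (hF _ ⟨⊤, q, P.apply_top, hq, rfl⟩)

theorem surjective_of_comap_injective (h : HeytingHom A A')
    (hinj : Function.Injective (comap h)) : Function.Surjective h := by
  by_contra hsurj
  obtain ⟨a, ha⟩ := not_forall.1 hsurj
  obtain ⟨Q, hQF, hQI⟩ := exists_of_disjoint (F := {x | ∃ b, a ≤ h b ∧ x = h b}) (I := {a})
    ⟨_, ⊤, by simp, rfl⟩
    (by
      rintro _ ⟨b, hb, rfl⟩ _ ⟨c, hc, rfl⟩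
      exact ⟨b ⊓ c, by rw [map_inf]; exact le_inf hb hc, (map_inf h b c).symm⟩)
    ⟨a, rfl⟩ (by rintro _ rfl _ rfl; exact sup_idem _)
    (by
      rintro _ ⟨b, hb, rfl⟩ _ rfl hle
      exact ha ⟨b, le_antisymm hle hb⟩)
  obtain ⟨P, hPF, hPI⟩ := exists_of_disjoint (F := {a}) (I := {x | ∃ b, ¬ Q (h b) ∧ x = h b})
    ⟨a, rfl⟩ (by rintro _ rfl _ rfl; exact inf_idem _)
    ⟨_, ⊥, by rw [map_bot]; exact Q.not_apply_bot, rfl⟩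
    (by
      rintro _ ⟨b, hb, rfl⟩ _ ⟨c, hc, rfl⟩
      exact ⟨b ⊔ c, by rw [map_sup, apply_sup]; tauto, (map_sup h b c).symm⟩)
    (by
      rintro _ rfl _ ⟨b, hb, rfl⟩ hle
      exact hb (hQF _ ⟨b, hle, rfl⟩))
  have hPQ : comap h P ≤ comap h Q := fun b hb => by
    by_contra hQ
    exact hPI _ ⟨b, hQ, rfl⟩ hb
  obtain ⟨P', hPP', hP'⟩ := exists_le_comap_eq h hPQ
  rw [← hinj hP'] at hQI
  exact hQI a rfl (hPP' a (hPF a rfl))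

/-- If every fibre strictly above `P` is a singleton, and `P`, `P'` lie in the same fibre, then
`P'` is below everything that is strictly above `P`. -/
theorem lt_of_comap_eq (h : HeytingHom A A') {P P' Q : PrimeFilterHom A'}
    (hPP' : comap h P = comap h P') (hne : P ≠ P') (hPQ : P < Q)
    (huniq : ∀ R, comap h Q = comap h R → R = Q) : P' < Q := by
  obtain ⟨R, hR, hRQ⟩ := exists_le_comap_eq h (hPP' ▸ comap_mono h hPQ.le : comap h P' ≤ comap h Q)
  obtain rfl := huniq R hRQ.symm
  refine lt_of_le_of_ne hR ?_
  rintro rfl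
  exact hne (huniq P hPP'.symm)

/-- If `comap h` is not injective, then, provided principal upper sets of prime filters are finite,
there are distinct `P`, `P'` in the same fibre such that the prime filters strictly above `P` are,
possibly together with `P`, those strictly above `P'`. -/
theorem exists_pair_of_not_injective (h : HeytingHom A A')
    (hfin : ∀ P : PrimeFilterHom A', (Set.Ici P).Finite)
    (hinj : ¬ Function.Injective (comap h)) :
    ∃ P P', P ≠ P' ∧ comap h P = comap h P' ∧ (∀ Q, P < Q → P' < Q) ∧
      ∀ Q, P' < Q → P ≤ Q := by
  simp only [Function.Injective, not_forall] at hinj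
  obtain ⟨P₀, P₁, h₀₁, hne⟩ := hinj
  obtain ⟨P, -, hP⟩ := ((hfin P₀).subset (Set.sep_subset _
    {P | ∃ P', P' ≠ P ∧ comap h P = comap h P'})).exists_le_maximal
    (a := P₀) ⟨le_refl P₀, P₁, Ne.symm hne, h₀₁⟩
  obtain ⟨hP₀, P₂, hne₂, h₂⟩ := hP.prop
  have huniq : ∀ Q, P < Q → ∀ R, comap h Q = comap h R → R = Q := by
    intro Q hPQ R hQR
    by_contra hR
    exact hP.not_gt ⟨le_trans hP₀ hPQ.le, R, hR, hQR⟩ hPQ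
  obtain ⟨P', -, hP'⟩ := ((hfin P₂).subset (Set.sep_subset _
    {R | R ≠ P ∧ comap h P = comap h R})).exists_le_maximal
    (a := P₂) ⟨le_refl P₂, hne₂, h₂⟩
  obtain ⟨hP₂, hne', hPP'⟩ := hP'.prop
  refine ⟨P, P', hne'.symm, hPP', fun Q hPQ => ?_, fun Q hP'Q => ?_⟩
  · exact lt_of_comap_eq h hPP' hne'.symm hPQ (huniq Q hPQ)
  · obtain ⟨R, hPR, hRQ⟩ := exists_le_comap_eq h (hPP' ▸ comap_mono h hP'Q.le :
      comap h P ≤ comap h Q)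
    rcases hPR.eq_or_lt with rfl | hPR
    · by_contra hPQ
      exact hP'.not_gt ⟨le_trans hP₂ hP'Q.le, fun hQ => hPQ hQ.ge, hRQ⟩ hP'Q
    · exact (huniq R hPR Q hRQ) ▸ hPR.le

end Heyting

section UpperSets

variable {A Z : Type*} [HeytingAlgebra A] [PartialOrder Z]

/-- The Heyting homomorphism dual to a p-morphism `σ` from a poset `Z` to the prime filters of `A`.
Upper sets of `Z` are written as lower sets of `Zᵒᵈ`. -/
def dualHom (σ : Z → PrimeFilterHom A) (hmono : Monotone σ)
    (hback : ∀ z Q, σ z ≤ Q → ∃ w, z ≤ w ∧ σ w = Q) : HeytingHom A (LowerSet Zᵒᵈ) where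
  toFun a := ⟨{z | σ (OrderDual.ofDual z) a}, fun _ _ hzw hz => hmono hzw a hz⟩
  map_sup' a b := by ext z; exact apply_sup _ a b
  map_inf' a b := by ext z; exact apply_inf _ a b
  map_bot' := by ext z; exact iff_of_false (not_apply_bot _) id
  map_himp' a b := by
    refine eq_of_forall_le_iff fun U => ?_
    rw [le_himp_iff]
    constructor
    · rintro hU z ⟨hzU, hza⟩
      exact (apply_himp_iff _ a b).1 (hU hzU) _ le_rfl hza
    · intro hU z hzU
      refine (apply_himp_iff _ a b).2 fun Q hQ hQa => ?_
      obtain ⟨w, hzw, rfl⟩ := hback _ Q hQ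
      exact hU (show OrderDual.toDual w ∈ U ⊓ _ from ⟨U.lower (OrderDual.toDual_le.2 hzw) hzU, hQa⟩)

theorem mem_dualHom {σ : Z → PrimeFilterHom A} {hmono : Monotone σ}
    {hback : ∀ z Q, σ z ≤ Q → ∃ w, z ≤ w ∧ σ w = Q} {a : A} {z : Zᵒᵈ} :
    z ∈ dualHom σ hmono hback a ↔ σ (OrderDual.ofDual z) a := Iff.rfl

theorem dualHom_surjective [Finite Z] {σ : Z → PrimeFilterHom A} {hmono : Monotone σ}
    {hback : ∀ z Q, σ z ≤ Q → ∃ w, z ≤ w ∧ σ w = Q} (hσ : ∀ z w, σ z ≤ σ w → z ≤ w) :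
    Function.Surjective (dualHom σ hmono hback) := by
  classical
  intro U
  have := Fintype.ofFinite Z
  have hsep : ∀ z w : Z, ∃ a, ¬ z ≤ w → σ z a ∧ ¬ σ w a := fun z w => by
    by_cases hzw : z ≤ w
    · exact ⟨⊤, fun h => absurd hzw h⟩
    · obtain ⟨a, ha⟩ := not_le_iff.1 (mt (hσ z w) hzw)
      exact ⟨a, fun _ => ha⟩
  choose a ha using hsep
  refine ⟨(Finset.univ.filter fun z => OrderDual.toDual z ∈ U).sup fun z =>
    (Finset.univ.filter fun w => OrderDual.toDual w ∉ U).inf (a z), ?_⟩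
  ext v
  change v ∈ dualHom σ hmono hback _ ↔ v ∈ U
  rw [mem_dualHom, apply_finset_sup]
  simp only [apply_finset_inf, Finset.mem_filter, Finset.mem_univ, true_and]
  constructor
  · rintro ⟨z, hzU, hz⟩
    by_contra hv
    exact (ha z _ fun hzv => hv (U.lower (OrderDual.le_toDual.2 hzv) hzU)).2 (hz _ hv)
  · intro hv
    refine ⟨OrderDual.ofDual v, hv, fun w hw => (ha _ w fun hvw => hw ?_).1⟩
    exact U.lower (OrderDual.toDual_le.2 hvw) hv

end UpperSets

end PrimeFilterHom

/-- An identity that holds in every Heyting algebra with fewer than `n` elements: among any `n`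
elements two are equivalent. -/
def PigeonholeIdentity (n : ℕ) (A : Type*) [HeytingAlgebra A] : Prop :=
  ∀ a : Fin n → A, ((Finset.univ : Finset (Fin n × Fin n)).filter fun p => p.1 ≠ p.2).sup
    (fun p => a p.1 ⇔ a p.2) = ⊤

theorem pigeonholeIdentity_of_finite (B : Type*) [HeytingAlgebra B] [Finite B] :
    PigeonholeIdentity (Nat.card B + 1) B := by
  intro a
  have hninj : ¬ Function.Injective a := fun ha => by
    simpa using Nat.card_le_card_of_injective a ha
  simp only [Function.Injective, not_forall] at hninj
  obtain ⟨i, j, ha, hij⟩ := hninj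
  refine top_le_iff.1 ?_
  calc ⊤ = a i ⇔ a j := by rw [ha, bihimp_self]
    _ ≤ _ := Finset.le_sup (f := fun p : Fin _ × Fin _ => a p.1 ⇔ a p.2) (b := (i, j))
      (by simpa using hij)

namespace PigeonholeIdentity

variable {n : ℕ} {A A' : Type*} [HeytingAlgebra A] [HeytingAlgebra A']

theorem pi {I : Type*} (hA : PigeonholeIdentity n A) : PigeonholeIdentity n (I → A) := by
  intro a
  ext i
  rw [Finset.sup_apply]
  exact hA fun k => a k i

theorem of_injective (hA' : PigeonholeIdentity n A') (f : HeytingHom A A')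
    (hf : Function.Injective f) : PigeonholeIdentity n A := by
  intro a
  apply hf
  rw [map_finset_sup, map_top, ← hA' (f ∘ a)]
  congr 1
  ext p
  exact map_bihimp f _ _

theorem of_surjective (hA : PigeonholeIdentity n A) (g : HeytingHom A A')
    (hg : Function.Surjective g) : PigeonholeIdentity n A' := by
  intro a
  choose b hb using fun i => hg (a i)
  rw [← map_top g, ← hA b, map_finset_sup]
  congr 1
  ext p
  simp [map_bihimp, hb]

open PrimeFilterHom in
theorem finite_Ici (hA : PigeonholeIdentity n A) (P : PrimeFilterHom A) : (Set.Ici P).Finite := by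
  let ev : A → Set.Ici P → Prop := fun a Q => Q.1 a
  have hev : Finite (Set.range ev) := by
    by_contra hinf
    rw [not_finite_iff_infinite] at hinf
    choose a ha using fun i : Fin n => ((Infinite.natEmbedding (Set.range ev)) i).2
    have htop := P.apply_top
    rw [← hA a, apply_finset_sup] at htop
    obtain ⟨⟨i, j⟩, hij, hP⟩ := htop
    refine (Finset.mem_filter.1 hij).2 (Fin.ext ?_)
    apply (Infinite.natEmbedding (Set.range ev)).injective
    rw [Subtype.ext_iff, ← ha, ← ha]
    exact funext fun Q => eq_of_apply_bihimp hP Q.2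
  refine Set.finite_coe_iff.1 (Finite.of_injective
    (fun (Q : Set.Ici P) (e : Set.range ev) => e.1 Q) fun Q R hQR => ?_)
  exact Subtype.ext (DFunLike.ext _ _ fun a => congrFun hQR ⟨ev a, a, rfl⟩)

end PigeonholeIdentity

theorem HeytingInHSP.pigeonholeIdentity {B A : Type u} [HeytingAlgebra B] [Finite B]
    [HeytingAlgebra A] (hA : HeytingInHSP B A) : PigeonholeIdentity (Nat.card B + 1) A := by
  obtain ⟨I, S, f, g, hf, hg⟩ := hA
  exact ((pigeonholeIdentity_of_finite B).pi.of_injective f hf).of_surjective g hg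

theorem HeytingInHSP.of_surjective {B A C : Type u} [HeytingAlgebra B] [HeytingAlgebra A]
    [HeytingAlgebra C] (hA : HeytingInHSP B A) (k : HeytingHom A C)
    (hk : Function.Surjective k) : HeytingInHSP B C := by
  obtain ⟨I, S, f, g, hf, hg⟩ := hA
  exact ⟨I, S, f, k.comp g, hf, hk.comp hg⟩

theorem es_finitely_generated_heyting_variety
    (B : Type u) [HeytingAlgebra B] [Finite B]
    {A A' : Type u} [HeytingAlgebra A] [HeytingAlgebra A']
    (hA : HeytingInHSP B A) (hA' : HeytingInHSP B A')
    (h : HeytingHom A A')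
    -- `h` is an `HSP(B)`-epimorphism
    (hepi : ∀ (C : Type u) [HeytingAlgebra C], HeytingInHSP B C →
      ∀ g₁ g₂ : HeytingHom A' C, g₁.comp h = g₂.comp h → g₁ = g₂) :
    Function.Surjective h := by
  classical
  refine PrimeFilterHom.surjective_of_comap_injective h ?_
  by_contra hinj
  have hfin : ∀ P : PrimeFilterHom A', (Set.Ici P).Finite := hA'.pigeonholeIdentity.finite_Ici
  obtain ⟨P, P', hne, hPP', hlt, hle⟩ :=
    PrimeFilterHom.exists_pair_of_not_injective h hfin hinj
  have : Finite (Set.Ici P') := (hfin P').to_subtype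
  let σ : Set.Ici P' → PrimeFilterHom A' := fun z => if z.1 = P' then P else z.1
  have hσP' : ∀ z : Set.Ici P', z.1 = P' → σ z = P := fun z hz => if_pos hz
  have hσ : ∀ z : Set.Ici P', z.1 ≠ P' → σ z = z.1 := fun z hz => if_neg hz
  have hne_of_lt : ∀ {z w : Set.Ici P'}, z.1 ≠ P' → z.1 ≤ w.1 → w.1 ≠ P' :=
    fun {z w} hz hzw hw => hz (le_antisymm (hzw.trans_eq hw) z.2)
  have hmono : Monotone σ := by
    intro z w hzw
    by_cases hz : z.1 = P'
    · by_cases hw : w.1 = P'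
      · rw [hσP' z hz, hσP' w hw]
      · rw [hσP' z hz, hσ w hw]
        exact hle _ (lt_of_le_of_ne w.2 (Ne.symm hw))
    · rw [hσ z hz, hσ w (hne_of_lt hz hzw)]
      exact hzw
  have hback : ∀ z Q, σ z ≤ Q → ∃ w, z ≤ w ∧ σ w = Q := by
    intro z Q hzQ
    by_cases hz : z.1 = P'
    · rw [hσP' z hz] at hzQ
      rcases hzQ.eq_or_lt with rfl | hPQ
      · exact ⟨z, le_rfl, hσP' z hz⟩
      · have hP'Q := hlt Q hPQ
        exact ⟨⟨Q, hP'Q.le⟩, hz.trans_le hP'Q.le, hσ _ hP'Q.ne'⟩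
    · rw [hσ z hz] at hzQ
      exact ⟨⟨Q, le_trans z.2 hzQ⟩, hzQ, hσ _ (hne_of_lt (w := ⟨Q, le_trans z.2 hzQ⟩) hz hzQ)⟩
  let g₁ : HeytingHom A' (LowerSet (Set.Ici P')ᵒᵈ) := PrimeFilterHom.dualHom Subtype.val
    (fun _ _ hzw => hzw) fun z Q hzQ => ⟨⟨Q, le_trans z.2 hzQ⟩, hzQ, rfl⟩
  let g₂ : HeytingHom A' (LowerSet (Set.Ici P')ᵒᵈ) := PrimeFilterHom.dualHom σ hmono hback
  have hg₁ : Function.Surjective g₁ := PrimeFilterHom.dualHom_surjective fun _ _ hzw => hzw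
  have hσcomap : ∀ z, PrimeFilterHom.comap h (σ z) = PrimeFilterHom.comap h z.1 := fun z => by
    by_cases hz : z.1 = P'
    · rw [hσP' z hz, hz, hPP']
    · rw [hσ z hz]
  have hg : g₁ = g₂ := by
    refine hepi _ (hA'.of_surjective g₁ hg₁) g₁ g₂ ?_
    ext a z
    exact (DFunLike.congr_fun (hσcomap (OrderDual.ofDual z)) a).symm.to_iff
  refine hne (DFunLike.ext _ _ fun a => ?_)
  have hmem : (OrderDual.toDual ⟨P', Set.self_mem_Ici⟩ ∈ g₁ a) =
      (OrderDual.toDual ⟨P', Set.self_mem_Ici⟩ ∈ g₂ a) := by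
    rw [hg]
  change P' a = σ ⟨P', Set.self_mem_Ici⟩ a at hmem
  rw [hmem, hσP' _ rfl]
end
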